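/- arXiv:1412.5641 — 4 statements merged into one kernel-verified Lean document; each statement's English description precedes it below -/
import Mathlib

section
/- Let 0 < ε < ε₀ and α > 0, and set δ(x) = dist(x, ∂D_ε). There exists a constant C > 0 independent of ε such that for every u ∈ W^{1,1}(D_ε; δ^α) the Hardy-type inequality ‖u‖_{L^1(Γ_ε; δ^{α−1})} ≤ (C/α) ( ε^α ‖u‖_{W^{1,1}(D)} + ‖∇u‖_{L^1(Γ_ε; δ^α)} ) holds, where ‖u‖_{W^{1,1}(D)} is the unweighted W^{1,1}-norm of the restriction of u to D. -/
open MeasureTheory ENNReal Set Filter Topology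
open scoped RealInnerProductSpace

noncomputable section

/-- The weighted measure `w dx` restricted to the set `U`. -/
def wMeas {n : ℕ} (U : Set (EuclideanSpace ℝ (Fin n)))
    (w : EuclideanSpace ℝ (Fin n) → ℝ) : Measure (EuclideanSpace ℝ (Fin n)) :=
  (volume.restrict U).withDensity fun x => ENNReal.ofReal (w x)

/-- At `x`, the function `f` increases with slope arbitrarily close to `1` along nearby points. -/
def HasUnitSlope {X : Type*} [PseudoMetricSpace X] (f : X → ℝ) (x : X) : Prop :=
  ∀ c < (1 : ℝ), ∀ r > (0 : ℝ), ∃ z, 0 < dist z x ∧ dist z x < r ∧ f x + c * dist z x ≤ f z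

theorem HasUnitSlope.congr {X : Type*} [PseudoMetricSpace X] {f g : X → ℝ} {x : X}
    (hf : HasUnitSlope f x) (h : f =ᶠ[𝓝 x] g) : HasUnitSlope g x := by
  intro c hc r hr
  obtain ⟨δ, hδ, hball⟩ := Metric.eventually_nhds_iff.1 h
  obtain ⟨z, hz0, hzr, hz⟩ := hf c hc (min r δ) (lt_min hr hδ)
  refine ⟨z, hz0, hzr.trans_le (min_le_left _ _), ?_⟩
  rw [← hball (hzr.trans_le (min_le_right _ _)), ← h.self_of_nhds]
  exact hz

/-- A function with unit slope at the points of a ball attains on the sphere the largest value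
allowed by a `1`-Lipschitz bound. -/
theorem exists_dist_eq_and_add_le {X : Type*} [MetricSpace X] [ProperSpace X] {f : X → ℝ}
    (hf : Continuous f) {x : X} {s : ℝ} (hs : 0 < s)
    (h : ∀ y, dist y x < s → f x ≤ f y → HasUnitSlope f y) :
    ∃ y, dist y x = s ∧ f x + s ≤ f y := by
  have key : ∀ c, 0 ≤ c → c < 1 → ∃ y ∈ Metric.sphere x s, f x + c * s ≤ f y := by
    intro c hc0 hc1
    obtain ⟨y, hy, hmax⟩ := (isCompact_closedBall x s).exists_isMaxOn
      ⟨x, Metric.mem_closedBall_self hs.le⟩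
      (f := fun y => f y - c * dist y x) (by fun_prop)
    have hx := hmax (Metric.mem_closedBall_self hs.le)
    simp only [mem_ofPred_eq, dist_self, mul_zero, sub_zero] at hx
    rcases (Metric.mem_closedBall.1 hy).lt_or_eq with hlt | heq
    · exfalso
      have hfx : f x ≤ f y := by nlinarith [mul_nonneg hc0 (dist_nonneg (x := y) (y := x))]
      obtain ⟨z, hz0, hzr, hz⟩ := h y hlt hfx ((1 + c) / 2) (by linarith) (s - dist y x)
        (by linarith)
      have htri := dist_triangle z y x
      have hzb : z ∈ Metric.closedBall x s := by
        rw [Metric.mem_closedBall]; linarith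
      have hm := hmax hzb
      simp only [mem_ofPred_eq] at hm
      nlinarith [mul_le_mul_of_nonneg_left htri hc0]
    · exact ⟨y, heq, by rw [heq] at hx; linarith⟩
  obtain ⟨y₀, hy₀, -⟩ := key 0 le_rfl one_pos
  obtain ⟨y, hy, hmax⟩ := (isCompact_sphere x s).exists_isMaxOn ⟨y₀, hy₀⟩ hf.continuousOn
  refine ⟨y, hy, le_of_forall_pos_le_add fun e he => ?_⟩
  obtain ⟨z, hz, hfz⟩ := key (max 0 (1 - e / s)) (le_max_left _ _)
    (max_lt one_pos (by have := div_pos he hs; linarith))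
  have h1 : f z ≤ f y := hmax hz
  have h2 : (1 - e / s) * s ≤ max 0 (1 - e / s) * s :=
    mul_le_mul_of_nonneg_right (le_max_right _ _) hs.le
  have h3 : (1 - e / s) * s = s - e := by field_simp
  linarith

section Rays

variable {E : Type*} [NormedAddCommGroup E] [InnerProductSpace ℝ E]

/-- If the values of a `1`-Lipschitz function at `y`, `x`, `z` decrease at full speed, then `x` lies
on the segment from `z` to `y`. -/
theorem sameRay_sub_of_lipschitz {f : E → ℝ} (hf : LipschitzWith 1 f) {x y z : E}
    (hy : f x + dist y x ≤ f y) (hz : f z ≤ f x - dist z x) : SameRay ℝ (y - x) (x - z) := by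
  rw [sameRay_iff_norm_add]
  refine le_antisymm (norm_add_le _ _) ?_
  have h := (le_abs_self _).trans (hf.dist_le_mul y z)
  rw [sub_add_sub_cancel, ← dist_eq_norm, ← dist_eq_norm, ← dist_eq_norm, dist_comm x z]
  simp only [NNReal.coe_one, one_mul] at h
  linarith

/-- Through every point of `{|f| < R}` there is a line along which a `1`-Lipschitz function `f` that
has unit slope upwards and downwards grows at unit speed. -/
theorem exists_unit_direction [ProperSpace E] {f : E → ℝ} (hf : LipschitzWith 1 f) {R : ℝ}
    (hup : ∀ y, |f y| < R → HasUnitSlope f y)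
    (hdown : ∀ y, |f y| < R → HasUnitSlope (fun z => -f z) y) {x : E} (hx : |f x| < R) :
    ∃ v : E, ‖v‖ = 1 ∧ ∀ s, |f x + s| < R → f (x + s • v) = f x + s := by
  obtain ⟨hx1, hx2⟩ := abs_lt.1 hx
  have up : ∀ s, 0 < s → f x + s < R → ∃ y, dist y x = s ∧ f x + s ≤ f y := by
    intro s hs hsR
    refine exists_dist_eq_and_add_le hf.continuous hs fun y hy hxy => hup y ?_
    have h := (le_abs_self _).trans (hf.dist_le_mul y x)
    simp only [NNReal.coe_one, one_mul] at h
    exact abs_lt.2 ⟨by linarith, by linarith⟩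
  have down : ∀ s, 0 < s → -R < f x - s → ∃ z, dist z x = s ∧ f z ≤ f x - s := by
    intro s hs hsR
    obtain ⟨z, hz, hfz⟩ := exists_dist_eq_and_add_le (f := fun z => -f z) hf.continuous.neg hs
      fun y hy hxy => hdown y (by
      have h := (neg_le_abs _).trans (hf.dist_le_mul y x)
      simp only [NNReal.coe_one, one_mul] at h
      exact abs_lt.2 ⟨by linarith, by linarith⟩)
    exact ⟨z, hz, by linarith⟩
  obtain ⟨a, ha0, haR⟩ : ∃ a, 0 < a ∧ -R < f x - a := ⟨(f x + R) / 2, by linarith, by linarith⟩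
  obtain ⟨b, hb0, hbR⟩ : ∃ b, 0 < b ∧ f x + b < R := ⟨(R - f x) / 2, by linarith, by linarith⟩
  obtain ⟨z, hz, hfz⟩ := down a ha0 haR
  obtain ⟨y, hy, hfy⟩ := up b hb0 hbR
  have hxz : ‖x - z‖ = a := by rw [← dist_eq_norm, dist_comm, hz]
  have hyx : ‖y - x‖ = b := by rw [← dist_eq_norm, hy]
  have hray := (sameRay_sub_of_lipschitz hf (hy ▸ hfy) (hz ▸ hfz)).norm_smul_eq
  rw [hxz, hyx] at hray
  refine ⟨a⁻¹ • (x - z), by rw [norm_smul, hxz, norm_inv, Real.norm_of_nonneg ha0.le,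
    inv_mul_cancel₀ ha0.ne'], fun s hs => ?_⟩
  obtain ⟨hs1, hs2⟩ := abs_lt.1 hs
  have lip : ∀ p q, f p - f q ≤ dist p q := fun p q => by
    simpa using (le_abs_self _).trans (hf.dist_le_mul p q)
  rcases lt_trichotomy s 0 with h0 | rfl | h0
  · obtain ⟨w, hw, hfw⟩ := down (-s) (by linarith) (by linarith)
    have h1 := (sameRay_sub_of_lipschitz hf (hy ▸ hfy) (hw ▸ hfw)).norm_smul_eq
    rw [hyx, ← dist_eq_norm, dist_comm, hw] at h1
    have h2 : w = x + s • a⁻¹ • (x - z) := by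
      have h3 : y - x = a⁻¹ • b • (x - z) := by rw [hray, inv_smul_smul₀ ha0.ne']
      rw [h3, smul_comm _ b, smul_comm _ b] at h1
      have h4 := smul_right_injective E hb0.ne' h1
      rw [neg_smul] at h4
      rw [← sub_neg_eq_add, ← h4]
      abel
    rw [← h2]
    have := lip x w
    rw [dist_comm, hw] at this
    linarith
  · simp
  · obtain ⟨w, hw, hfw⟩ := up s h0 (by linarith)
    have h1 := (sameRay_sub_of_lipschitz hf (hw ▸ hfw) (hz ▸ hfz)).norm_smul_eq
    rw [hxz, ← dist_eq_norm, hw] at h1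
    have h2 : w = x + s • a⁻¹ • (x - z) := by
      rw [smul_comm, h1, inv_smul_smul₀ ha0.ne']; abel
    rw [← h2]
    have := lip w x
    rw [hw] at this
    linarith

/-- The direction of unit-speed growth of a `1`-Lipschitz function is Lipschitz. -/
theorem mul_norm_direction_sub_le {f : E → ℝ} (hf : LipschitzWith 1 f) {ρ : ℝ} (hρ : 0 < ρ)
    {x y v w : E} (hv : ‖v‖ = 1) (hw : ‖w‖ = 1)
    (hx₁ : f (x + ρ • v) = f x + ρ) (hx₂ : f (x - ρ • v) = f x - ρ)
    (hy₁ : f (y + ρ • w) = f y + ρ) (hy₂ : f (y - ρ • w) = f y - ρ) :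
    ρ * ‖v - w‖ ≤ dist x y := by
  have lip : ∀ p q, f p - f q ≤ ‖p - q‖ := fun p q => by
    simpa [dist_eq_norm] using (le_abs_self _).trans (hf.dist_le_mul p q)
  rcases le_or_gt (2 * ρ) (dist x y) with h | h
  · have : ‖v - w‖ ≤ 2 := (norm_sub_le _ _).trans (by rw [hv, hw]; norm_num)
    nlinarith
  rw [dist_eq_norm] at h ⊢
  have h1 := lip (x + ρ • v) (y - ρ • w)
  have h2 := lip (y + ρ • w) (x - ρ • v)
  have e1 : x + ρ • v - (y - ρ • w) = (x - y) + ρ • (v + w) := by rw [smul_add]; abel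
  have e2 : y + ρ • w - (x - ρ • v) = -((x - y) - ρ • (v + w)) := by rw [smul_add]; abel
  rw [hx₁, hy₂, e1] at h1
  rw [hy₁, hx₂, e2, norm_neg] at h2
  have h3 := lip x y
  have h4 := lip y x
  rw [norm_sub_rev] at h4
  have p1 := parallelogram_law_with_norm ℝ (x - y) (ρ • (v + w))
  have p2 := parallelogram_law_with_norm ℝ v w
  rw [norm_smul, Real.norm_of_nonneg hρ.le] at p1
  rw [hv, hw] at p2
  have q1 := mul_self_le_mul_self (by linarith) h1
  have q2 := mul_self_le_mul_self (by linarith) h2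
  refine abs_le_of_sq_le_sq' ?_ (norm_nonneg _) |>.2
  nlinarith [sq_nonneg (f x - f y)]

end Rays

section UnitSlope

variable {E : Type*} [NormedAddCommGroup E]

theorem one_le_norm_fderiv_of_hasUnitSlope [NormedSpace ℝ E] {f : E → ℝ} {x : E}
    (hf : DifferentiableAt ℝ f x) (h : HasUnitSlope f x) : 1 ≤ ‖fderiv ℝ f x‖ := by
  refine le_of_forall_pos_le_add fun e he => ?_
  obtain ⟨r, hr, hball⟩ := Metric.eventually_nhds_iff.1 (hf.hasFDerivAt.isLittleO.bound (half_pos he))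
  obtain ⟨z, hz0, hzr, hz⟩ := h (1 - e / 2) (by linarith) r hr
  have h1 := (le_abs_self _).trans (hball hzr)
  have h2 := (le_abs_self _).trans ((fderiv ℝ f x).le_opNorm (z - x))
  rw [← dist_eq_norm] at h1 h2
  have h3 : 1 * dist z x ≤ (‖fderiv ℝ f x‖ + e) * dist z x := by linarith
  exact le_of_mul_le_mul_right h3 hz0

theorem hasUnitSlope_of_one_le_norm_fderiv [NormedSpace ℝ E] {f : E → ℝ} {x : E}
    (hf : DifferentiableAt ℝ f x) (h : 1 ≤ ‖fderiv ℝ f x‖) : HasUnitSlope f x := by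
  intro c hc r hr
  obtain ⟨m, hcm, hm1⟩ := exists_between (max_lt hc one_pos)
  have hm0 : 0 < m := (le_max_right _ _).trans_lt hcm
  obtain ⟨v, hv⟩ : ∃ v, m * ‖v‖ < fderiv ℝ f x v := by
    by_contra! hcon
    have : ‖fderiv ℝ f x‖ ≤ m := ContinuousLinearMap.opNorm_le_bound _ hm0.le fun v =>
      abs_le.2 ⟨by have := hcon (-v); rw [norm_neg, map_neg] at this; linarith, hcon v⟩
    linarith
  have hv0 : 0 < ‖v‖ := by
    rw [norm_pos_iff]; rintro rfl; simp at hv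
  have hmc : 0 < m - c := by have := (le_max_left c 0).trans_lt hcm; linarith
  obtain ⟨r', hr', hball⟩ := Metric.eventually_nhds_iff.1 (hf.hasFDerivAt.isLittleO.bound hmc)
  obtain ⟨t, ht0, ht⟩ := exists_between (lt_min hr hr')
  have ht' : 0 < t / ‖v‖ := div_pos ht0 hv0
  have hd : dist (x + (t / ‖v‖) • v) x = t := by
    rw [dist_eq_norm, add_sub_cancel_left, norm_smul, Real.norm_of_nonneg ht'.le,
      div_mul_cancel₀ _ hv0.ne']
  refine ⟨x + (t / ‖v‖) • v, by rwa [hd], by rw [hd]; exact ht.trans_le (min_le_left _ _), ?_⟩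
  have h1 := (neg_le_abs _).trans
    (hball (y := x + (t / ‖v‖) • v) (by rw [hd]; exact ht.trans_le (min_le_right _ _)))
  rw [← dist_eq_norm, hd, add_sub_cancel_left, map_smul, smul_eq_mul] at h1
  have h2 : t / ‖v‖ * (m * ‖v‖) ≤ t / ‖v‖ * fderiv ℝ f x v :=
    mul_le_mul_of_nonneg_left hv.le ht'.le
  have h3 : t / ‖v‖ * (m * ‖v‖) = m * t := by field_simp
  rw [hd]
  linarith

theorem hasUnitSlope_neg_infDist [NormedSpace ℝ E] {F : Set E} {x p : E} (hp : p ∈ F)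
    (hxp : dist x p = Metric.infDist x F) (hpos : 0 < Metric.infDist x F) :
    HasUnitSlope (fun z => -Metric.infDist z F) x := by
  intro c hc r hr
  set δ := Metric.infDist x F
  obtain ⟨t, ht0, ht⟩ := exists_between (lt_min hr hpos)
  have hn : ‖p - x‖ = δ := by rw [← dist_eq_norm, dist_comm, hxp]
  have hd : dist (x + (t / δ) • (p - x)) x = t := by
    rw [dist_eq_norm, add_sub_cancel_left, norm_smul, hn, Real.norm_of_nonneg (by positivity),
      div_mul_cancel₀ _ hpos.ne']
  refine ⟨x + (t / δ) • (p - x), by rwa [hd], by rw [hd]; exact ht.trans_le (min_le_left _ _), ?_⟩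
  have htδ := ht.trans_le (min_le_right _ _)
  have h1 : dist (x + (t / δ) • (p - x)) p = δ - t := by
    have : x + (t / δ) • (p - x) - p = -((1 - t / δ) • (p - x)) := by module
    rw [dist_eq_norm, this, norm_neg, norm_smul, hn, Real.norm_of_nonneg
      (by rw [sub_nonneg, div_le_one hpos]; exact htδ.le)]
    field_simp
  have h2 := Metric.infDist_le_dist_of_mem (x := x + (t / δ) • (p - x)) hp
  rw [h1] at h2
  rw [hd]
  simp only
  nlinarith

/-- The distance function to a compact set has unit slope at the points outside the set whose
nearest point is unique. -/
theorem hasUnitSlope_infDist [InnerProductSpace ℝ E] {F : Set E} (hF : IsCompact F) {x p : E}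
    (hp : p ∈ F) (hxp : dist x p = Metric.infDist x F) (hpos : 0 < Metric.infDist x F)
    (huniq : ∀ q ∈ F, dist x q = Metric.infDist x F → q = p) :
    HasUnitSlope (fun z => Metric.infDist z F) x := by
  intro c hc r hr
  set δ := Metric.infDist x F with hδ
  obtain ⟨m, hcm, hm1⟩ := exists_between (max_lt hc one_pos)
  have hm0 : 0 < m := (le_max_right _ _).trans_lt hcm
  have hcm' := (le_max_left c 0).trans_lt hcm
  obtain ⟨γ, hγ0, hγ⟩ : ∃ γ, 0 < γ ∧ γ ≤ (1 - m) * δ := ⟨_, mul_pos (by linarith) hpos, le_rfl⟩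
  obtain ⟨κ, hκ0, hκ⟩ : ∃ κ > 0, ∀ q ∈ F, dist x q < δ + κ → dist q p < γ := by
    by_contra! hcon
    have hK : IsCompact (F ∩ {q | γ ≤ dist q p}) :=
      hF.inter_right (isClosed_le continuous_const (by fun_prop))
    obtain ⟨q₁, hq₁, -, hq₁'⟩ := hcon 1 one_pos
    obtain ⟨q, ⟨hqF, hqγ⟩, hmin⟩ := hK.exists_isMinOn ⟨q₁, hq₁, hq₁'⟩
      (f := fun q => dist x q) (by fun_prop)
    have hqγ : γ ≤ dist q p := hqγ
    have h1 : δ < dist x q := by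
      refine lt_of_le_of_ne (Metric.infDist_le_dist_of_mem hqF) fun heq => ?_
      rw [huniq q hqF heq.symm, dist_self] at hqγ
      linarith
    obtain ⟨q', hq', hq'1, hq'2⟩ := hcon (dist x q - δ) (by linarith)
    have : dist x q ≤ dist x q' := hmin ⟨hq', hq'2⟩
    linarith
  obtain ⟨t, ht0, ht⟩ := exists_between (lt_min hr (half_pos hκ0))
  have htκ := ht.trans_le (min_le_right _ _)
  have hn : ‖x - p‖ = δ := by rw [← dist_eq_norm, hxp]
  set y := x + (t / δ) • (x - p) with hy
  have hd : dist y x = t := by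
    rw [hy, dist_eq_norm, add_sub_cancel_left, norm_smul, hn, Real.norm_of_nonneg (by positivity),
      div_mul_cancel₀ _ hpos.ne']
  refine ⟨y, by rwa [hd], by rw [hd]; exact ht.trans_le (min_le_left _ _), ?_⟩
  obtain ⟨q, hqF, hq⟩ := hF.exists_infDist_eq_dist ⟨p, hp⟩ y
  have hyδ : Metric.infDist y F ≤ δ + t := by
    have := Metric.infDist_le_infDist_add_dist (s := F) (x := y) (y := x)
    rwa [hd] at this
  have hqx := dist_triangle x y q
  rw [dist_comm x y, hd, ← hq] at hqx
  have hqp := hκ q hqF (by linarith)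
  have hxq : δ ≤ ‖x - q‖ := by rw [← dist_eq_norm]; exact Metric.infDist_le_dist_of_mem hqF
  have hin : ⟪x - q, x - p⟫ ≥ δ * (δ - γ) := by
    have e : x - q = (x - p) - (q - p) := by abel
    rw [e, inner_sub_left, real_inner_self_eq_norm_sq, hn]
    have := real_inner_le_norm (q - p) (x - p)
    rw [hn, ← dist_eq_norm] at this
    nlinarith
  have hsq : ‖y - q‖ ^ 2 = ‖x - q‖ ^ 2 + 2 * (t / δ * ⟪x - q, x - p⟫) + t ^ 2 := by
    have e : y - q = (x - q) + (t / δ) • (x - p) := by rw [hy]; abel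
    rw [e, norm_add_sq_real, inner_smul_right, norm_smul, hn, Real.norm_of_nonneg (by positivity),
      div_mul_cancel₀ _ hpos.ne']
  have h1 : t / δ * ⟪x - q, x - p⟫ ≥ t * (δ - γ) := by
    have : t / δ * (δ * (δ - γ)) = t * (δ - γ) := by field_simp
    rw [← this]
    exact mul_le_mul_of_nonneg_left hin (by positivity)
  simp only
  rw [hd, hq, dist_eq_norm]
  refine (add_le_add_right (mul_le_mul_of_nonneg_right hcm'.le ht0.le) δ).trans ?_
  refine abs_le_of_sq_le_sq' ?_ (norm_nonneg _) |>.2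
  rw [hsq]
  nlinarith [mul_le_mul_of_nonneg_left hγ ht0.le, mul_self_le_mul_self hpos.le hxq,
    mul_nonneg (sq_nonneg t) (by nlinarith : 0 ≤ 1 - m ^ 2)]

end UnitSlope

section OrientedDistance

variable {E : Type*} [NormedAddCommGroup E]

theorem infDist_compl_eq_infDist_frontier [NormedSpace ℝ E] [FiniteDimensional ℝ E] {D : Set E}
    (hD : D ≠ univ) {x : E} (hx : x ∈ D) :
    Metric.infDist x Dᶜ = Metric.infDist x (frontier D) := by
  obtain ⟨y, hy, hxy⟩ := exists_mem_frontier_infDist_compl_eq_dist hx hD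
  refine le_antisymm ?_ (hxy ▸ Metric.infDist_le_dist_of_mem hy)
  rw [← Metric.infDist_closure (s := Dᶜ)]
  refine Metric.infDist_le_infDist_of_subset ?_ ⟨y, hy⟩
  rw [← frontier_compl]
  exact frontier_subset_closure

variable {D : Set E} {d : E → ℝ}

theorem orientedDist_of_mem [NormedSpace ℝ E] [FiniteDimensional ℝ E] (hD : D ≠ univ)
    (hd : ∀ x, d x = Metric.infDist x D - Metric.infDist x Dᶜ) {x : E} (hx : x ∈ D) :
    d x = -Metric.infDist x (frontier D) := by
  rw [hd, Metric.infDist_zero_of_mem hx, infDist_compl_eq_infDist_frontier hD hx, zero_sub]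

theorem orientedDist_of_notMem [NormedSpace ℝ E] [FiniteDimensional ℝ E] (hD : D.Nonempty)
    (hd : ∀ x, d x = Metric.infDist x D - Metric.infDist x Dᶜ) {x : E} (hx : x ∉ D) :
    d x = Metric.infDist x (frontier D) := by
  rw [hd, Metric.infDist_zero_of_mem (mem_compl hx), sub_zero]
  have hne : Dᶜ ≠ univ := by simpa [compl_univ_iff] using hD.ne_empty
  rw [← frontier_compl, ← infDist_compl_eq_infDist_frontier hne (mem_compl hx), compl_compl]

theorem abs_orientedDist [NormedSpace ℝ E] [FiniteDimensional ℝ E] (hne : D.Nonempty)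
    (hD : D ≠ univ) (hd : ∀ x, d x = Metric.infDist x D - Metric.infDist x Dᶜ) (x : E) :
    |d x| = Metric.infDist x (frontier D) := by
  by_cases hx : x ∈ D
  · rw [orientedDist_of_mem hD hd hx, abs_neg, abs_of_nonneg Metric.infDist_nonneg]
  · rw [orientedDist_of_notMem hne hd hx, abs_of_nonneg Metric.infDist_nonneg]

theorem exists_mem_segment_mem_frontier [NormedSpace ℝ E] {x y : E} (hx : x ∉ D) (hy : y ∈ D) :
    ∃ q ∈ segment ℝ x y, q ∈ frontier D := by
  by_contra! h
  have hcover : segment ℝ x y ⊆ interior D ∪ interior Dᶜ := fun q hq => by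
    rw [← compl_frontier_eq_union_interior]
    exact h q hq
  obtain ⟨q, -, hq₁, hq₂⟩ := (convex_segment x y).isPreconnected _ _ isOpen_interior isOpen_interior
    hcover
    ⟨y, right_mem_segment ℝ x y, (hcover (right_mem_segment ℝ x y)).resolve_right
      fun hc => interior_subset hc hy⟩
    ⟨x, left_mem_segment ℝ x y, (hcover (left_mem_segment ℝ x y)).resolve_left
      fun hc => hx (interior_subset hc)⟩
  exact interior_subset hq₂ (interior_subset hq₁)

theorem lipschitzWith_orientedDist [NormedSpace ℝ E] [FiniteDimensional ℝ E] (hne : D.Nonempty)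
    (hD : D ≠ univ) (hd : ∀ x, d x = Metric.infDist x D - Metric.infDist x Dᶜ) :
    LipschitzWith 1 d := by
  refine LipschitzWith.of_le_add fun x y => ?_
  by_cases hx : x ∈ D <;> by_cases hy : y ∈ D
  · rw [orientedDist_of_mem hD hd hx, orientedDist_of_mem hD hd hy]
    have := Metric.infDist_le_infDist_add_dist (s := frontier D) (x := y) (y := x)
    rw [dist_comm] at this
    linarith
  · rw [orientedDist_of_mem hD hd hx, orientedDist_of_notMem hne hd hy]
    linarith [Metric.infDist_nonneg (s := frontier D) (x := x), dist_nonneg (x := x) (y := y),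
      Metric.infDist_nonneg (s := frontier D) (x := y)]
  · rw [orientedDist_of_notMem hne hd hx, orientedDist_of_mem hD hd hy]
    obtain ⟨q, hq, hqF⟩ := exists_mem_segment_mem_frontier hx hy
    rw [← dist_add_dist_of_mem_segment hq]
    have h1 := Metric.infDist_le_dist_of_mem (x := x) hqF
    have h2 := Metric.infDist_le_dist_of_mem (x := y) hqF
    rw [dist_comm y] at h2
    linarith
  · rw [orientedDist_of_notMem hne hd hx, orientedDist_of_notMem hne hd hy]
    exact Metric.infDist_le_infDist_add_dist

theorem orientedDist_neg_iff [NormedSpace ℝ E] [FiniteDimensional ℝ E] (hne : D.Nonempty)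
    (hD : D ≠ univ) (hopen : IsOpen D)
    (hd : ∀ x, d x = Metric.infDist x D - Metric.infDist x Dᶜ) {x : E} : d x < 0 ↔ x ∈ D := by
  refine ⟨fun h => ?_, fun h => ?_⟩
  · by_contra hx
    rw [orientedDist_of_notMem hne hd hx] at h
    exact absurd h Metric.infDist_nonneg.not_gt
  · rw [hd, Metric.infDist_zero_of_mem h, zero_sub, neg_lt_zero,
      ← hopen.isClosed_compl.notMem_iff_infDist_pos (nonempty_compl.2 hD)]
    exact fun hc => hc h

/-- Unique nearest points off the boundary and continuous differentiability near it give the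
oriented distance unit slope in both directions. -/
theorem hasUnitSlope_orientedDist [InnerProductSpace ℝ E] [FiniteDimensional ℝ E]
    (hne : D.Nonempty) (hopen : IsOpen D) (hbdd : Bornology.IsBounded D) (hD : D ≠ univ)
    (hd : ∀ x, d x = Metric.infDist x D - Metric.infDist x Dᶜ) {R : ℝ}
    (hproj : ∀ z, |d z| < R →
      ∃! y, y ∈ frontier D ∧ dist z y = Metric.infDist z (frontier D))
    {U : Set E} (hU : IsOpen U) (hFU : frontier D ⊆ U) (hC1 : ContDiffOn ℝ 1 d U)
    {x : E} (hx : |d x| < R) : HasUnitSlope d x ∧ HasUnitSlope (fun z => -d z) x := by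
  have hcont : Continuous d := (lipschitzWith_orientedDist hne hD hd).continuous
  have hF : IsCompact (frontier D) :=
    hbdd.isCompact_closure.of_isClosed_subset isClosed_frontier frontier_subset_closure
  have off : ∀ y, |d y| < R → d y ≠ 0 → HasUnitSlope d y ∧ HasUnitSlope (fun z => -d z) y := by
    intro y hy hy0
    obtain ⟨p, ⟨hp, hyp⟩, huniq⟩ := hproj y hy
    have habs := abs_orientedDist hne hD hd
    have hpos : 0 < Metric.infDist y (frontier D) := by rw [← habs]; exact abs_pos.2 hy0
    have h1 := hasUnitSlope_infDist hF hp hyp hpos fun q hq hyq => huniq q ⟨hq, hyq⟩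
    have h2 := hasUnitSlope_neg_infDist hp hyp hpos
    rcases hy0.lt_or_gt with h | h
    · have ev : ∀ᶠ z in 𝓝 y, d z < 0 := hcont.continuousAt.eventually_lt_const h
      refine ⟨h2.congr ?_, h1.congr ?_⟩ <;>
      · filter_upwards [ev] with z hz
        rw [← habs, abs_of_neg hz]
        try rw [neg_neg]
    · have ev : ∀ᶠ z in 𝓝 y, 0 < d z := hcont.continuousAt.eventually_const_lt h
      refine ⟨h1.congr ?_, h2.congr ?_⟩ <;>
      · filter_upwards [ev] with z hz
        rw [← habs, abs_of_pos hz]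
  by_cases hx0 : d x = 0
  · have hxF : x ∈ frontier D := by
      obtain ⟨p, ⟨hp, hxp⟩, -⟩ := hproj x hx
      rw [← abs_orientedDist hne hD hd, hx0, abs_zero, dist_eq_zero] at hxp
      exact hxp ▸ hp
    have hdiff : ∀ y ∈ U, DifferentiableAt ℝ d y := fun y hy =>
      (hC1.differentiableOn one_ne_zero).differentiableAt (hU.mem_nhds hy)
    have hfd : ContinuousAt (fderiv ℝ d) x :=
      (hC1.continuousOn_fderiv_of_isOpen hU le_rfl).continuousAt (hU.mem_nhds (hFU hxF))
    have hnorm : 1 ≤ ‖fderiv ℝ d x‖ := by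
      by_contra! hlt
      have ev : ∀ᶠ y in 𝓝 x, ‖fderiv ℝ d y‖ < 1 ∧ y ∈ U ∧ |d y| < R :=
        (hfd.norm.eventually_lt_const hlt).and ((hU.eventually_mem (hFU hxF)).and
          (hcont.abs.continuousAt.eventually_lt_const hx))
      obtain ⟨y, ⟨hy1, hyU, hyR⟩, hyD⟩ :=
        ((mem_closure_iff_frequently.1 (frontier_subset_closure hxF)).and_eventually ev).exists.imp
          fun _ h => h.symm
      exact absurd (one_le_norm_fderiv_of_hasUnitSlope (hdiff y hyU)
        (off y hyR ((orientedDist_neg_iff hne hD hopen hd).2 hyD).ne).1) hy1.not_ge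
    have hdx := hdiff x (hFU hxF)
    exact ⟨hasUnitSlope_of_one_le_norm_fderiv hdx hnorm,
      hasUnitSlope_of_one_le_norm_fderiv hdx.fun_neg (by rwa [fderiv_fun_neg, norm_neg])⟩
  · exact off x hx hx0

/-- In a sublevel set of a `1`-Lipschitz function growing at unit speed along a line through `x`,
the distance from `x` to the boundary is the difference of the values. -/
theorem infDist_frontier_sublevel [NormedSpace ℝ E] {f : E → ℝ} (hf : LipschitzWith 1 f) {t : ℝ}
    {x v : E} (hv : ‖v‖ = 1) (hx : f x < t)
    (hray : ∀ s ∈ Icc 0 (t - f x), f (x + s • v) = f x + s) :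
    Metric.infDist x (frontier {y | f y < t}) = t - f x := by
  have hmem : x + (t - f x) • v ∈ frontier {y | f y < t} := by
    have hend : f (x + (t - f x) • v) = t := by
      rw [hray _ (right_mem_Icc.2 (by linarith))]; ring
    refine ⟨?_, fun h => ?_⟩
    · have hc : Tendsto (fun s : ℝ => x + s • v) (𝓝[<] (t - f x)) (𝓝 (x + (t - f x) • v)) := by
        refine Tendsto.mono_left ?_ nhdsWithin_le_nhds
        exact Continuous.tendsto (by fun_prop) _
      refine mem_closure_of_tendsto hc ?_
      filter_upwards [Ioo_mem_nhdsLT (sub_pos.2 hx)] with s hs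
      rw [hray s ⟨hs.1.le, hs.2.le⟩]
      linarith [hs.2]
    · have := interior_subset h
      rw [mem_ofPred_eq, hend] at this
      exact lt_irrefl _ this
  refine le_antisymm ?_ ((Metric.le_infDist ⟨_, hmem⟩).2 fun y hy => ?_)
  · refine (Metric.infDist_le_dist_of_mem hmem).trans ?_
    rw [dist_eq_norm, sub_add_cancel_left, norm_neg, norm_smul, hv, mul_one,
      Real.norm_of_nonneg (by linarith)]
  · have hyt : t ≤ f y := by
      by_contra! h
      refine hy.2 ?_
      rw [(isOpen_lt hf.continuous continuous_const).interior_eq]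
      exact h
    have := (le_abs_self _).trans (hf.dist_le_mul y x)
    rw [dist_comm x]
    simp only [NNReal.coe_one, one_mul] at this
    linarith

end OrientedDistance

section Integrals

theorem volume_image_le_of_lipschitzWith {n : ℕ} {K : NNReal}
    {T : EuclideanSpace ℝ (Fin n) → EuclideanSpace ℝ (Fin n)} (hT : LipschitzWith K T)
    (s : Set (EuclideanSpace ℝ (Fin n))) : volume (T '' s) ≤ (K : ℝ≥0∞) ^ n * volume s := by
  have h := hT.hausdorffMeasure_image_le (Nat.cast_nonneg n) s
  rw [ENNReal.rpow_natCast] at h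
  rw [← EuclideanSpace.euclideanHausdorffMeasure_eq_volume, Measure.euclideanHausdorffMeasure_def,
    Measure.smul_apply, Measure.smul_apply, ENNReal.smul_def, ENNReal.smul_def, smul_eq_mul,
    smul_eq_mul, mul_left_comm]
  gcongr

/-- Composition with a map that has a Lipschitz left inverse is bounded on integrals. -/
theorem setLIntegral_comp_le_of_leftInverse {n : ℕ} {K : NNReal}
    {T S : EuclideanSpace ℝ (Fin n) → EuclideanSpace ℝ (Fin n)} (hT : Measurable T)
    (hS : LipschitzWith K S) {X : Set (EuclideanSpace ℝ (Fin n))}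
    (hST : ∀ x ∈ X, S (T x) = x) {f : EuclideanSpace ℝ (Fin n) → ℝ≥0∞} (hf : Measurable f) :
    ∫⁻ x in X, f (T x) ≤ (K : ℝ≥0∞) ^ n * ∫⁻ y, f y := by
  have hle : (volume.restrict X).map T ≤ (K : ℝ≥0∞) ^ n • volume := by
    refine Measure.le_iff.2 fun B hB => ?_
    rw [Measure.map_apply hT hB, Measure.restrict_apply (hT hB), Measure.smul_apply, smul_eq_mul]
    refine (measure_mono ?_).trans (volume_image_le_of_lipschitzWith hS B)
    exact fun x hx => ⟨T x, hx.1, hST x hx.2⟩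
  calc ∫⁻ x in X, f (T x) = ∫⁻ y, f y ∂((volume.restrict X).map T) := (lintegral_map hf hT).symm
    _ ≤ ∫⁻ y, f y ∂((K : ℝ≥0∞) ^ n • volume) := lintegral_mono' hle le_rfl
    _ = _ := lintegral_smul_measure _ _

/-- The fundamental theorem of calculus along a segment, as an inequality of extended reals. -/
theorem enorm_le_enorm_add_lintegral_fderiv {E : Type*} [NormedAddCommGroup E] [NormedSpace ℝ E]
    {u : E → ℝ} {x v : E} (hv : ‖v‖ ≤ 1) {s : ℝ} (hs : 0 ≤ s)
    (hu : ∀ τ ∈ Icc 0 s, DifferentiableAt ℝ u (x - τ • v)) :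
    ‖u x‖ₑ ≤ ‖u (x - s • v)‖ₑ + ∫⁻ τ in Ioo 0 s, ‖fderiv ℝ u (x - τ • v)‖ₑ := by
  set g : ℝ → ℝ := fun τ => u (x - τ • v) with hg
  have hderiv : ∀ τ ∈ Icc 0 s, HasDerivAt g (fderiv ℝ u (x - τ • v) (-v)) τ := by
    intro τ hτ
    have hline : HasDerivAt (fun τ : ℝ => x - τ • v) (-v) τ := by
      simpa using ((hasDerivAt_id τ).smul_const v).const_sub x
    exact (hu τ hτ).hasFDerivAt.comp_hasDerivAt τ hline
  have hbound : ∫⁻ τ in Ioc 0 s, ‖deriv g τ‖ₑ ≤ ∫⁻ τ in Ioo 0 s, ‖fderiv ℝ u (x - τ • v)‖ₑ := by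
    rw [← setLIntegral_congr (Ioo_ae_eq_Ioc (μ := volume) (a := 0) (b := s))]
    refine setLIntegral_mono' measurableSet_Ioo fun τ hτ => ?_
    rw [(hderiv τ (Ioo_subset_Icc_self hτ)).deriv, ← ofReal_norm, ← ofReal_norm]
    refine ENNReal.ofReal_le_ofReal (((fderiv ℝ u (x - τ • v)).le_opNorm _).trans ?_)
    rw [norm_neg]
    exact mul_le_of_le_one_right (norm_nonneg _) hv
  rcases eq_or_ne (∫⁻ τ in Ioo 0 s, ‖fderiv ℝ u (x - τ • v)‖ₑ) ⊤ with htop | htop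
  · rw [htop, add_top]; exact le_top
  have hint : IntervalIntegrable (deriv g) volume 0 s := by
    rw [intervalIntegrable_iff_integrableOn_Ioc_of_le hs]
    exact ⟨(measurable_deriv g).aestronglyMeasurable, hbound.trans_lt htop.lt_top⟩
  have hftc := intervalIntegral.integral_eq_sub_of_hasDerivAt (f := g) (f' := deriv g)
    (fun τ hτ => (hderiv τ (uIcc_of_le hs ▸ hτ)).differentiableAt.hasDerivAt) hint
  rw [intervalIntegral.integral_of_le hs] at hftc
  have hx : u x = g s - ∫ τ in Ioc 0 s, deriv g τ := by
    rw [hftc, hg]; simp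
  calc ‖u x‖ₑ ≤ ‖g s‖ₑ + ‖∫ τ in Ioc 0 s, deriv g τ‖ₑ := by rw [hx]; exact enorm_sub_le
    _ ≤ _ := by gcongr; exact (enorm_integral_le_lintegral_enorm _).trans hbound

theorem setLIntegral_Ioo_sub_rpow {α : ℝ} (hα : 0 < α) {a c : ℝ} (hac : a ≤ c) :
    ∫⁻ τ in Ioo a c, ENNReal.ofReal ((c - τ) ^ (α - 1)) = ENNReal.ofReal ((c - a) ^ α / α) := by
  have hint : IntervalIntegrable (fun τ => (c - τ) ^ (α - 1)) volume a c := by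
    have := (intervalIntegral.intervalIntegrable_rpow' (a := c - a) (b := 0) (r := α - 1)
      (by linarith)).comp_sub_left c
    simpa using this
  rw [setLIntegral_congr Ioo_ae_eq_Ioc, ← ofReal_integral_eq_lintegral_ofReal
    ((intervalIntegrable_iff_integrableOn_Ioc_of_le hac).1 hint),
    ← intervalIntegral.integral_of_le hac, intervalIntegral.integral_comp_sub_left
      (fun x => x ^ (α - 1)), integral_rpow (Or.inl (by linarith))]
  · simp [Real.zero_rpow hα.ne']
  · filter_upwards [ae_restrict_mem measurableSet_Ioc] with τ hτ
    exact Real.rpow_nonneg (sub_nonneg.2 hτ.2) _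

/-- The weight `(ε - t - τ)^(α - 1)` integrated over the `τ > 0` that move `t` into `[-ε, ε)`. -/
theorem setLIntegral_indicator_sub_rpow_le {α : ℝ} (hα : 0 < α) {ε t b : ℝ} (hε : 0 ≤ ε)
    (ht : t ≤ ε) :
    ∫⁻ τ in Ioo 0 b, ((t + ·) ⁻¹' Ico (-ε) ε).indicator
      (fun τ => ENNReal.ofReal ((ε - t - τ) ^ (α - 1))) τ ≤
      ENNReal.ofReal (min (2 * ε) (ε - t) ^ α / α) := by
  have hmeas : MeasurableSet ((t + ·) ⁻¹' Ico (-ε) ε) :=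
    measurableSet_Ico.preimage (measurable_const_add t)
  have hmin : 0 ≤ min (2 * ε) (ε - t) := le_min (by linarith) (by linarith)
  have h := setLIntegral_Ioo_sub_rpow hα (a := ε - t - min (2 * ε) (ε - t)) (c := ε - t)
    (by linarith)
  rw [_root_.sub_sub_cancel] at h
  rw [← h, lintegral_indicator hmeas, Measure.restrict_restrict hmeas,
    setLIntegral_congr (Ioo_ae_eq_Ico (a := ε - t - min (2 * ε) (ε - t)))]
  refine lintegral_mono_set fun τ hτ => ?_
  obtain ⟨⟨h1, h2⟩, h3, -⟩ := hτ
  refine ⟨?_, by linarith⟩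
  rcases min_choice (2 * ε) (ε - t) with h | h <;> rw [h] <;> linarith

end Integrals

section UnitDirection

variable {E : Type*} [NormedAddCommGroup E] [InnerProductSpace ℝ E]

/-- Under the unit slope condition on `{|f| < 4ρ}`, the direction of unit-speed growth on
`{|f| < 3ρ}` is the restriction of a globally Lipschitz map. -/
theorem exists_lipschitzWith_unit_direction [FiniteDimensional ℝ E] {f : E → ℝ}
    (hf : LipschitzWith 1 f) {ρ : ℝ} (hρ : 0 < ρ)
    (hslope : ∀ y, |f y| < 4 * ρ → HasUnitSlope f y ∧ HasUnitSlope (fun z => -f z) y) :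
    ∃ (K : NNReal) (N : E → E), LipschitzWith K N ∧ ∀ x, |f x| < 3 * ρ →
      ‖N x‖ = 1 ∧ ∀ s, |f x + s| < 4 * ρ → f (x + s • N x) = f x + s := by
  have hex : ∀ x, ∃ v : E, |f x| < 3 * ρ →
      ‖v‖ = 1 ∧ ∀ s, |f x + s| < 4 * ρ → f (x + s • v) = f x + s := by
    intro x
    by_cases hx : |f x| < 3 * ρ
    · obtain ⟨v, hv⟩ := exists_unit_direction hf (fun y hy => (hslope y hy).1)
        (fun y hy => (hslope y hy).2) (x := x) (by linarith)
      exact ⟨v, fun _ => hv⟩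
    · exact ⟨0, fun h => absurd h hx⟩
  choose v hv using hex
  have hstep : ∀ x, |f x| < 3 * ρ →
      f (x + ρ • v x) = f x + ρ ∧ f (x - ρ • v x) = f x - ρ := by
    intro x hx
    obtain ⟨h1, h2⟩ := abs_lt.1 hx
    refine ⟨(hv x hx).2 ρ (abs_lt.2 ⟨by linarith, by linarith⟩), ?_⟩
    have := (hv x hx).2 (-ρ) (abs_lt.2 ⟨by linarith, by linarith⟩)
    rwa [neg_smul, ← sub_eq_add_neg, ← sub_eq_add_neg] at this
  have hlip : LipschitzOnWith (Real.toNNReal ρ⁻¹) v {x | |f x| < 3 * ρ} := by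
    refine LipschitzOnWith.of_dist_le_mul fun x hx y hy => ?_
    rw [Real.coe_toNNReal _ (inv_nonneg.2 hρ.le), dist_eq_norm, inv_mul_eq_div, le_div_iff₀' hρ]
    exact mul_norm_direction_sub_le hf hρ (hv x hx).1 (hv y hy).1 (hstep x hx).1 (hstep x hx).2
      (hstep y hy).1 (hstep y hy).2
  obtain ⟨N, hN, hNv⟩ := hlip.extend_finite_dimension
  refine ⟨_, N, hN, fun x hx => ?_⟩
  rw [← hNv hx]
  exact hv x hx

theorem unit_direction_sub_smul {f : E → ℝ} (hf : LipschitzWith 1 f) {ρ : ℝ} (hρ : 0 < ρ)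
    {N : E → E} (hN : ∀ x, |f x| < 3 * ρ →
      ‖N x‖ = 1 ∧ ∀ s, |f x + s| < 4 * ρ → f (x + s • N x) = f x + s)
    {x : E} (hx : |f x| < 3 * ρ) {τ : ℝ} (hτ : |f x - τ| < 3 * ρ) :
    f (x - τ • N x) = f x - τ ∧ N (x - τ • N x) = N x := by
  have hline : ∀ s, |f x - τ + s| < 4 * ρ → f (x - τ • N x + s • N x) = f x - τ + s := by
    intro s hs
    have := (hN x hx).2 (-τ + s) (by rwa [← add_assoc, ← sub_eq_add_neg])
    rw [← add_assoc, ← sub_eq_add_neg] at this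
    rw [← this]
    congr 1
    module
  have h0 : f (x - τ • N x) = f x - τ := by
    simpa using hline 0 (by rw [add_zero]; linarith)
  refine ⟨h0, ?_⟩
  obtain ⟨hτ1, hτ2⟩ := abs_lt.1 hτ
  obtain ⟨hn, hs⟩ := hN (x - τ • N x) (by rwa [h0])
  rw [h0] at hs
  have hp : |f x - τ + ρ| < 4 * ρ := abs_lt.2 ⟨by linarith, by linarith⟩
  have hm : |f x - τ + -ρ| < 4 * ρ := abs_lt.2 ⟨by linarith, by linarith⟩
  have h := mul_norm_direction_sub_le hf hρ hn (hN x hx).1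
    (x := x - τ • N x) (y := x - τ • N x) (by rw [h0, hs ρ hp])
    (by rw [h0, sub_eq_add_neg, ← neg_smul, hs _ hm]; ring) (by rw [h0, hline ρ hp])
    (by rw [h0, sub_eq_add_neg _ (ρ • N x), ← neg_smul, hline _ hm]; ring)
  rw [dist_self] at h
  have : ‖N (x - τ • N x) - N x‖ ≤ 0 := by nlinarith
  exact sub_eq_zero.1 (norm_le_zero_iff.1 this)

/-- Pointwise bound of a function by an average over a deep layer and the gradient along the line
through the point. -/
theorem enorm_le_lintegral_line [MeasurableSpace E] [BorelSpace E] [CompleteSpace E]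
    [SecondCountableTopology E] {f : E → ℝ} {ρ : ℝ} (hρ : 0 < ρ)
    {x v : E} (hv : ‖v‖ = 1) {ε : ℝ} (hερ : ε < 2 * ρ) (hx : f x ∈ Ico (-ε) ε)
    (hray : ∀ τ, |f x - τ| < 3 * ρ → f (x - τ • v) = f x - τ)
    {u : E → ℝ} (hu : Measurable u) (hdiff : ∀ y, f y < ε → DifferentiableAt ℝ u y) :
    ‖u x‖ₑ ≤ ∫⁻ τ in Ioo 0 (f x + 3 * ρ),
      ((ENNReal.ofReal ρ)⁻¹ * (f ⁻¹' Ioo (-(3 * ρ)) (-(2 * ρ))).indicator (fun y => ‖u y‖ₑ)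
        (x - τ • v) +
      (f ⁻¹' Ioo (-(3 * ρ)) ε).indicator (fun y => ‖fderiv ℝ u y‖ₑ) (x - τ • v)) := by
  obtain ⟨hx1, hx2⟩ := hx
  have hρ0 : ENNReal.ofReal ρ ≠ 0 := by simpa using hρ
  set J := Ioo (f x + 2 * ρ) (f x + 3 * ρ) with hJ
  set I := ∫⁻ τ in Ioo 0 (f x + 3 * ρ), ‖fderiv ℝ u (x - τ • v)‖ₑ with hI
  have hmeas : Measurable fun τ : ℝ => ‖u (x - τ • v)‖ₑ :=
    (hu.comp (by fun_prop : Measurable fun τ : ℝ => x - τ • v)).enorm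
  have hJvol : volume J = ENNReal.ofReal ρ := by
    rw [hJ, Real.volume_Ioo]; congr 1; ring
  have hpt : ∀ τ ∈ J, ‖u x‖ₑ ≤ ‖u (x - τ • v)‖ₑ + I := by
    intro τ hτ
    refine (enorm_le_enorm_add_lintegral_fderiv hv.le (s := τ) (by linarith [hτ.1])
      fun σ hσ => hdiff _ ?_).trans ?_
    · rw [hray σ (abs_lt.2 ⟨by linarith [hσ.2, hτ.2], by linarith [hσ.1]⟩)]
      linarith [hσ.1]
    · exact add_le_add le_rfl (lintegral_mono_set (Ioo_subset_Ioo_right hτ.2.le))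
  have hJint : ENNReal.ofReal ρ * ‖u x‖ₑ ≤
      (∫⁻ τ in J, ‖u (x - τ • v)‖ₑ) + ENNReal.ofReal ρ * I := by
    have := setLIntegral_mono' (μ := volume) measurableSet_Ioo hpt
    rwa [lintegral_add_left hmeas, setLIntegral_const, setLIntegral_const, hJvol,
      mul_comm, mul_comm I] at this
  have hdiv : ‖u x‖ₑ ≤ (ENNReal.ofReal ρ)⁻¹ * (∫⁻ τ in J, ‖u (x - τ • v)‖ₑ) + I := by
    have := mul_le_mul_right hJint (ENNReal.ofReal ρ)⁻¹
    rwa [mul_add, ← mul_assoc, ← mul_assoc, ENNReal.inv_mul_cancel hρ0 ENNReal.ofReal_ne_top,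
      one_mul, one_mul] at this
  refine hdiv.trans ?_
  have hJsub : J ⊆ Ioo 0 (f x + 3 * ρ) := fun τ hτ => ⟨by linarith [hτ.1], hτ.2⟩
  rw [← lintegral_const_mul _ hmeas, ← inter_eq_left.2 hJsub,
    ← Measure.restrict_restrict measurableSet_Ioo, ← lintegral_indicator measurableSet_Ioo, hI,
    ← lintegral_add_left ((hmeas.const_mul _).indicator measurableSet_Ioo)]
  refine setLIntegral_mono' measurableSet_Ioo fun τ hτ => ?_
  have hfτ := hray τ (abs_lt.2 ⟨by linarith [hτ.2], by linarith [hτ.1]⟩)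
  refine add_le_add ?_ (le_of_eq ?_)
  · by_cases hτJ : τ ∈ Ioo (f x + 2 * ρ) (f x + 3 * ρ)
    · rw [indicator_of_mem hτJ, indicator_of_mem]
      rw [mem_preimage, hfτ]
      exact ⟨by linarith [hτ.2], by linarith [hτJ.1]⟩
    · rw [indicator_of_notMem hτJ]
      exact zero_le
  · rw [indicator_of_mem]
    rw [mem_preimage, hfτ]
    exact ⟨by linarith [hτ.2], by linarith [hτ.1]⟩

end UnitDirection

section Hardy

variable {n : ℕ}

/-- Averaging along the lines of unit-speed growth and Tonelli's theorem: the weighted integral of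
`u` is bounded by an integral of any function dominating `u` along these lines. -/
theorem lintegral_weight_le_of_lines {f : EuclideanSpace ℝ (Fin n) → ℝ} (hf : LipschitzWith 1 f)
    {ρ : ℝ} (hρ : 0 < ρ) {K : NNReal} {N : EuclideanSpace ℝ (Fin n) → EuclideanSpace ℝ (Fin n)}
    (hNlip : LipschitzWith K N) (hN : ∀ x, |f x| < 3 * ρ →
      ‖N x‖ = 1 ∧ ∀ s, |f x + s| < 4 * ρ → f (x + s • N x) = f x + s)
    {α : ℝ} (hα : 0 < α) {ε : ℝ} (hε : 0 < ε) (hερ : ε < 2 * ρ)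
    {g F : EuclideanSpace ℝ (Fin n) → ℝ≥0∞} (hF : Measurable F) (hF0 : ∀ y, ε ≤ f y → F y = 0)
    (hgF : ∀ x, f x ∈ Ico (-ε) ε → g x ≤ ∫⁻ τ in Ioo 0 (f x + 3 * ρ), F (x - τ • N x)) :
    ∫⁻ x in f ⁻¹' Ico (-ε) ε, g x * ENNReal.ofReal ((ε - f x) ^ (α - 1)) ≤
      ((1 + Real.toNNReal (5 * ρ) * K : NNReal) : ℝ≥0∞) ^ n *
        ∫⁻ y, F y * ENNReal.ofReal (min (2 * ε) (ε - f y) ^ α / α) := by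
  have hfm : Measurable f := hf.continuous.measurable
  have hNm : Measurable N := hNlip.continuous.measurable
  set W : EuclideanSpace ℝ (Fin n) → ℝ → ℝ≥0∞ := fun y τ =>
    ((f y + ·) ⁻¹' Ico (-ε) ε).indicator (fun τ => ENNReal.ofReal ((ε - f y - τ) ^ (α - 1))) τ
    with hW
  set X : ℝ → Set (EuclideanSpace ℝ (Fin n)) := fun τ =>
    f ⁻¹' Ico (-ε) ε ∩ {x | τ < f x + 3 * ρ} with hX
  have hWm : Measurable (Function.uncurry W) := by
    have : Function.uncurry W =
        ((fun p : EuclideanSpace ℝ (Fin n) × ℝ => f p.1 + p.2) ⁻¹' Ico (-ε) ε).indicator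
          fun p => ENNReal.ofReal ((ε - f p.1 - p.2) ^ (α - 1)) := rfl
    rw [this]
    have h1 : Measurable fun p : EuclideanSpace ℝ (Fin n) × ℝ => f p.1 := hfm.comp measurable_fst
    refine Measurable.indicator ?_ ((h1.add measurable_snd) measurableSet_Ico)
    exact (((measurable_const.sub h1).sub measurable_snd).pow_const _).ennreal_ofReal
  have hQm : Measurable fun p : EuclideanSpace ℝ (Fin n) × ℝ => F p.1 * W p.1 p.2 :=
    (hF.comp measurable_fst).mul hWm
  have hTm : Measurable fun p : EuclideanSpace ℝ (Fin n) × ℝ => p.1 - p.2 • N p.1 :=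
    measurable_fst.sub (measurable_snd.smul (hNm.comp measurable_fst))
  have hXm : MeasurableSet {p : EuclideanSpace ℝ (Fin n) × ℝ | p.1 ∈ X p.2} := by
    refine ((hfm.comp measurable_fst) measurableSet_Ico).inter (measurableSet_lt measurable_snd ?_)
    exact (hfm.comp measurable_fst).add_const _
  have hpt : ∀ x ∈ f ⁻¹' Ico (-ε) ε, g x * ENNReal.ofReal ((ε - f x) ^ (α - 1)) ≤
      ∫⁻ τ in Ioo 0 (5 * ρ), {p : EuclideanSpace ℝ (Fin n) × ℝ | p.1 ∈ X p.2}.indicator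
        (fun p => F (p.1 - p.2 • N p.1) * W (p.1 - p.2 • N p.1) p.2) (x, τ) := by
    intro x hx
    have hsub : Ioo 0 (f x + 3 * ρ) ⊆ Ioo 0 (5 * ρ) := Ioo_subset_Ioo_right (by linarith [hx.2])
    refine (mul_le_mul_left (hgF x hx) _).trans ?_
    have hline : Measurable fun τ => F (x - τ • N x) := hF.comp (hTm.comp measurable_prodMk_left)
    rw [← lintegral_mul_const _ hline]
    refine le_trans (setLIntegral_mono' measurableSet_Ioo fun τ hτ => le_of_eq ?_)
      (lintegral_mono_set hsub)
    have hxX : (x, τ) ∈ {p : EuclideanSpace ℝ (Fin n) × ℝ | p.1 ∈ X p.2} := ⟨hx, hτ.2⟩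
    have hfτ := (unit_direction_sub_smul hf hρ hN (x := x) (τ := τ)
      (abs_lt.2 ⟨by linarith [hx.1], by linarith [hx.2]⟩)
      (abs_lt.2 ⟨by linarith [hτ.2], by linarith [hτ.1, hx.2]⟩)).1
    have hmem : τ ∈ (f (x - τ • N x) + ·) ⁻¹' Ico (-ε) ε := by
      rw [mem_preimage, hfτ, sub_add_cancel]
      exact hx
    have hWτ : W (x - τ • N x) τ = ENNReal.ofReal ((ε - f x) ^ (α - 1)) := by
      simp only [hW]
      rw [indicator_of_mem hmem, hfτ, show ε - (f x - τ) - τ = ε - f x by ring]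
    rw [indicator_of_mem hxX, ← hWτ]
  have hslice : ∀ τ ∈ Ioo 0 (5 * ρ), ∫⁻ x in f ⁻¹' Ico (-ε) ε,
      {p : EuclideanSpace ℝ (Fin n) × ℝ | p.1 ∈ X p.2}.indicator
        (fun p => F (p.1 - p.2 • N p.1) * W (p.1 - p.2 • N p.1) p.2) (x, τ) ≤
      ((1 + Real.toNNReal (5 * ρ) * K : NNReal) : ℝ≥0∞) ^ n * ∫⁻ y, F y * W y τ := by
    intro τ hτ
    have hXτ : MeasurableSet (X τ) := hXm.preimage measurable_prodMk_right
    have hS : LipschitzWith (1 + Real.toNNReal (5 * ρ) * K) fun y => y + τ • N y := by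
      refine LipschitzWith.id.add (LipschitzWith.of_dist_le_mul fun x y => ?_)
      rw [dist_smul₀, Real.norm_of_nonneg hτ.1.le, NNReal.coe_mul,
        Real.coe_toNNReal _ (by linarith [hτ.1, hτ.2]), mul_assoc]
      exact mul_le_mul hτ.2.le (hNlip.dist_le_mul x y) dist_nonneg (by linarith [hτ.1, hτ.2])
    refine le_trans ?_ (setLIntegral_comp_le_of_leftInverse (X := X τ)
      (T := fun x => x - τ • N x) (hTm.comp measurable_prodMk_right) hS ?_ (hQm.comp measurable_prodMk_right))
    · rw [← lintegral_indicator hXτ]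
      exact setLIntegral_le_lintegral _ _
    · rintro x ⟨hx, hxτ⟩
      have hxτ : τ < f x + 3 * ρ := hxτ
      have hNτ := (unit_direction_sub_smul hf hρ hN (x := x) (τ := τ)
        (abs_lt.2 ⟨by linarith [hx.1], by linarith [hx.2]⟩)
        (abs_lt.2 ⟨by linarith, by linarith [hτ.1, hx.2]⟩)).2
      simp only [hNτ, sub_add_cancel]
  have hswapm : Measurable fun p : EuclideanSpace ℝ (Fin n) × ℝ =>
      {p : EuclideanSpace ℝ (Fin n) × ℝ | p.1 ∈ X p.2}.indicator
        (fun p => F (p.1 - p.2 • N p.1) * W (p.1 - p.2 • N p.1) p.2) p :=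
    Measurable.indicator (hQm.comp (hTm.prodMk measurable_snd)) hXm
  refine (setLIntegral_mono' (hfm measurableSet_Ico) hpt).trans ?_
  rw [lintegral_lintegral_swap (f := fun x τ =>
    {p : EuclideanSpace ℝ (Fin n) × ℝ | p.1 ∈ X p.2}.indicator
      (fun p => F (p.1 - p.2 • N p.1) * W (p.1 - p.2 • N p.1) p.2) (x, τ)) hswapm.aemeasurable]
  refine (setLIntegral_mono' measurableSet_Ioo hslice).trans ?_
  rw [lintegral_const_mul' _ _ (ENNReal.pow_ne_top ENNReal.coe_ne_top),
    lintegral_lintegral_swap (f := fun τ y => F y * W y τ) (hQm.comp measurable_swap).aemeasurable]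
  refine mul_le_mul_right (lintegral_mono fun y => ?_) _
  rcases le_or_gt ε (f y) with hy | hy
  · simp [hF0 y hy]
  · have hWy : Measurable (W y) := hWm.comp measurable_prodMk_left
    rw [lintegral_const_mul _ hWy]
    exact mul_le_mul_right (setLIntegral_indicator_sub_rpow_le hα hε.le hy.le) _

/-- Hardy-type inequality for a `1`-Lipschitz function having unit slope in both directions near
its zero set. -/
theorem hardy_of_hasUnitSlope {f : EuclideanSpace ℝ (Fin n) → ℝ} (hf : LipschitzWith 1 f)
    {ρ : ℝ} (hρ : 0 < ρ)
    (hslope : ∀ y, |f y| < 4 * ρ → HasUnitSlope f y ∧ HasUnitSlope (fun z => -f z) y)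
    {α : ℝ} (hα : 0 < α) :
    ∃ C : ℝ, 0 < C ∧ ∀ ε ∈ Ioo 0 (2 * ρ), ∀ u : EuclideanSpace ℝ (Fin n) → ℝ, Measurable u →
      (∀ x, f x < ε → DifferentiableAt ℝ u x) →
      ∫⁻ x in f ⁻¹' Ico (-ε) ε, ‖u x‖ₑ * ENNReal.ofReal ((ε - f x) ^ (α - 1)) ≤
        ENNReal.ofReal (C / α) *
          (ENNReal.ofReal (ε ^ α) * (∫⁻ x in f ⁻¹' Iio 0, (‖u x‖ₑ + ‖fderiv ℝ u x‖ₑ)) +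
            ∫⁻ x in f ⁻¹' Ico 0 ε, ‖fderiv ℝ u x‖ₑ * ENNReal.ofReal ((ε - f x) ^ α)) := by
  obtain ⟨K, N, hNlip, hN⟩ := exists_lipschitzWith_unit_direction hf hρ hslope
  set C₁ : NNReal := (1 + Real.toNNReal (5 * ρ) * K) ^ n with hC₁
  set B : ℝ := (1 + ρ⁻¹) * 2 ^ α + 1 with hB
  have hC₁pos : 0 < C₁ := by positivity
  have hBpos : 0 < B := by positivity
  refine ⟨C₁ * B, by positivity, fun ε ⟨hε, hερ⟩ u hu hdiff => ?_⟩
  have hfm : Measurable f := hf.continuous.measurable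
  have hum : Measurable fun y => ‖u y‖ₑ := hu.enorm
  have hdum : Measurable fun y => ‖fderiv ℝ u y‖ₑ := (measurable_fderiv ℝ u).enorm
  set F : EuclideanSpace ℝ (Fin n) → ℝ≥0∞ := fun y =>
    (ENNReal.ofReal ρ)⁻¹ * (f ⁻¹' Ioo (-(3 * ρ)) (-(2 * ρ))).indicator (fun y => ‖u y‖ₑ) y +
      (f ⁻¹' Ioo (-(3 * ρ)) ε).indicator (fun y => ‖fderiv ℝ u y‖ₑ) y with hFdef
  have hF : Measurable F :=
    ((hum.indicator (hfm measurableSet_Ioo)).const_mul _).add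
      (hdum.indicator (hfm measurableSet_Ioo))
  have hF0 : ∀ y, ε ≤ f y → F y = 0 := by
    intro y hy
    simp only [hFdef]
    rw [indicator_of_notMem, indicator_of_notMem, mul_zero, add_zero]
    · exact fun h => h.2.not_ge hy
    · exact fun h => h.2.not_ge (by linarith)
  have hmain := lintegral_weight_le_of_lines hf hρ hNlip hN hα hε hερ hF hF0
    (g := fun x => ‖u x‖ₑ) fun x hx => by
      have hx3 : |f x| < 3 * ρ := abs_lt.2 ⟨by linarith [hx.1], by linarith [hx.2]⟩
      exact enorm_le_lintegral_line hρ (hN x hx3).1 hερ hx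
        (fun τ hτ => (unit_direction_sub_smul hf hρ hN hx3 hτ).1) hu hdiff
  refine hmain.trans ?_
  have hpt : ∀ y, F y * ENNReal.ofReal (min (2 * ε) (ε - f y) ^ α / α) ≤
      ENNReal.ofReal (B / α) *
        ((f ⁻¹' Iio 0).indicator (fun y => ENNReal.ofReal (ε ^ α) * (‖u y‖ₑ + ‖fderiv ℝ u y‖ₑ)) y +
          (f ⁻¹' Ico 0 ε).indicator
            (fun y => ‖fderiv ℝ u y‖ₑ * ENNReal.ofReal ((ε - f y) ^ α)) y) := by
    intro y
    rcases le_or_gt ε (f y) with hy | hy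
    · simp [hF0 y hy]
    have hmin0 : 0 ≤ min (2 * ε) (ε - f y) := le_min (by linarith) (by linarith)
    rcases lt_or_ge (f y) 0 with hy0 | hy0
    · rw [indicator_of_mem (show y ∈ f ⁻¹' Iio 0 from hy0),
        indicator_of_notMem (fun h => h.1.not_gt hy0), add_zero]
      have hFy : F y ≤ ENNReal.ofReal (1 + ρ⁻¹) * (‖u y‖ₑ + ‖fderiv ℝ u y‖ₑ) := by
        rw [mul_add]
        refine add_le_add (mul_le_mul' ?_ (indicator_le_self _ _ _)) ?_
        · rw [← ENNReal.ofReal_inv_of_pos hρ]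
          exact ENNReal.ofReal_le_ofReal (by linarith)
        · refine (indicator_le_self _ _ _).trans (le_mul_of_one_le_left' ?_)
          rw [ENNReal.one_le_ofReal]
          have := inv_pos.2 hρ
          linarith
      have hwy : ENNReal.ofReal (1 + ρ⁻¹) * ENNReal.ofReal (min (2 * ε) (ε - f y) ^ α / α) ≤
          ENNReal.ofReal (B / α) * ENNReal.ofReal (ε ^ α) := by
        rw [← ENNReal.ofReal_mul (by positivity), ← ENNReal.ofReal_mul (by positivity)]
        refine ENNReal.ofReal_le_ofReal ?_
        have h1 : min (2 * ε) (ε - f y) ^ α ≤ 2 ^ α * ε ^ α := by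
          rw [← Real.mul_rpow zero_le_two hε.le]
          exact Real.rpow_le_rpow hmin0 (min_le_left _ _) hα.le
        have h2 : (1 + ρ⁻¹) * min (2 * ε) (ε - f y) ^ α ≤ B * ε ^ α := by
          have h3 : (1 + ρ⁻¹) * min (2 * ε) (ε - f y) ^ α ≤ (1 + ρ⁻¹) * (2 ^ α * ε ^ α) :=
            mul_le_mul_of_nonneg_left h1 (by positivity)
          have h4 : 0 ≤ ε ^ α := by positivity
          rw [hB]
          linarith
        rw [← mul_div_assoc, div_mul_eq_mul_div]
        gcongr
      calc F y * ENNReal.ofReal (min (2 * ε) (ε - f y) ^ α / α)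
          ≤ ENNReal.ofReal (1 + ρ⁻¹) * (‖u y‖ₑ + ‖fderiv ℝ u y‖ₑ) *
            ENNReal.ofReal (min (2 * ε) (ε - f y) ^ α / α) := by gcongr
        _ = ENNReal.ofReal (1 + ρ⁻¹) * ENNReal.ofReal (min (2 * ε) (ε - f y) ^ α / α) *
            (‖u y‖ₑ + ‖fderiv ℝ u y‖ₑ) := by ring
        _ ≤ ENNReal.ofReal (B / α) * ENNReal.ofReal (ε ^ α) * (‖u y‖ₑ + ‖fderiv ℝ u y‖ₑ) := by
            gcongr
        _ = _ := by ring
    · rw [indicator_of_notMem (show y ∉ f ⁻¹' Iio 0 from hy0.not_gt),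
        indicator_of_mem (show y ∈ f ⁻¹' Ico 0 ε from ⟨hy0, hy⟩), zero_add]
      have hFy : F y ≤ ‖fderiv ℝ u y‖ₑ := by
        simp only [hFdef]
        rw [indicator_of_notMem (fun h => by linarith [h.2]), mul_zero, zero_add]
        exact indicator_le_self _ _ _
      have hwy : ENNReal.ofReal (min (2 * ε) (ε - f y) ^ α / α) ≤
          ENNReal.ofReal (B / α) * ENNReal.ofReal ((ε - f y) ^ α) := by
        rw [← ENNReal.ofReal_mul (by positivity), div_mul_eq_mul_div]
        refine ENNReal.ofReal_le_ofReal ?_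
        gcongr
        have h1 : min (2 * ε) (ε - f y) ^ α ≤ (ε - f y) ^ α :=
          Real.rpow_le_rpow hmin0 (min_le_right _ _) hα.le
        refine h1.trans (le_mul_of_one_le_left (Real.rpow_nonneg (by linarith) _) ?_)
        rw [hB]
        have : 0 ≤ (1 + ρ⁻¹) * 2 ^ α := by positivity
        linarith
      calc F y * ENNReal.ofReal (min (2 * ε) (ε - f y) ^ α / α)
          ≤ ‖fderiv ℝ u y‖ₑ * (ENNReal.ofReal (B / α) * ENNReal.ofReal ((ε - f y) ^ α)) :=
            mul_le_mul' hFy hwy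
        _ = _ := by ring
  have hm₁ : Measurable fun y => ENNReal.ofReal (ε ^ α) * (‖u y‖ₑ + ‖fderiv ℝ u y‖ₑ) :=
    (hum.add hdum).const_mul _
  have hC : ENNReal.ofReal (C₁ * B / α) =
      ((1 + Real.toNNReal (5 * ρ) * K : NNReal) : ℝ≥0∞) ^ n * ENNReal.ofReal (B / α) := by
    rw [mul_div_assoc, ENNReal.ofReal_mul C₁.coe_nonneg, ENNReal.ofReal_coe_nnreal, hC₁,
      ENNReal.coe_pow]
  rw [hC, mul_assoc]
  refine mul_le_mul_right ((lintegral_mono hpt).trans (le_of_eq ?_)) _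
  rw [lintegral_const_mul' _ _ ENNReal.ofReal_ne_top,
    lintegral_add_left (hm₁.indicator (hfm measurableSet_Iio)),
    lintegral_indicator (hfm measurableSet_Iio), lintegral_indicator (hfm measurableSet_Ico),
    lintegral_const_mul' _ _ ENNReal.ofReal_ne_top]

end Hardy

/-- Hardy-type inequality for diffuse interfaces, with constant independent of `ε`. -/
theorem hardy_type_inequality
    (n : ℕ) (hn : 2 ≤ n)
    (D : Set (EuclideanSpace ℝ (Fin n)))
    (hD_open : IsOpen D) (hD_bdd : Bornology.IsBounded D) (hD_ne : D.Nonempty)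
    (dD : EuclideanSpace ℝ (Fin n) → ℝ)
    (hdD : ∀ x, dD x = Metric.infDist x D - Metric.infDist x Dᶜ)
    (Dt : ℝ → Set (EuclideanSpace ℝ (Fin n)))
    (hDt : ∀ t, Dt t = {x | dD x < t})
    (Γ : ℝ → Set (EuclideanSpace ℝ (Fin n)))
    (hΓ : ∀ ε : ℝ, Γ ε = Dt ε \ closure (Dt (-ε)))
    (ε₀ : ℝ) (hε₀ : 0 < ε₀)
    (hproj : ∀ z ∈ Γ (2 * ε₀), ∃! y, y ∈ frontier D ∧ dist z y = Metric.infDist z (frontier D))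
    (hC11 : ∃ U : Set (EuclideanSpace ℝ (Fin n)), IsOpen U ∧ frontier D ⊆ U ∧
      ContDiffOn ℝ 1 dD U ∧ ∃ L : NNReal, LipschitzOnWith L (fun x => fderiv ℝ dD x) U)
    (α : ℝ) (hα : 0 < α) :
    ∃ C : ℝ, 0 < C ∧ ∀ ε ∈ Set.Ioo (0:ℝ) ε₀,
      ∀ u : EuclideanSpace ℝ (Fin n) → ℝ, Measurable u →
        (∀ x ∈ Dt ε, DifferentiableAt ℝ u x) →
        (∫⁻ x in Γ ε,
            ENNReal.ofReal (|u x| * Metric.infDist x (frontier (Dt ε)) ^ (α - 1))) ≤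
          ENNReal.ofReal (C / α) *
            (ENNReal.ofReal (ε ^ α) *
                (∫⁻ x in D, ENNReal.ofReal (|u x| + ‖fderiv ℝ u x‖)) +
              ∫⁻ x in Γ ε,
                ENNReal.ofReal (‖fderiv ℝ u x‖ * Metric.infDist x (frontier (Dt ε)) ^ α)) := by
  have : Nontrivial (Fin n) := Fin.nontrivial_iff_two_le.2 hn
  have hD_univ : D ≠ univ := fun h =>
    NormedSpace.unbounded_univ ℝ (EuclideanSpace ℝ (Fin n)) (h ▸ hD_bdd)
  have hlip : LipschitzWith 1 dD := lipschitzWith_orientedDist hD_ne hD_univ hdD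
  have hcl : ∀ t, closure (Dt t) ⊆ {x | dD x ≤ t} := fun t => by
    rw [hDt]
    exact closure_lt_subset_le hlip.continuous continuous_const
  have hΓ_mem : ∀ ε x, -ε < dD x → dD x < ε → x ∈ Γ ε := fun ε x h₁ h₂ => by
    rw [hΓ]
    refine ⟨?_, fun h => h₁.not_ge (hcl _ h)⟩
    rw [hDt]
    exact h₂
  have hΓ_sub : ∀ ε, Γ ε ⊆ dD ⁻¹' Ico (-ε) ε := fun ε x hx => by
    rw [hΓ, hDt, hDt] at hx
    exact ⟨not_lt.1 fun h => hx.2 (subset_closure h), hx.1⟩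
  obtain ⟨U, hU, hFU, hC1, -⟩ := hC11
  have hslope : ∀ y, |dD y| < 4 * (ε₀ / 2) →
      HasUnitSlope dD y ∧ HasUnitSlope (fun z => -dD z) y := fun y hy =>
    hasUnitSlope_orientedDist hD_ne hD_open hD_bdd hD_univ hdD (R := 2 * ε₀)
      (fun z hz => hproj z (hΓ_mem _ z (abs_lt.1 hz).1 (abs_lt.1 hz).2)) hU hFU hC1
      (by linarith)
  obtain ⟨C, hC, hmain⟩ := hardy_of_hasUnitSlope hlip (half_pos hε₀) hslope hα
  refine ⟨C, hC, fun ε hε u hu hdiff => ?_⟩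
  have hδ : ∀ x ∈ dD ⁻¹' Ico (-ε) ε, Metric.infDist x (frontier (Dt ε)) = ε - dD x := by
    intro x hx
    obtain ⟨v, hv, hray⟩ := exists_unit_direction hlip (fun y hy => (hslope y hy).1)
      (fun y hy => (hslope y hy).2) (x := x)
      (abs_lt.2 ⟨by linarith [hx.1, hε.2], by linarith [hx.2, hε.2]⟩)
    rw [hDt]
    refine infDist_frontier_sublevel hlip hv hx.2 fun s hs => hray s (abs_lt.2 ⟨?_, ?_⟩)
    · linarith [hx.1, hs.1, hε.2]
    · linarith [hs.2, hε.2]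
  have hDpre : dD ⁻¹' Iio 0 = D := Set.ext fun x => orientedDist_neg_iff hD_ne hD_univ hD_open hdD
  have hm : ∀ a b, MeasurableSet (dD ⁻¹' Ico a b) := fun a b =>
    hlip.continuous.measurable measurableSet_Ico
  have key := hmain ε (by rwa [mul_div_cancel₀ _ two_ne_zero]) u hu
    fun x hx => hdiff x (by rw [hDt]; exact hx)
  have hleft : (∫⁻ x in Γ ε,
      ENNReal.ofReal (|u x| * Metric.infDist x (frontier (Dt ε)) ^ (α - 1))) ≤
      ∫⁻ x in dD ⁻¹' Ico (-ε) ε, ‖u x‖ₑ * ENNReal.ofReal ((ε - dD x) ^ (α - 1)) := by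
    refine (lintegral_mono_set (hΓ_sub ε)).trans (setLIntegral_mono' (hm _ _) fun x hx => ?_)
    rw [ENNReal.ofReal_mul (abs_nonneg _), hδ x hx, Real.enorm_eq_ofReal_abs]
  have hD_int : (∫⁻ x in dD ⁻¹' Iio 0, (‖u x‖ₑ + ‖fderiv ℝ u x‖ₑ)) =
      ∫⁻ x in D, ENNReal.ofReal (|u x| + ‖fderiv ℝ u x‖) := by
    rw [hDpre]
    refine lintegral_congr fun x => ?_
    rw [ENNReal.ofReal_add (abs_nonneg _) (norm_nonneg _), Real.enorm_eq_ofReal_abs, ofReal_norm]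
  have hright : (∫⁻ x in dD ⁻¹' Ico 0 ε, ‖fderiv ℝ u x‖ₑ * ENNReal.ofReal ((ε - dD x) ^ α)) ≤
      ∫⁻ x in Γ ε,
        ENNReal.ofReal (‖fderiv ℝ u x‖ * Metric.infDist x (frontier (Dt ε)) ^ α) := by
    refine (setLIntegral_mono' (hm _ _) fun x hx => ?_).trans (lintegral_mono_set fun x hx =>
      hΓ_mem ε x (by linarith [hx.1, hε.1]) hx.2)
    rw [ENNReal.ofReal_mul (norm_nonneg _), hδ x ⟨by linarith [hx.1, hε.1], hx.2⟩, ofReal_norm]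
  refine hleft.trans (key.trans (mul_le_mul_right (add_le_add ?_ hright) _))
  rw [hD_int]
end
end

section
/- Let 1 ≤ p < ∞ and assume D_ε is connected for each ε ∈ [0, ε₀]. Then there exists a constant C independent of ε such that for every ε ∈ [0, ε₀] and every u ∈ W^{1,p}(D_ε; ω^ε), the weighted Poincaré inequality ‖u − ū_{D_ε}‖_{L^p(D_ε;ω^ε)} ≤ C ‖∇u‖_{L^p(D_ε;ω^ε)} holds, where ū_{D_ε} = (∫_{D_ε} u ω^ε dx) / (∫_{D_ε} ω^ε dx) is the weighted mean value of u. -/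
open MeasureTheory ENNReal Set Filter Topology
open scoped RealInnerProductSpace

noncomputable section

/-- Fundamental theorem of calculus combined with Jensen's inequality on the unit interval. -/
theorem enorm_sub_rpow_le_lintegral_deriv {g : ℝ → ℝ} {p : ℝ} (hp : 1 ≤ p)
    (hg : ∀ t ∈ Icc (0 : ℝ) 1, DifferentiableAt ℝ g t) :
    ‖g 1 - g 0‖ₑ ^ p ≤ ∫⁻ t in Icc (0 : ℝ) 1, ‖deriv g t‖ₑ ^ p := by
  have hp0 : 0 < p := by linarith
  have h1 : ‖g 1 - g 0‖ₑ ≤ ∫⁻ t in Icc (0 : ℝ) 1, ‖deriv g t‖ₑ := by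
    by_cases hfin : ∫⁻ t in Icc (0 : ℝ) 1, ‖deriv g t‖ₑ = ⊤
    · rw [hfin]; exact le_top
    have hint : IntervalIntegrable (deriv g) volume 0 1 := by
      rw [intervalIntegrable_iff_integrableOn_Icc_of_le zero_le_one]
      exact ⟨(measurable_deriv g).aestronglyMeasurable, lt_top_iff_ne_top.2 hfin⟩
    rw [← intervalIntegral.integral_eq_sub_of_hasDerivAt (f' := deriv g) (fun t ht => by
      rw [uIcc_of_le zero_le_one] at ht
      exact (hg t ht).hasDerivAt) hint, intervalIntegral.integral_of_le zero_le_one,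
      ← integral_Icc_eq_integral_Ioc]
    exact enorm_integral_le_lintegral_enorm _
  have : IsProbabilityMeasure (volume.restrict (Icc (0 : ℝ) 1)) := ⟨by simp⟩
  have h2 := eLpNorm_le_eLpNorm_of_exponent_le (μ := volume.restrict (Icc (0 : ℝ) 1))
    (p := 1) (q := ENNReal.ofReal p) (by simpa using hp)
    (measurable_deriv g).aestronglyMeasurable
  rw [eLpNorm_one_eq_lintegral_enorm, eLpNorm_eq_lintegral_rpow_enorm_toReal
    (by simpa using hp0) ofReal_ne_top, ENNReal.toReal_ofReal hp0.le] at h2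
  calc ‖g 1 - g 0‖ₑ ^ p ≤ ((∫⁻ t in Icc (0 : ℝ) 1, ‖deriv g t‖ₑ ^ p) ^ (1 / p)) ^ p := by
        gcongr; exact h1.trans h2
    _ = _ := by rw [← ENNReal.rpow_mul, one_div_mul_cancel hp0.ne', ENNReal.rpow_one]

theorem enorm_translate_sub_rpow_le {E : Type*} [NormedAddCommGroup E] [NormedSpace ℝ E] {p : ℝ}
    (hp : 1 ≤ p) {u : E → ℝ} {x v : E}
    (hu : ∀ t ∈ Icc (0 : ℝ) 1, DifferentiableAt ℝ u (x + t • v)) :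
    ‖u (x + v) - u x‖ₑ ^ p ≤
      ‖v‖ₑ ^ p * ∫⁻ t in Icc (0 : ℝ) 1, ‖fderiv ℝ u (x + t • v)‖ₑ ^ p := by
  have hp0 : 0 ≤ p := by linarith
  have hd : ∀ t ∈ Icc (0 : ℝ) 1,
      HasDerivAt (fun t : ℝ => u (x + t • v)) (fderiv ℝ u (x + t • v) v) t := by
    intro t ht
    have h1 : HasDerivAt (fun t : ℝ => x + t • v) v t := by
      simpa using ((hasDerivAt_id t).smul_const v).const_add x
    exact (hu t ht).hasFDerivAt.comp_hasDerivAt t h1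
  have h := enorm_sub_rpow_le_lintegral_deriv hp fun t ht => (hd t ht).differentiableAt
  simp only [one_smul, zero_smul, add_zero] at h
  refine h.trans ?_
  rw [← lintegral_const_mul' _ _ (by simp [ENNReal.rpow_eq_top_iff, not_lt.2 hp0])]
  refine setLIntegral_mono' measurableSet_Icc fun t ht => ?_
  rw [(hd t ht).deriv, mul_comm, ← ENNReal.mul_rpow_of_nonneg _ _ hp0]
  gcongr
  exact ContinuousLinearMap.le_opENorm _ _

section ControlledBy

variable {E : Type*} [NormedAddCommGroup E] [NormedSpace ℝ E] [MeasurableSpace E]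

/-- On every weight of the class `𝒲`, the distance of `u` to any constant on `R` is controlled
by the distance on the base set `B` and the weighted gradient. -/
def ControlledBy (μ : Measure E) (p : ℝ) (𝒲 : Set (E → ℝ≥0∞)) (B R : Set E) : Prop :=
  ∃ C : ℝ≥0∞, C ≠ ⊤ ∧ ∀ w ∈ 𝒲, ∀ u : E → ℝ, Measurable u →
    (∀ x, w x ≠ 0 → DifferentiableAt ℝ u x) → ∀ c : ℝ,
    ∫⁻ x in R, ‖u x - c‖ₑ ^ p * w x ∂μ ≤
      C * (∫⁻ x in B, ‖u x - c‖ₑ ^ p * w x ∂μ + ∫⁻ x, ‖fderiv ℝ u x‖ₑ ^ p * w x ∂μ)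

variable {μ : Measure E} {p : ℝ} {𝒲 : Set (E → ℝ≥0∞)} {B R R' : Set E}

theorem controlledBy_empty : ControlledBy μ p 𝒲 B ∅ :=
  ⟨0, by simp, fun w _ u _ _ c => by simp⟩

theorem controlledBy_self : ControlledBy μ p 𝒲 B B :=
  ⟨1, by simp, fun w _ u _ _ c => by rw [one_mul]; exact le_self_add⟩

theorem ControlledBy.mono (h : ControlledBy μ p 𝒲 B R') (hR : R ⊆ R') :
    ControlledBy μ p 𝒲 B R := by
  obtain ⟨C, hC, h⟩ := h
  exact ⟨C, hC, fun w hw u hu hd c => (lintegral_mono_set hR).trans (h w hw u hu hd c)⟩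

theorem ControlledBy.union (h : ControlledBy μ p 𝒲 B R) (h' : ControlledBy μ p 𝒲 B R') :
    ControlledBy μ p 𝒲 B (R ∪ R') := by
  obtain ⟨C, hC, h⟩ := h
  obtain ⟨C', hC', h'⟩ := h'
  refine ⟨C + C', by simp [hC, hC'], fun w hw u hu hd c => ?_⟩
  rw [add_mul]
  exact (lintegral_union_le _ _ _).trans (add_le_add (h w hw u hu hd c) (h' w hw u hu hd c))

variable [FiniteDimensional ℝ E] [BorelSpace E] [μ.IsAddHaarMeasure]

/-- The `p`-th power of the oscillation of `u` along a translation is controlled by the weighted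
gradient, provided the weight does not drop by more than a factor `2` along the way. -/
theorem lintegral_translate_sub_le (hp : 1 ≤ p) {w : E → ℝ≥0∞} (hw : Measurable w) {u : E → ℝ}
    (hu : ∀ x, w x ≠ 0 → DifferentiableAt ℝ u x) {N : Set E} (hN : MeasurableSet N) {v : E}
    (hv : ∀ x ∈ N, ∀ t ∈ Icc (0 : ℝ) 1, w x ≤ 2 * w (x + t • v)) :
    ∫⁻ x in N, ‖u (x + v) - u x‖ₑ ^ p * w x ∂μ ≤
      2 * ‖v‖ₑ ^ p * ∫⁻ x, ‖fderiv ℝ u x‖ₑ ^ p * w x ∂μ := by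
  have hp0 : 0 ≤ p := by linarith
  have hvtop : 2 * ‖v‖ₑ ^ p ≠ ⊤ :=
    mul_ne_top (by simp) (by simp [ENNReal.rpow_eq_top_iff, not_lt.2 hp0])
  have hF : Measurable fun x => ‖fderiv ℝ u x‖ₑ ^ p * w x :=
    ((measurable_fderiv ℝ u).enorm.pow_const p).mul hw
  have hpt : ∀ x ∈ N, ‖u (x + v) - u x‖ₑ ^ p * w x ≤ ∫⁻ t in Icc (0 : ℝ) 1,
      2 * ‖v‖ₑ ^ p * (‖fderiv ℝ u (x + t • v)‖ₑ ^ p * w (x + t • v)) := by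
    intro x hx
    by_cases h0 : w x = 0
    · simp [h0]
    have hdiff : ∀ t ∈ Icc (0 : ℝ) 1, DifferentiableAt ℝ u (x + t • v) := fun t ht =>
      hu _ fun h => h0 (by simpa [h] using hv x hx t ht)
    have hm : Measurable fun t : ℝ => ‖fderiv ℝ u (x + t • v)‖ₑ ^ p :=
      ((measurable_fderiv ℝ u).enorm.pow_const p).comp (by fun_prop)
    calc ‖u (x + v) - u x‖ₑ ^ p * w x
        ≤ (‖v‖ₑ ^ p * ∫⁻ t in Icc (0 : ℝ) 1, ‖fderiv ℝ u (x + t • v)‖ₑ ^ p) * w x := by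
          gcongr; exact enorm_translate_sub_rpow_le hp hdiff
      _ = ∫⁻ t in Icc (0 : ℝ) 1, ‖v‖ₑ ^ p * ‖fderiv ℝ u (x + t • v)‖ₑ ^ p * w x := by
          rw [lintegral_mul_const _ (by fun_prop), lintegral_const_mul _ hm]
      _ ≤ _ := setLIntegral_mono' measurableSet_Icc fun t ht => by
          calc _ ≤ ‖v‖ₑ ^ p * ‖fderiv ℝ u (x + t • v)‖ₑ ^ p * (2 * w (x + t • v)) := by
                gcongr; exact hv x hx t ht
            _ = _ := by ring
  have hmeas : Measurable (Function.uncurry fun (x : E) (t : ℝ) =>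
      2 * ‖v‖ₑ ^ p * (‖fderiv ℝ u (x + t • v)‖ₑ ^ p * w (x + t • v))) :=
    (hF.comp (g := fun x => ‖fderiv ℝ u x‖ₑ ^ p * w x)
      (f := fun z : E × ℝ => z.1 + z.2 • v) (by fun_prop)).const_mul _
  calc ∫⁻ x in N, ‖u (x + v) - u x‖ₑ ^ p * w x ∂μ
      ≤ ∫⁻ x in N, (∫⁻ t in Icc (0 : ℝ) 1,
          2 * ‖v‖ₑ ^ p * (‖fderiv ℝ u (x + t • v)‖ₑ ^ p * w (x + t • v))) ∂μ :=
        setLIntegral_mono' hN hpt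
    _ ≤ ∫⁻ x, (∫⁻ t in Icc (0 : ℝ) 1,
          2 * ‖v‖ₑ ^ p * (‖fderiv ℝ u (x + t • v)‖ₑ ^ p * w (x + t • v))) ∂μ :=
        setLIntegral_le_lintegral _ _
    _ = ∫⁻ t in Icc (0 : ℝ) 1, ∫⁻ x,
          2 * ‖v‖ₑ ^ p * (‖fderiv ℝ u (x + t • v)‖ₑ ^ p * w (x + t • v)) ∂μ :=
        lintegral_lintegral_swap hmeas.aemeasurable
    _ = ∫⁻ _ in Icc (0 : ℝ) 1, 2 * ‖v‖ₑ ^ p * ∫⁻ x, ‖fderiv ℝ u x‖ₑ ^ p * w x ∂μ := by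
        refine lintegral_congr fun t => ?_
        rw [lintegral_const_mul' _ _ hvtop,
          lintegral_add_right_eq_self (fun x => ‖fderiv ℝ u x‖ₑ ^ p * w x) (t • v)]
    _ = _ := by simp

theorem ControlledBy.translate (hp : 1 ≤ p) (h𝒲 : ∀ w ∈ 𝒲, Measurable w)
    (h : ControlledBy μ p 𝒲 B R) {N : Set E} (hN : MeasurableSet N) {v : E}
    (hNR : ∀ x ∈ N, x + v ∈ R)
    (hv : ∀ w ∈ 𝒲, ∀ x ∈ N, ∀ t ∈ Icc (0 : ℝ) 1, w x ≤ 2 * w (x + t • v)) :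
    ControlledBy μ p 𝒲 B N := by
  obtain ⟨C, hC, h⟩ := h
  have hp0 : 0 ≤ p := by linarith
  refine ⟨2 ^ (p - 1) * (2 * C + 2 * ‖v‖ₑ ^ p), ?_, fun w hw u hu hd c => ?_⟩
  · refine mul_ne_top (by simp [ENNReal.rpow_eq_top_iff]) (add_ne_top.2
      ⟨mul_ne_top (by simp) hC, mul_ne_top (by simp) ?_⟩)
    simp [ENNReal.rpow_eq_top_iff, not_lt.2 hp0]
  set G := ∫⁻ x, ‖fderiv ℝ u x‖ₑ ^ p * w x ∂μ
  set A := ∫⁻ x in B, ‖u x - c‖ₑ ^ p * w x ∂μ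
  have hwm := h𝒲 w hw
  have hpt : ∀ x ∈ N, ‖u x - c‖ₑ ^ p * w x ≤ 2 ^ (p - 1) *
      (2 * (‖u (x + v) - c‖ₑ ^ p * w (x + v)) + ‖u (x + v) - u x‖ₑ ^ p * w x) := by
    intro x hx
    have h1 : ‖u x - c‖ₑ ≤ ‖u (x + v) - c‖ₑ + ‖u (x + v) - u x‖ₑ := by
      have : u x - c = (u (x + v) - c) - (u (x + v) - u x) := by ring
      rw [this]; exact enorm_sub_le
    have h2 : w x ≤ 2 * w (x + v) := by simpa using hv w hw x hx 1 (by simp)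
    calc ‖u x - c‖ₑ ^ p * w x
        ≤ (2 ^ (p - 1) * (‖u (x + v) - c‖ₑ ^ p + ‖u (x + v) - u x‖ₑ ^ p)) * w x := by
          gcongr
          exact (ENNReal.rpow_le_rpow h1 hp0).trans
            (ENNReal.rpow_add_le_mul_rpow_add_rpow _ _ hp)
      _ = 2 ^ (p - 1) * (‖u (x + v) - c‖ₑ ^ p * w x + ‖u (x + v) - u x‖ₑ ^ p * w x) := by ring
      _ ≤ 2 ^ (p - 1) * (‖u (x + v) - c‖ₑ ^ p * (2 * w (x + v))
            + ‖u (x + v) - u x‖ₑ ^ p * w x) := by gcongr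
      _ = _ := by ring
  have hm1 : Measurable fun x => ‖u x - c‖ₑ ^ p * w x := by fun_prop
  have hm1' : Measurable fun x => ‖u (x + v) - c‖ₑ ^ p * w (x + v) :=
    hm1.comp (measurable_add_const v)
  have hm2 : Measurable fun x => ‖u (x + v) - u x‖ₑ ^ p * w x :=
    (((hu.comp (measurable_add_const v)).sub hu).enorm.pow_const p).mul hwm
  have htr : ∫⁻ x in N, ‖u (x + v) - c‖ₑ ^ p * w (x + v) ∂μ ≤ C * (A + G) := by
    refine le_trans ?_ (h w hw u hu hd c)
    have hsub : N ⊆ (fun x => x + v) ⁻¹' R := hNR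
    refine (lintegral_mono_set hsub).trans_eq ?_
    exact (measurePreserving_add_right μ v).setLIntegral_comp_preimage_emb
      (MeasurableEquiv.addRight v).measurableEmbedding (fun x => ‖u x - c‖ₑ ^ p * w x) R
  calc ∫⁻ x in N, ‖u x - c‖ₑ ^ p * w x ∂μ
      ≤ ∫⁻ x in N, 2 ^ (p - 1) * (2 * (‖u (x + v) - c‖ₑ ^ p * w (x + v))
          + ‖u (x + v) - u x‖ₑ ^ p * w x) ∂μ := setLIntegral_mono' hN hpt
    _ = 2 ^ (p - 1) * (2 * ∫⁻ x in N, ‖u (x + v) - c‖ₑ ^ p * w (x + v) ∂μ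
          + ∫⁻ x in N, ‖u (x + v) - u x‖ₑ ^ p * w x ∂μ) := by
        rw [lintegral_const_mul' _ _ (by simp [ENNReal.rpow_eq_top_iff]),
          lintegral_add_right _ hm2, lintegral_const_mul _ hm1']
    _ ≤ 2 ^ (p - 1) * (2 * (C * (A + G)) + 2 * ‖v‖ₑ ^ p * G) := by
        gcongr
        exact lintegral_translate_sub_le hp hwm hd hN (hv w hw)
    _ ≤ 2 ^ (p - 1) * (2 * (C * (A + G)) + 2 * ‖v‖ₑ ^ p * (A + G)) := by
        gcongr; exact le_add_self
    _ = _ := by ring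

/-- Weighted Poincaré inequality on a ball, in terms of some constant. -/
theorem exists_const_lintegral_ball_le (hp : 1 ≤ p) (h𝒲 : ∀ w ∈ 𝒲, Measurable w) {a : E}
    {r : ℝ} (hr : 0 < r)
    (hcomp : ∀ w ∈ 𝒲, ∀ x ∈ Metric.ball a r, ∀ y ∈ Metric.ball a (3 * r), w x ≤ 2 * w y) :
    ∃ C : ℝ≥0∞, C ≠ ⊤ ∧ ∀ w ∈ 𝒲, ∀ u : E → ℝ, Measurable u →
      (∀ x, w x ≠ 0 → DifferentiableAt ℝ u x) → ∃ c : ℝ,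
      ∫⁻ x in Metric.ball a r, ‖u x - c‖ₑ ^ p * w x ∂μ ≤
        C * ∫⁻ x, ‖fderiv ℝ u x‖ₑ ^ p * w x ∂μ := by
  have hp0 : 0 ≤ p := by linarith
  set B := Metric.ball a r with hB
  set H := Metric.ball (0 : E) (2 * r) with hH
  have hB0 : μ B ≠ 0 := (Metric.measure_ball_pos μ a hr).ne'
  have hBt : μ B ≠ ⊤ := measure_ball_lt_top.ne
  refine ⟨μ H * (2 * ENNReal.ofReal (2 * r) ^ p) / μ B, ?_, fun w hw u hu hd => ?_⟩
  · refine ENNReal.div_ne_top (mul_ne_top measure_ball_lt_top.ne (mul_ne_top (by simp) ?_)) hB0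
    exact ENNReal.rpow_ne_top_of_nonneg hp0 ofReal_ne_top
  have hwm := h𝒲 w hw
  set G := ∫⁻ x, ‖fderiv ℝ u x‖ₑ ^ p * w x ∂μ
  have hstep : ∀ h ∈ H, ∫⁻ x in B, ‖u (x + h) - u x‖ₑ ^ p * w x ∂μ ≤
      2 * ENNReal.ofReal (2 * r) ^ p * G := by
    intro h hh
    have hh' : ‖h‖ < 2 * r := by simpa [hH] using hh
    refine (lintegral_translate_sub_le hp hwm hd measurableSet_ball fun x hx t ht => ?_).trans ?_
    · refine hcomp w hw x hx _ ?_
      have hx' : ‖x - a‖ < r := by simpa [hB, dist_eq_norm] using hx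
      rw [Metric.mem_ball, dist_eq_norm]
      calc ‖x + t • h - a‖ = ‖(x - a) + t • h‖ := by congr 1; abel
        _ ≤ ‖x - a‖ + ‖t • h‖ := norm_add_le _ _
        _ ≤ ‖x - a‖ + 1 * ‖h‖ := by
            rw [norm_smul, Real.norm_of_nonneg ht.1]; gcongr; exact ht.2
        _ < 3 * r := by linarith
    · gcongr
      rw [← ofReal_norm]
      exact ENNReal.ofReal_le_ofReal hh'.le
  have hm : Measurable (Function.uncurry fun (x h : E) => ‖u (x + h) - u x‖ₑ ^ p * w x) := by
    refine Measurable.mul (Measurable.pow_const (Measurable.enorm (Measurable.sub ?_ ?_)) p) ?_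
    · exact hu.comp (measurable_fst.add measurable_snd)
    · exact hu.comp measurable_fst
    · exact hwm.comp measurable_fst
  have hm' : Measurable (Function.uncurry fun (x y : E) => ‖u x - u y‖ₑ ^ p * w x) := by
    refine Measurable.mul (Measurable.pow_const (Measurable.enorm (Measurable.sub ?_ ?_)) p) ?_
    · exact hu.comp measurable_fst
    · exact hu.comp measurable_snd
    · exact hwm.comp measurable_fst
  have hdouble : ∫⁻ y in B, ∫⁻ x in B, ‖u x - u y‖ₑ ^ p * w x ∂μ ∂μ ≤
      μ H * (2 * ENNReal.ofReal (2 * r) ^ p) * G := by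
    calc ∫⁻ y in B, ∫⁻ x in B, ‖u x - u y‖ₑ ^ p * w x ∂μ ∂μ
        = ∫⁻ x in B, ∫⁻ y in B, ‖u x - u y‖ₑ ^ p * w x ∂μ ∂μ :=
          (lintegral_lintegral_swap hm'.aemeasurable).symm
      _ ≤ ∫⁻ x in B, ∫⁻ h in H, ‖u (x + h) - u x‖ₑ ^ p * w x ∂μ ∂μ := by
          refine setLIntegral_mono' measurableSet_ball fun x hx => ?_
          rw [← (measurePreserving_add_left μ x).setLIntegral_comp_preimage_emb
            (MeasurableEquiv.addLeft x).measurableEmbedding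
            (fun y => ‖u x - u y‖ₑ ^ p * w x) B]
          simp_rw [enorm_sub_rev (u x)]
          refine lintegral_mono_set fun h hh => ?_
          simp only [hB, hH, mem_preimage, Metric.mem_ball, dist_eq_norm, sub_zero] at hx hh ⊢
          calc ‖h‖ = ‖(x + h - a) - (x - a)‖ := by congr 1; abel
            _ ≤ _ := norm_sub_le _ _
            _ < 2 * r := by linarith
      _ = ∫⁻ h in H, ∫⁻ x in B, ‖u (x + h) - u x‖ₑ ^ p * w x ∂μ ∂μ :=
          lintegral_lintegral_swap hm.aemeasurable
      _ ≤ ∫⁻ _ in H, 2 * ENNReal.ofReal (2 * r) ^ p * G ∂μ :=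
          setLIntegral_mono' measurableSet_ball hstep
      _ = _ := by rw [setLIntegral_const]; ring
  obtain ⟨y, -, hy⟩ := exists_le_setLAverage hB0 hBt
    (hm'.lintegral_prod_left' (μ := μ.restrict B)).aemeasurable
  refine ⟨u y, ?_⟩
  refine (show _ ≤ _ from hy).trans ?_
  rw [setLAverage_eq, ENNReal.div_eq_inv_mul, ENNReal.div_eq_inv_mul, mul_assoc]
  gcongr
  exact hdouble

/-- Control propagates from a base ball through a connected open set on which the weights are
comparable to constants. -/
theorem controlledBy_of_isPreconnected (hp : 1 ≤ p) (h𝒲 : ∀ w ∈ 𝒲, Measurable w) {D : Set E}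
    (hD : IsOpen D) (hD' : IsPreconnected D) (hcomp : ∀ w ∈ 𝒲, ∀ x ∈ D, ∀ y ∈ D, w x ≤ 2 * w y)
    {a : E} {r : ℝ} (hr : 0 < r) (ha : a ∈ D) {x : E} (hx : x ∈ D) :
    ∃ ρ > 0, ControlledBy μ p 𝒲 (Metric.ball a r) (Metric.ball x ρ) := by
  set U := {x | ∃ ρ > 0, ControlledBy μ p 𝒲 (Metric.ball a r) (Metric.ball x ρ)} with hU
  have hUo : IsOpen U := by
    rw [Metric.isOpen_iff]
    rintro x ⟨ρ, hρ, h⟩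
    refine ⟨ρ / 2, by positivity, fun y hy => ⟨ρ / 2, by positivity, h.mono ?_⟩⟩
    refine Metric.ball_subset_ball' ?_
    rw [Metric.mem_ball] at hy
    linarith
  refine hD'.subset_of_closure_inter_subset hUo ⟨a, ha, r, hr, controlledBy_self⟩ ?_ hx
  rintro x ⟨hxc, hxD⟩
  obtain ⟨s, hs, hsD⟩ := Metric.isOpen_iff.1 hD x hxD
  obtain ⟨y, ⟨ρ, hρ, h⟩, hxy⟩ := Metric.mem_closure_iff.1 hxc (s / 2) (by positivity)
  have hxy' : ‖y - x‖ < s / 2 := by rwa [← dist_eq_norm, dist_comm]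
  refine ⟨min ρ (s / 2), by positivity, h.translate hp h𝒲 measurableSet_ball (v := y - x) ?_ ?_⟩
  · intro z hz
    have := (Metric.mem_ball.1 hz).trans_le (min_le_left _ _)
    rw [dist_eq_norm] at this
    rwa [Metric.mem_ball, dist_eq_norm, show z + (y - x) - y = z - x by abel]
  · intro w hw z hz t ht
    have hz' := (Metric.mem_ball.1 hz).trans_le (min_le_right _ _)
    refine hcomp w hw z (hsD ?_) _ (hsD ?_)
    · rw [Metric.mem_ball]; linarith
    · rw [dist_eq_norm] at hz'
      rw [Metric.mem_ball, dist_eq_norm]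
      calc ‖z + t • (y - x) - x‖ = ‖(z - x) + t • (y - x)‖ := by congr 1; abel
        _ ≤ ‖z - x‖ + ‖t • (y - x)‖ := norm_add_le _ _
        _ ≤ ‖z - x‖ + 1 * ‖y - x‖ := by
            rw [norm_smul, Real.norm_of_nonneg ht.1]; gcongr; exact ht.2
        _ < s := by linarith

/-- If every point of a compact sublevel set of `d` either has a controlled neighbourhood or
a neighbourhood that can be translated to strictly lower levels, then the whole sublevel set is
controlled, for weights that decrease with `d`. -/
theorem controlledBy_of_descent (hp : 1 ≤ p) (h𝒲 : ∀ w ∈ 𝒲, Measurable w) {d : E → ℝ}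
    (hd : Continuous d) (hanti : ∀ w ∈ 𝒲, ∀ x y, d y ≤ d x → w x ≤ w y) {T : ℝ}
    (hT : IsCompact {x | d x ≤ T})
    (hloc : ∀ x, d x ≤ T → ∃ r > 0, ControlledBy μ p 𝒲 B (Metric.ball x r) ∨
      ∃ v : E, ∃ c > 0, ∀ y ∈ Metric.ball x r, d (y + v) ≤ d y - c ∧
        ∀ t ∈ Icc (0 : ℝ) 1, d (y + t • v) ≤ d y) :
    ControlledBy μ p 𝒲 B {x | d x ≤ T} := by
  have hunif : ∃ c > 0, ∀ s, ControlledBy μ p 𝒲 B ({x | d x ≤ T} ∩ {x | d x ≤ s}) →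
      ControlledBy μ p 𝒲 B ({x | d x ≤ T} ∩ ({x | d x ≤ T} ∩ {x | d x ≤ s + c})) := by
    refine hT.induction_on (p := fun A => ∃ c > 0, ∀ s,
      ControlledBy μ p 𝒲 B ({x | d x ≤ T} ∩ {x | d x ≤ s}) →
      ControlledBy μ p 𝒲 B (A ∩ ({x | d x ≤ T} ∩ {x | d x ≤ s + c}))) ?_ ?_ ?_ ?_
    · exact ⟨1, one_pos, fun s _ => by rw [empty_inter]; exact controlledBy_empty⟩
    · rintro A A' hA ⟨c, hc, h⟩
      exact ⟨c, hc, fun s hs => (h s hs).mono (inter_subset_inter_left _ hA)⟩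
    · rintro A A' ⟨c, hc, h⟩ ⟨c', hc', h'⟩
      refine ⟨min c c', lt_min hc hc', fun s hs => ?_⟩
      rw [union_inter_distrib_right]
      refine ((h s hs).mono ?_).union ((h' s hs).mono ?_)
      · rintro x ⟨hx, hxT, hxs⟩
        simp only [mem_ofPred_eq] at hxs
        exact ⟨hx, hxT, hxs.trans (add_le_add_right (min_le_left c c') s)⟩
      · rintro x ⟨hx, hxT, hxs⟩
        simp only [mem_ofPred_eq] at hxs
        exact ⟨hx, hxT, hxs.trans (add_le_add_right (min_le_right c c') s)⟩
    · intro x hx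
      obtain ⟨r, hr, h | ⟨v, c, hc, h⟩⟩ := hloc x hx
      · exact ⟨Metric.ball x r, mem_nhdsWithin_of_mem_nhds (Metric.ball_mem_nhds x hr), 1, one_pos,
          fun s _ => h.mono inter_subset_left⟩
      · refine ⟨Metric.ball x r, mem_nhdsWithin_of_mem_nhds (Metric.ball_mem_nhds x hr), c, hc,
          fun s hs => hs.translate hp h𝒲 ?_ (v := v) ?_ ?_⟩
        · exact measurableSet_ball.inter ((measurableSet_le hd.measurable measurable_const).inter
            (measurableSet_le hd.measurable measurable_const))
        · rintro y ⟨hy, hyT, hys⟩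
          have h1 := (h y hy).1
          simp only [mem_ofPred_eq, mem_inter_iff] at hyT hys ⊢
          constructor <;> linarith
        · rintro w hw y ⟨hy, -, -⟩ t ht
          refine (hanti w hw _ _ ((h y hy).2 t ht)).trans ?_
          rw [two_mul]; exact le_self_add
  obtain ⟨c, hc, hstep⟩ := hunif
  obtain ⟨m, hm⟩ := (hT.image hd).bddBelow
  have hk : ∀ k : ℕ,
      ControlledBy μ p 𝒲 B ({x | d x ≤ T} ∩ {x | d x ≤ m - 1 + k * c}) := by
    intro k
    induction k with
    | zero =>
      refine controlledBy_empty.mono ?_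
      rintro x ⟨hxT, hx⟩
      have := hm (mem_image_of_mem d hxT)
      simp only [mem_ofPred_eq] at hx
      norm_num at hx
      linarith
    | succ k ih =>
      refine (hstep _ ih).mono ?_
      rintro x ⟨hxT, hx⟩
      refine ⟨hxT, hxT, ?_⟩
      simp only [mem_ofPred_eq] at hx ⊢
      push_cast at hx
      linarith
  obtain ⟨k, hk'⟩ := exists_nat_ge ((T - (m - 1)) / c)
  refine (hk k).mono fun x hx => ⟨hx, ?_⟩
  rw [div_le_iff₀ hc] at hk'
  simp only [mem_ofPred_eq] at hx ⊢
  linarith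

end ControlledBy

/-- Near a point with a unique nearest point of `D`, moving in a suitable fixed direction decreases
the distance to `D`. -/
theorem exists_descent_of_unique_nearest {E : Type*} [NormedAddCommGroup E]
    [InnerProductSpace ℝ E] [FiniteDimensional ℝ E] {D : Set E} (hD : D.Nonempty) {x₀ y₀ : E}
    (hx₀ : 0 < Metric.infDist x₀ D) (hy₀ : dist x₀ y₀ = Metric.infDist x₀ D)
    (huniq : ∀ y ∈ frontier D, dist x₀ y = Metric.infDist x₀ D → y = y₀) :
    ∃ r > 0, ∃ e : E, ∃ τ > 0, ∃ c > 0, ∀ x ∈ Metric.ball x₀ r, ∀ t ∈ Icc 0 τ,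
      Metric.infDist (x + t • e) D ≤ Metric.infDist x D - c * t := by
  set δ := Metric.infDist x₀ D with hδ
  have hproj : ∃ r > 0, ∀ x ∈ Metric.ball x₀ r, ∀ y ∈ frontier D,
      dist x y = Metric.infDist x D → dist y y₀ < δ / 4 := by
    set F := frontier D \ Metric.ball y₀ (δ / 4) with hF
    have hFc : IsClosed F := isClosed_frontier.sdiff Metric.isOpen_ball
    rcases F.eq_empty_or_nonempty with hFe | hFn
    · refine ⟨1, one_pos, fun x _ y hy _ => ?_⟩
      by_contra hcon
      have : y ∈ F := ⟨hy, hcon⟩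
      simp [hFe] at this
    obtain ⟨z, hzF, hz⟩ := hFc.exists_infDist_eq_dist hFn x₀
    have hle : ∀ y ∈ frontier D, δ ≤ dist x₀ y := fun y hy => by
      rw [hδ, ← Metric.infDist_closure]
      exact Metric.infDist_le_dist_of_mem (frontier_subset_closure hy)
    have hgap : δ < Metric.infDist x₀ F := by
      refine lt_of_le_of_ne (hz ▸ hle z hzF.1) fun h => ?_
      have := huniq z hzF.1 (by rw [← hz, ← h])
      rw [this] at hzF
      exact hzF.2 (Metric.mem_ball_self (by positivity))
    refine ⟨(Metric.infDist x₀ F - δ) / 2, by linarith, fun x hx y hy hxy => ?_⟩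
    by_contra hcon
    have hyF : y ∈ F := ⟨hy, hcon⟩
    have h1 := Metric.infDist_le_dist_of_mem (x := x₀) hyF
    have h2 := dist_triangle x₀ x y
    have h3 : Metric.infDist x D ≤ δ + dist x x₀ := Metric.infDist_le_infDist_add_dist
    rw [Metric.mem_ball] at hx
    rw [dist_comm x₀ x] at h2
    linarith
  obtain ⟨r, hr, hproj⟩ := hproj
  refine ⟨min r (δ / 4), by positivity, δ⁻¹ • (y₀ - x₀), δ / 2, by positivity, 1 / 8,
    by norm_num, fun x hx t ht => ?_⟩
  have hxr := (Metric.mem_ball.1 hx).trans_le (min_le_left _ _)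
  have hxδ := (Metric.mem_ball.1 hx).trans_le (min_le_right _ _)
  set ρ := Metric.infDist x D with hρ
  have hρ1 : ρ ≤ δ + dist x x₀ := Metric.infDist_le_infDist_add_dist
  have hρ2 : δ ≤ ρ + dist x x₀ := by
    rw [dist_comm]; exact Metric.infDist_le_infDist_add_dist
  have hxD : x ∈ Dᶜ := fun h => by
    rw [hρ, Metric.infDist_zero_of_mem h] at hρ2
    linarith
  obtain ⟨y, hyD, hy⟩ := exists_mem_frontier_infDist_compl_eq_dist hxD
    (compl_ne_univ.2 hD)
  rw [compl_compl, ← hρ] at hy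
  rw [frontier_compl] at hyD
  have hyy := hproj x hxr y hyD hy.symm
  set e := δ⁻¹ • (y₀ - x₀) with he
  have hny : ‖y₀ - x₀‖ = δ := by rw [← dist_eq_norm, dist_comm, hy₀]
  have hne : ‖e‖ = 1 := by
    rw [he, norm_smul, hny, norm_inv, Real.norm_of_nonneg hx₀.le, inv_mul_cancel₀ hx₀.ne']
  have hin : inner ℝ (x - y) e ≤ -(δ / 2) := by
    have h1 : x - y = -(y₀ - x₀) + ((x - x₀) - (y - y₀)) := by abel
    have h2 : inner ℝ (y₀ - x₀) e = δ := by
      rw [he, real_inner_smul_right, real_inner_self_eq_norm_sq, hny]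
      field_simp
    have h3 : inner ℝ ((x - x₀) - (y - y₀)) e ≤ δ / 2 := by
      refine (real_inner_le_norm _ _).trans ?_
      rw [hne, mul_one]
      refine (norm_sub_le _ _).trans ?_
      rw [← dist_eq_norm, ← dist_eq_norm]
      linarith
    rw [h1, inner_add_left, inner_neg_left, h2]
    linarith
  have hle : Metric.infDist (x + t • e) D ≤ ‖(x - y) + t • e‖ := by
    rw [← Metric.infDist_closure]
    refine (Metric.infDist_le_dist_of_mem (frontier_subset_closure hyD)).trans_eq ?_
    rw [dist_eq_norm]
    congr 1
    abel
  have hsq : ‖(x - y) + t • e‖ ^ 2 ≤ (ρ - 1 / 8 * t) ^ 2 := by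
    rw [norm_add_sq_real, real_inner_smul_right, norm_smul, hne, ← dist_eq_norm, ← hy,
      Real.norm_of_nonneg ht.1]
    have ht0 := ht.1
    have ht1 := ht.2
    nlinarith [mul_nonneg ht0 (by linarith : 0 ≤ 2 * δ - ρ),
      mul_le_mul_of_nonneg_left hin ht0, mul_nonneg ht0 (sub_nonneg.2 ht1)]
  refine hle.trans (abs_le_of_sq_le_sq' hsq ?_).2
  linarith [ht.2]

/-- Near a boundary point at which an oriented distance function is `C¹`, moving in a suitable
fixed direction decreases it. -/
theorem exists_descent_of_contDiffOn {E : Type*} [NormedAddCommGroup E]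
    [NormedSpace ℝ E] [FiniteDimensional ℝ E] {D U : Set E} {d : E → ℝ}
    (hD : IsOpen D) (hd : ∀ x, d x = Metric.infDist x D - Metric.infDist x Dᶜ)
    (hU : IsOpen U) (hdU : ContDiffOn ℝ 1 d U) {x₀ : E} (hx₀ : x₀ ∈ frontier D) (hx₀U : x₀ ∈ U) :
    ∃ r > 0, ∃ e : E, ∃ τ > 0, ∃ c > 0, ∀ x ∈ Metric.ball x₀ r, ∀ t ∈ Icc 0 τ,
      d (x + t • e) ≤ d x - c * t := by
  have hcont : ContinuousAt (fderiv ℝ d) x₀ :=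
    (hdU.continuousOn_fderiv_of_isOpen hU le_rfl).continuousAt (hU.mem_nhds hx₀U)
  have hdiff : ∀ x ∈ U, DifferentiableAt ℝ d x := fun x hx =>
    (hdU.differentiableOn one_ne_zero).differentiableAt (hU.mem_nhds hx)
  have hx₀D : x₀ ∉ D := fun h => by
    rw [hD.frontier_eq] at hx₀
    exact hx₀.2 h
  have hne : fderiv ℝ d x₀ ≠ 0 := by
    intro h0
    have hev : ∀ᶠ x in 𝓝 x₀, ‖fderiv ℝ d x‖ < 1 / 2 := by
      have := hcont.norm
      refine this.eventually_lt_const ?_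
      simp [h0]
    obtain ⟨r, hr, hball⟩ := Metric.eventually_nhds_iff_ball.1 (hev.and (hU.mem_nhds hx₀U))
    obtain ⟨x, hxD, hx⟩ := Metric.mem_closure_iff.1 (frontier_subset_closure hx₀) (r / 2)
      (by positivity)
    obtain ⟨y, hyF, hy⟩ := exists_mem_frontier_infDist_compl_eq_dist hxD
      (ne_univ_iff_exists_notMem D |>.2 ⟨x₀, hx₀D⟩)
    have hxy : dist x y ≤ dist x x₀ := hy ▸ Metric.infDist_le_dist_of_mem hx₀D
    have hyD : y ∈ Dᶜ := by
      rw [hD.frontier_eq] at hyF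
      exact hyF.2
    have hyfr : Metric.infDist y D = 0 := by
      rw [← Metric.infDist_closure]
      exact Metric.infDist_zero_of_mem (frontier_subset_closure hyF)
    have h1 := (convex_ball x₀ r).norm_image_sub_le_of_norm_fderiv_le (𝕜 := ℝ) (f := d)
      (C := 1 / 2) (x := y) (y := x)
      (fun z hz => hdiff z (hball z hz).2) (fun z hz => (hball z hz).1.le)
      (by
        rw [Metric.mem_ball]
        rw [dist_comm] at hx
        have := dist_triangle_left y x₀ x
        linarith)
      (by rw [Metric.mem_ball, dist_comm]; linarith)
    rw [hd x, hd y, hyfr, Metric.infDist_zero_of_mem hxD, Metric.infDist_zero_of_mem hyD, hy,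
      ← dist_eq_norm x y] at h1
    have hpos : 0 < dist x y := dist_pos.2 fun h => hyD (h ▸ hxD)
    rw [Real.norm_eq_abs, sub_zero, sub_zero, zero_sub, abs_neg, abs_of_pos hpos] at h1
    linarith
  obtain ⟨v, hv⟩ : ∃ v, fderiv ℝ d x₀ v < 0 := by
    obtain ⟨v, hv⟩ := DFunLike.ne_iff.1 hne
    rcases lt_or_gt_of_ne hv with h | h
    · exact ⟨v, by simpa using h⟩
    · exact ⟨-v, by simpa using h⟩
  set c := -(fderiv ℝ d x₀ v) / 2 with hc
  have hc0 : 0 < c := by rw [hc]; linarith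
  have hev : ∀ᶠ x in 𝓝 x₀, fderiv ℝ d x v < -c := by
    have : ContinuousAt (fun x => fderiv ℝ d x v) x₀ := hcont.clm_apply continuousAt_const
    exact this.eventually_lt_const (by rw [hc]; linarith)
  obtain ⟨r, hr, hball⟩ := Metric.eventually_nhds_iff_ball.1 (hev.and (hU.mem_nhds hx₀U))
  refine ⟨r / 2, by positivity, v, r / (2 * (‖v‖ + 1)), by positivity, c, hc0,
    fun x hx t ht => ?_⟩
  have hmem : ∀ s ∈ Icc 0 t, x + s • v ∈ Metric.ball x₀ r := by
    intro s hs
    have h1 : s * ‖v‖ ≤ r / 2 := by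
      have : s * (2 * (‖v‖ + 1)) ≤ r := by
        rw [← le_div_iff₀ (by positivity)]; exact hs.2.trans ht.2
      nlinarith [hs.1]
    rw [Metric.mem_ball, dist_eq_norm] at hx ⊢
    calc ‖x + s • v - x₀‖ = ‖(x - x₀) + s • v‖ := by congr 1; abel
      _ ≤ ‖x - x₀‖ + ‖s • v‖ := norm_add_le _ _
      _ < r := by rw [norm_smul, Real.norm_of_nonneg hs.1]; linarith
  have hder : ∀ s ∈ Icc 0 t, HasDerivAt (fun s : ℝ => d (x + s • v) + c * s)
      (fderiv ℝ d (x + s • v) v + c) s := by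
    intro s hs
    have h1 : HasDerivAt (fun s : ℝ => x + s • v) v s := by
      simpa using ((hasDerivAt_id s).smul_const v).const_add x
    have h2 := (hdiff _ (hball _ (hmem s hs)).2).hasFDerivAt.comp_hasDerivAt s h1
    simpa using HasDerivAt.fun_add h2 ((hasDerivAt_id s).const_mul c)
  have hanti : AntitoneOn (fun s : ℝ => d (x + s • v) + c * s) (Icc 0 t) := by
    refine antitoneOn_of_deriv_nonpos (convex_Icc 0 t)
      (fun s hs => (hder s hs).continuousAt.continuousWithinAt)
      (fun s hs => (hder s (interior_subset hs)).differentiableAt.differentiableWithinAt)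
      fun s hs => ?_
    rw [(hder s (interior_subset hs)).deriv]
    linarith [(hball _ (hmem s (interior_subset hs))).1]
  have := hanti (left_mem_Icc.2 ht.1) (right_mem_Icc.2 ht.1) ht.1
  simp only [zero_smul, add_zero, mul_zero] at this
  linarith

/-- The mean value is, up to a factor `2`, the best approximating constant. -/
theorem eLpNorm_sub_average_le {α : Type*} {m : MeasurableSpace α} {μ : Measure α}
    [IsFiniteMeasure μ] {q : ℝ≥0∞} (hq : 1 ≤ q) {f : α → ℝ} (hf : MemLp f q μ)
    (c : ℝ) : eLpNorm (fun x => f x - ⨍ y, f y ∂μ) q μ ≤ 2 * eLpNorm (fun x => f x - c) q μ := by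
  rcases eq_or_ne μ 0 with rfl | hμ
  · simp
  have : NeZero μ := ⟨hμ⟩
  have hU0 : μ univ ≠ 0 := by simpa using hμ
  have hUt : μ univ ≠ ⊤ := measure_ne_top _ _
  have hfi : Integrable f μ := hf.integrable hq
  have hfc : AEStronglyMeasurable (fun x => f x - c) μ := hf.1.sub aestronglyMeasurable_const
  have havg : (⨍ y, f y ∂μ) - c = ⨍ y, (f y - c) ∂μ := by
    rw [average_eq, average_eq, integral_sub hfi (integrable_const c), integral_const, smul_sub,
      smul_smul, inv_mul_cancel₀ measureReal_univ_ne_zero, one_smul]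
  have hconst : eLpNorm (fun _ => (⨍ y, f y ∂μ) - c) q μ ≤ eLpNorm (fun x => f x - c) q μ := by
    rw [eLpNorm_const _ (one_pos.trans_le hq).ne' hμ, havg, average_eq, enorm_smul,
      ← ofReal_norm, norm_inv, Real.norm_of_nonneg measureReal_nonneg,
      ENNReal.ofReal_inv_of_pos measureReal_univ_pos]
    rw [measureReal_def, ENNReal.ofReal_toReal hUt]
    have h1 : ‖∫ y, (f y - c) ∂μ‖ₑ ≤ eLpNorm (fun x => f x - c) q μ *
        μ univ ^ (1 / (1 : ℝ≥0∞).toReal - 1 / q.toReal) := by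
      refine (enorm_integral_le_lintegral_enorm _).trans ?_
      rw [← eLpNorm_one_eq_lintegral_enorm]
      exact eLpNorm_le_eLpNorm_mul_rpow_measure_univ hq hfc
    calc (μ univ)⁻¹ * ‖∫ y, (f y - c) ∂μ‖ₑ * μ univ ^ (1 / q.toReal)
        ≤ (μ univ)⁻¹ * (eLpNorm (fun x => f x - c) q μ *
          μ univ ^ (1 / (1 : ℝ≥0∞).toReal - 1 / q.toReal)) * μ univ ^ (1 / q.toReal) := by
          gcongr
      _ = eLpNorm (fun x => f x - c) q μ * ((μ univ)⁻¹ *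
          (μ univ ^ (1 / (1 : ℝ≥0∞).toReal - 1 / q.toReal) * μ univ ^ (1 / q.toReal))) := by ring
      _ = eLpNorm (fun x => f x - c) q μ := by
          rw [← ENNReal.rpow_add _ _ hU0 hUt]
          simp [ENNReal.inv_mul_cancel hU0 hUt]
  calc eLpNorm (fun x => f x - ⨍ y, f y ∂μ) q μ
      = eLpNorm ((fun x => f x - c) - fun _ => (⨍ y, f y ∂μ) - c) q μ := by
        congr 1; ext x; simp
    _ ≤ eLpNorm (fun x => f x - c) q μ + eLpNorm (fun _ => (⨍ y, f y ∂μ) - c) q μ :=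
        eLpNorm_sub_le hfc aestronglyMeasurable_const hq
    _ ≤ _ := by rw [two_mul]; gcongr

theorem eLpNorm_withDensity_rpow {α : Type*} [MeasurableSpace α] {μ : Measure α} {p : ℝ}
    (hp : 1 ≤ p) {w : α → ℝ} (hw : Measurable w) {f : α → ℝ} (hf : Measurable f) :
    eLpNorm f (ENNReal.ofReal p) (μ.withDensity fun x => ENNReal.ofReal (w x)) =
      (∫⁻ x, ENNReal.ofReal (|f x| ^ p * w x) ∂μ) ^ (1 / p) := by
  have hp0 : 0 < p := by linarith
  rw [eLpNorm_eq_lintegral_rpow_enorm_toReal (by simpa using hp0) ofReal_ne_top,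
    ENNReal.toReal_ofReal hp0.le,
    lintegral_withDensity_eq_lintegral_mul _ hw.ennreal_ofReal (by fun_prop)]
  congr 1
  refine lintegral_congr fun x => ?_
  rw [ENNReal.ofReal_mul (by positivity), ← ENNReal.ofReal_rpow_of_nonneg (abs_nonneg _) hp0.le,
    ← Real.enorm_eq_ofReal_abs, Pi.mul_apply, mul_comm]

/-- The transition profile is monotone. -/
theorem monotone_of_profile {S : ℝ → ℝ} (hS : Continuous S)
    (hS_sign : ∀ t : ℝ, 1 ≤ |t| → S t = t / |t|) (hS_pos : ∀ t : ℝ, |t| < 1 → 0 < deriv S t) :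
    Monotone S := by
  have h1 : ∀ t, 1 ≤ t → S t = 1 := fun t ht => by
    have h0 : 0 < t := by linarith
    rw [hS_sign t (by rwa [abs_of_pos h0]), abs_of_pos h0, div_self h0.ne']
  have h2 : ∀ t, t ≤ -1 → S t = -1 := fun t ht => by
    have h0 : t < 0 := by linarith
    rw [hS_sign t (by rw [abs_of_neg h0]; linarith), abs_of_neg h0, div_neg, div_self h0.ne]
  have hmid : MonotoneOn S (Icc (-1) 1) := by
    refine (strictMonoOn_of_deriv_pos (convex_Icc _ _) hS.continuousOn fun t ht => ?_).monotoneOn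
    rw [interior_Icc] at ht
    exact hS_pos t (abs_lt.2 ht)
  have hlow : MonotoneOn S (Iic (-1)) := fun x hx y hy _ => by rw [h2 x hx, h2 y hy]
  have hup : MonotoneOn S (Ici 1) := fun x hx y hy _ => by rw [h1 x hx, h1 y hy]
  have hIic : MonotoneOn S (Iic 1) := by
    have := hlow.union_right hmid (c := -1) ⟨by simp, fun x hx => hx⟩
      ⟨by simp, fun x hx => hx.1⟩
    rwa [Iic_union_Icc_eq_Iic (by norm_num)] at this
  have := hIic.union_right hup (c := 1) ⟨by simp, fun x hx => hx⟩ ⟨by simp, fun x hx => hx⟩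
  rwa [Iic_union_Ici, monotoneOn_univ] at this

/-- Sublevel sets of the oriented distance function of a bounded set are bounded. -/
theorem isBounded_sublevel {E : Type*} [PseudoMetricSpace E] [ProperSpace E] {D : Set E}
    {d : E → ℝ} (hDb : Bornology.IsBounded D) (hDn : D.Nonempty)
    (hd : ∀ x, d x = Metric.infDist x D - Metric.infDist x Dᶜ) (T : ℝ) :
    Bornology.IsBounded {x | d x ≤ T} := by
  obtain ⟨a, ha⟩ := hDn
  obtain ⟨R, hR⟩ := hDb.subset_ball a
  refine Metric.isBounded_closedBall (x := a) (r := |T| + R) |>.subset fun x hx => ?_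
  simp only [mem_ofPred_eq] at hx
  rw [Metric.mem_closedBall]
  have hR0 : 0 < R := by simpa using hR ha
  by_cases hxD : x ∈ D
  · have := hR hxD
    rw [Metric.mem_ball] at this
    linarith [abs_nonneg T]
  · rw [hd, Metric.infDist_zero_of_mem (s := Dᶜ) hxD, sub_zero] at hx
    obtain ⟨y, hy, hxy⟩ := Metric.exists_mem_closure_infDist_eq_dist ⟨a, ha⟩ x
    have h1 := Metric.closure_ball_subset_closedBall (closure_mono hR hy)
    rw [Metric.mem_closedBall] at h1
    linarith [dist_triangle x y a, le_abs_self T]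

/-- Weighted Poincaré inequality on a sublevel set of the oriented distance function, uniform in
all weights which decrease with the oriented distance and lie between `1 / 2` and `1` inside. -/
theorem exists_const_lintegral_sublevel_le {E : Type*} [NormedAddCommGroup E]
    [InnerProductSpace ℝ E] [FiniteDimensional ℝ E] [MeasurableSpace E] [BorelSpace E]
    {μ : Measure E} [μ.IsAddHaarMeasure] {p : ℝ} (hp : 1 ≤ p) {D U : Set E} {d : E → ℝ} {T : ℝ}
    (hD : IsOpen D) (hDb : Bornology.IsBounded D) (hDc : IsConnected D)
    (hd : ∀ x, d x = Metric.infDist x D - Metric.infDist x Dᶜ)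
    (hU : IsOpen U) (hDU : frontier D ⊆ U) (hdU : ContDiffOn ℝ 1 d U)
    (hproj : ∀ x, 0 < d x → d x ≤ T →
      ∃! y, y ∈ frontier D ∧ dist x y = Metric.infDist x (frontier D)) :
    ∃ C : ℝ≥0∞, C ≠ ⊤ ∧ ∀ w : E → ℝ≥0∞, Measurable w → (∀ x y, d y ≤ d x → w x ≤ w y) →
      (∀ x, w x ≤ 1) → (∀ x ∈ D, 1 ≤ 2 * w x) → ∀ u : E → ℝ, Measurable u →
      (∀ x, w x ≠ 0 → DifferentiableAt ℝ u x) → ∃ c : ℝ,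
      ∫⁻ x in {x | d x ≤ T}, ‖u x - c‖ₑ ^ p * w x ∂μ ≤
        C * ∫⁻ x, ‖fderiv ℝ u x‖ₑ ^ p * w x ∂μ := by
  set 𝒲 : Set (E → ℝ≥0∞) := {w | Measurable w ∧ (∀ x y, d y ≤ d x → w x ≤ w y) ∧
    (∀ x, w x ≤ 1) ∧ ∀ x ∈ D, 1 ≤ 2 * w x}
  have hmeas : ∀ w ∈ 𝒲, Measurable w := fun w hw => hw.1
  have hcomp : ∀ w ∈ 𝒲, ∀ x ∈ D, ∀ y ∈ D, w x ≤ 2 * w y := fun w hw x _ y hy =>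
    (hw.2.2.1 x).trans (hw.2.2.2 y hy)
  have hdc : Continuous d := by
    rw [funext hd]
    exact (Metric.continuous_infDist_pt D).sub (Metric.continuous_infDist_pt Dᶜ)
  have hdout : ∀ x ∉ D, d x = Metric.infDist x D := fun x hx => by
    rw [hd, Metric.infDist_zero_of_mem (s := Dᶜ) hx, sub_zero]
  have hcompact : IsCompact {x | d x ≤ T} :=
    Metric.isCompact_of_isClosed_isBounded (isClosed_le hdc continuous_const)
      (isBounded_sublevel hDb hDc.nonempty hd T)
  obtain ⟨a, ha⟩ := hDc.nonempty
  obtain ⟨s, hs, hsD⟩ := Metric.isOpen_iff.1 hD a ha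
  have hr : 0 < s / 3 := by positivity
  have hdesc : ∀ x, d x ≤ T → (∃ r > 0, ∃ e : E, ∃ τ > 0, ∃ c > 0, ∀ y ∈ Metric.ball x r,
      ∀ t ∈ Icc 0 τ, d (y + t • e) ≤ d y - c * t) →
      ∃ r > 0, ControlledBy μ p 𝒲 (Metric.ball a (s / 3)) (Metric.ball x r) ∨
      ∃ v : E, ∃ c > 0, ∀ y ∈ Metric.ball x r, d (y + v) ≤ d y - c ∧
        ∀ t ∈ Icc (0 : ℝ) 1, d (y + t • v) ≤ d y := by
    rintro x - ⟨r, hr, e, τ, hτ, c, hc, h⟩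
    refine ⟨r, hr, Or.inr ⟨τ • e, c * τ, by positivity, fun y hy =>
      ⟨h y hy τ (right_mem_Icc.2 hτ.le), fun t ht => ?_⟩⟩⟩
    rw [smul_smul]
    have ht0 : 0 ≤ t * τ := mul_nonneg ht.1 hτ.le
    refine (h y hy (t * τ) ⟨ht0, ?_⟩).trans ?_
    · nlinarith [ht.2]
    · nlinarith
  have hctrl : ControlledBy μ p 𝒲 (Metric.ball a (s / 3)) {x | d x ≤ T} := by
    refine controlledBy_of_descent hp hmeas hdc (fun w hw => hw.2.1) hcompact fun x hxT => ?_
    by_cases hxD : x ∈ D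
    · obtain ⟨ρ, hρ, h⟩ := controlledBy_of_isPreconnected (μ := μ) hp hmeas hD
        hDc.isPreconnected hcomp hr ha hxD
      exact ⟨ρ, hρ, Or.inl h⟩
    refine hdesc x hxT ?_
    have hxd := hdout x hxD
    by_cases hxc : x ∈ closure D
    · have hxF : x ∈ frontier D := by
        rw [hD.frontier_eq]
        exact ⟨hxc, hxD⟩
      exact exists_descent_of_contDiffOn hD hd hU hdU hxF (hDU hxF)
    have hpos : 0 < Metric.infDist x D :=
      (Metric.infDist_pos_iff_notMem_closure hDc.nonempty).1 hxc
    obtain ⟨y₁, hy₁, hxy₁⟩ := exists_mem_frontier_infDist_compl_eq_dist (s := Dᶜ) hxD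
      (compl_ne_univ.2 hDc.nonempty)
    rw [compl_compl] at hxy₁
    rw [frontier_compl] at hy₁
    have hfr : Metric.infDist x (frontier D) = Metric.infDist x D := by
      refine le_antisymm (hxy₁ ▸ Metric.infDist_le_dist_of_mem hy₁) ?_
      rw [← Metric.infDist_closure (s := D)]
      exact Metric.infDist_le_infDist_of_subset frontier_subset_closure ⟨y₁, hy₁⟩
    obtain ⟨y₀, ⟨-, hy₀⟩, huniq⟩ := hproj x (hxd ▸ hpos) hxT
    rw [hfr] at hy₀
    obtain ⟨r, hr, e, τ, hτ, c, hc, h⟩ := exists_descent_of_unique_nearest hDc.nonempty hpos hy₀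
      fun y hy hxy => huniq y ⟨hy, by rw [hfr, hxy]⟩
    refine ⟨r, hr, e, τ, hτ, c, hc, fun y hy t ht => ?_⟩
    have hyD : y ∉ D := fun hyD => by
      have h1 := h y hy τ (right_mem_Icc.2 hτ.le)
      rw [Metric.infDist_zero_of_mem hyD] at h1
      nlinarith [Metric.infDist_nonneg (x := y + τ • e) (s := D), mul_pos hc hτ]
    rw [hdout y hyD]
    refine le_trans ?_ (h y hy t ht)
    rw [hd]
    linarith [Metric.infDist_nonneg (x := y + t • e) (s := Dᶜ)]
  obtain ⟨C, hC, hctrl⟩ := hctrl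
  obtain ⟨C', hC', hball⟩ := exists_const_lintegral_ball_le (μ := μ) hp hmeas hr
    (fun w hw x hx y hy => hcomp w hw x
      (hsD (Metric.ball_subset_ball (by linarith) hx)) y
      (hsD (by rwa [mul_div_cancel₀ _ (by norm_num : (3 : ℝ) ≠ 0)] at hy)))
  refine ⟨C * (C' + 1), mul_ne_top hC (by simp [hC']), fun w h1 h2 h3 h4 u hu hdu => ?_⟩
  have hw : w ∈ 𝒲 := ⟨h1, h2, h3, h4⟩
  obtain ⟨c, hc⟩ := hball w hw u hu hdu
  refine ⟨c, (hctrl w hw u hu hdu c).trans ?_⟩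
  rw [mul_assoc, add_mul, one_mul]
  gcongr

/-- Weighted Poincaré inequality with weighted mean value, constant independent of `ε`. -/
theorem weighted_poincare_mean_value
    (n : ℕ) (hn : 2 ≤ n)
    (D : Set (EuclideanSpace ℝ (Fin n)))
    (hD_open : IsOpen D) (hD_bdd : Bornology.IsBounded D) (hD_ne : D.Nonempty)
    (dD : EuclideanSpace ℝ (Fin n) → ℝ)
    (hdD : ∀ x, dD x = Metric.infDist x D - Metric.infDist x Dᶜ)
    (Dt : ℝ → Set (EuclideanSpace ℝ (Fin n)))
    (hDt : ∀ t, Dt t = {x | dD x < t})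
    (Γ : ℝ → Set (EuclideanSpace ℝ (Fin n)))
    (hΓ : ∀ ε : ℝ, Γ ε = Dt ε \ closure (Dt (-ε)))
    (ε₀ : ℝ) (hε₀ : 0 < ε₀)
    (hproj : ∀ z ∈ Γ (2 * ε₀), ∃! y, y ∈ frontier D ∧ dist z y = Metric.infDist z (frontier D))
    (hC11 : ∃ U : Set (EuclideanSpace ℝ (Fin n)), IsOpen U ∧ frontier D ⊆ U ∧
      ContDiffOn ℝ 1 dD U ∧ ∃ L : NNReal, LipschitzOnWith L (fun x => fderiv ℝ dD x) U)
    (S : ℝ → ℝ) (ζ₁ ζ₂ α : ℝ) (hζ₁ : 0 < ζ₁) (hζ₂ : 0 < ζ₂) (hα : 0 < α)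
    (hS_lip : ∃ L : NNReal, LipschitzWith L S)
    (hS_sign : ∀ t : ℝ, 1 ≤ |t| → S t = t / |t|)
    (hS_pos : ∀ t : ℝ, |t| < 1 → 0 < deriv S t)
    (hS_odd : ∀ t : ℝ, S (-t) = -S t)
    (hS2 : ∀ t ∈ Set.Ioo (0:ℝ) 2,
      ζ₁ * t ^ α ≤ (1 + S (t - 1)) / 2 ∧ (1 + S (t - 1)) / 2 ≤ ζ₂ * t ^ α)
    (ω : ℝ → EuclideanSpace ℝ (Fin n) → ℝ)
    (hω : ∀ ε : ℝ, 0 < ε → ∀ x, ω ε x = (1 + S (-(dD x) / ε)) / 2)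
    (hω0 : ∀ x, ω 0 x = D.indicator (fun _ => (1:ℝ)) x)
    (p : ℝ) (hp : 1 ≤ p)
    (hconn : ∀ ε ∈ Set.Icc (0:ℝ) ε₀, IsConnected (Dt ε)) :
    ∃ C : ℝ, 0 < C ∧ ∀ ε ∈ Set.Icc (0:ℝ) ε₀,
      ∀ u : EuclideanSpace ℝ (Fin n) → ℝ, Measurable u →
        (∀ x ∈ Dt ε, DifferentiableAt ℝ u x) →
        (∫⁻ x in Dt ε,
          ENNReal.ofReal ((|u x| ^ p + ‖fderiv ℝ u x‖ ^ p) * ω ε x)) < ⊤ →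
        (∫⁻ x in Dt ε,
            ENNReal.ofReal (|u x -
              (∫ y in Dt ε, u y * ω ε y) / (∫ y in Dt ε, ω ε y)| ^ p * ω ε x)) ^ (1 / p) ≤
          ENNReal.ofReal C *
            (∫⁻ x in Dt ε, ENNReal.ofReal (‖fderiv ℝ u x‖ ^ p * ω ε x)) ^ (1 / p) := by
  obtain ⟨U, hU, hDU, hdU, -⟩ := hC11
  obtain ⟨LS, hLS⟩ := hS_lip
  have hSmono : Monotone S := monotone_of_profile hLS.continuous hS_sign hS_pos
  have hS0 : S 0 = 0 := by have := hS_odd 0; rw [neg_zero] at this; linarith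
  have hS_one : ∀ t, 1 ≤ t → S t = 1 := fun t ht => by
    have h0 : 0 < t := by linarith
    rw [hS_sign t (by rwa [abs_of_pos h0]), abs_of_pos h0, div_self h0.ne']
  have hS_le : ∀ t, S t ≤ 1 := fun t =>
    (hSmono (le_max_left t 1)).trans_eq (hS_one _ (le_max_right t 1))
  have hS_ge : ∀ t, -1 ≤ S t := fun t => by
    have := hS_le (-t)
    rw [hS_odd] at this
    linarith
  have hdc : Continuous dD := by
    rw [funext hdD]
    exact (Metric.continuous_infDist_pt D).sub (Metric.continuous_infDist_pt Dᶜ)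
  have hmemDt : ∀ t x, x ∈ Dt t ↔ dD x < t := fun t x => by rw [hDt]; rfl
  have hconn0 := hconn 0 ⟨le_rfl, hε₀.le⟩
  have hDne : D ≠ univ := by
    rintro rfl
    obtain ⟨x, hx⟩ := hconn0.nonempty
    rw [hmemDt, hdD, compl_univ, Metric.infDist_empty] at hx
    linarith [Metric.infDist_nonneg (x := x) (s := (univ : Set (EuclideanSpace ℝ (Fin n))))]
  have hmemD : ∀ x, x ∈ D ↔ dD x < 0 := by
    intro x
    rw [hdD]
    constructor
    · intro hx
      have := (hD_open.isClosed_compl.notMem_iff_infDist_pos (nonempty_compl.2 hDne)).1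
        (not_not_intro hx)
      rw [Metric.infDist_zero_of_mem hx]
      linarith
    · intro hx
      by_contra hxD
      rw [Metric.infDist_zero_of_mem (s := Dᶜ) hxD] at hx
      linarith [Metric.infDist_nonneg (x := x) (s := D)]
  have hDt0 : Dt 0 = D := by ext x; rw [hmemDt, hmemD]
  have hproj' : ∀ x, 0 < dD x → dD x ≤ ε₀ →
      ∃! y, y ∈ frontier D ∧ dist x y = Metric.infDist x (frontier D) := by
    intro x hx hxε
    refine hproj x ?_
    rw [hΓ]
    refine ⟨(hmemDt _ _).2 (by linarith), fun hxc => ?_⟩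
    have hsub : closure (Dt (-(2 * ε₀))) ⊆ {x | dD x ≤ -(2 * ε₀)} :=
      closure_minimal (fun y hy => ((hmemDt _ _).1 hy).le) (isClosed_le hdc continuous_const)
    have := hsub hxc
    simp only [mem_ofPred_eq] at this
    linarith
  obtain ⟨C, hC, hmain⟩ := exists_const_lintegral_sublevel_le (μ := volume) hp hD_open hD_bdd
    (hDt0 ▸ hconn0) hdD hU hDU hdU hproj'
  have hp0 : 0 < p := by linarith
  have hC' : 2 * C ^ (1 / p) ≠ ⊤ :=
    mul_ne_top (by simp) (ENNReal.rpow_ne_top_of_nonneg (by positivity) hC)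
  refine ⟨(2 * C ^ (1 / p)).toReal + 1, by positivity, fun ε hε u hu hdu hfin => ?_⟩
  have hωprop : Measurable (ω ε) ∧ (∀ x y, dD y ≤ dD x → ω ε x ≤ ω ε y) ∧ (∀ x, 0 ≤ ω ε x) ∧
      (∀ x, ω ε x ≤ 1) ∧ (∀ x ∈ D, 1 / 2 ≤ ω ε x) ∧ ∀ x, ε ≤ dD x → ω ε x = 0 := by
    rcases hε.1.eq_or_lt with rfl | hpos
    · rw [funext hω0]
      refine ⟨measurable_const.indicator hD_open.measurableSet, fun x y hxy => ?_,
        fun x => indicator_nonneg (fun _ _ => zero_le_one) x,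
        fun x => indicator_le_self' (fun _ _ => zero_le_one) x, fun x hx => ?_, fun x hx => ?_⟩
      · by_cases hx : x ∈ D
        · rw [indicator_of_mem hx, indicator_of_mem]
          rw [hmemD] at hx ⊢
          linarith
        · rw [indicator_of_notMem hx]
          exact indicator_nonneg (fun _ _ => zero_le_one) y
      · rw [indicator_of_mem hx]; norm_num
      · exact indicator_of_notMem (fun h => by rw [hmemD] at h; linarith) _
    · have hω' := hω ε hpos
      refine ⟨?_, fun x y hxy => ?_, fun x => ?_, fun x => ?_, fun x hx => ?_, fun x hx => ?_⟩
      · rw [funext hω']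
        exact ((continuous_const.add (hLS.continuous.comp
          (hdc.neg.div_const ε))).div_const 2).measurable
      · rw [hω', hω']
        have : S (-(dD x) / ε) ≤ S (-(dD y) / ε) := hSmono (by gcongr)
        linarith
      · rw [hω']; linarith [hS_ge (-(dD x) / ε)]
      · rw [hω']; linarith [hS_le (-(dD x) / ε)]
      · rw [hω']
        have : S 0 ≤ S (-(dD x) / ε) :=
          hSmono (div_nonneg (by linarith [(hmemD x).1 hx]) hpos.le)
        linarith
      · rw [hω', neg_div, hS_odd, hS_one _ ((one_le_div hpos).2 hx)]
        norm_num
  obtain ⟨hωm, hωanti, hω_nonneg, hω_le, hω_ge, hω_zero⟩ := hωprop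
  have hDtm : MeasurableSet (Dt ε) := by
    rw [hDt]
    exact measurableSet_lt hdc.measurable measurable_const
  have hDtsub : Dt ε ⊆ {x | dD x ≤ ε₀} := fun x hx => ((hmemDt _ _).1 hx).le.trans hε.2
  obtain ⟨c, hc⟩ := hmain (fun x => ENNReal.ofReal (ω ε x)) hωm.ennreal_ofReal
    (fun x y hxy => ENNReal.ofReal_le_ofReal (hωanti x y hxy))
    (fun x => ENNReal.ofReal_le_one.2 (hω_le x))
    (fun x hx => by
      rw [← ENNReal.ofReal_ofNat, ← ENNReal.ofReal_mul (by norm_num), ENNReal.one_le_ofReal]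
      linarith [hω_ge x hx]) u hu
    (fun x hx => hdu x ((hmemDt _ _).2 (by
      by_contra hcon
      exact hx (by simp [hω_zero x (not_lt.1 hcon)]))))
  have hgrad : ∫⁻ x, ‖fderiv ℝ u x‖ₑ ^ p * ENNReal.ofReal (ω ε x) =
      ∫⁻ x in Dt ε, ENNReal.ofReal (‖fderiv ℝ u x‖ ^ p * ω ε x) := by
    rw [← lintegral_indicator hDtm]
    refine lintegral_congr fun x => ?_
    by_cases hx : x ∈ Dt ε
    · rw [indicator_of_mem hx, ENNReal.ofReal_mul (by positivity),
        ← ENNReal.ofReal_rpow_of_nonneg (norm_nonneg _) hp0.le, ofReal_norm]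
    · rw [indicator_of_notMem hx, hω_zero x (not_lt.1 fun h => hx ((hmemDt _ _).2 h))]
      simp
  have hvol : volume (Dt ε) ≠ ⊤ := by
    exact ((isBounded_sublevel hD_bdd hD_ne hdD ε₀).subset hDtsub).measure_lt_top.ne
  set μ := (volume.restrict (Dt ε)).withDensity fun x => ENNReal.ofReal (ω ε x) with hμ
  have hμfin : IsFiniteMeasure μ := by
    refine isFiniteMeasure_withDensity (ne_of_lt ?_)
    refine (lintegral_mono fun x => ENNReal.ofReal_le_one.2 (hω_le x)).trans_lt ?_
    rw [lintegral_one, Measure.restrict_apply_univ]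
    exact lt_top_iff_ne_top.2 hvol
  have hq : 1 ≤ ENNReal.ofReal p := by simpa using hp
  have hmem : MemLp u (ENNReal.ofReal p) μ := by
    refine ⟨hu.aestronglyMeasurable, ?_⟩
    rw [eLpNorm_withDensity_rpow hp hωm hu]
    refine ENNReal.rpow_lt_top_of_nonneg (by positivity) (ne_of_lt (lt_of_le_of_lt ?_ hfin))
    refine lintegral_mono fun x => ENNReal.ofReal_le_ofReal ?_
    have := hω_nonneg x
    gcongr
    exact le_add_of_nonneg_right (by positivity)
  have havg : ⨍ x, u x ∂μ = (∫ y in Dt ε, u y * ω ε y) / (∫ y in Dt ε, ω ε y) := by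
    have h1 : ∀ f : EuclideanSpace ℝ (Fin n) → ℝ, ∫ x, f x ∂μ = ∫ x in Dt ε, f x * ω ε x := by
      intro f
      rw [hμ, integral_withDensity_eq_integral_toReal_smul hωm.ennreal_ofReal (by simp)]
      refine integral_congr_ae (ae_of_all _ fun x => ?_)
      simp only [ENNReal.toReal_ofReal (hω_nonneg x), smul_eq_mul]
      ring
    have h2 : μ.real univ = ∫ y in Dt ε, ω ε y := by
      have := h1 fun _ => 1
      simpa using this
    rw [average_eq, h1, h2, smul_eq_mul, div_eq_inv_mul]
  have hfinal := eLpNorm_sub_average_le hq hmem c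
  rw [havg, hμ, eLpNorm_withDensity_rpow hp hωm (hu.sub_const _),
    eLpNorm_withDensity_rpow hp hωm (hu.sub_const _)] at hfinal
  refine hfinal.trans ?_
  have hcbound : ∫⁻ x in Dt ε, ENNReal.ofReal (|u x - c| ^ p * ω ε x) ≤
      C * ∫⁻ x in Dt ε, ENNReal.ofReal (‖fderiv ℝ u x‖ ^ p * ω ε x) := by
    rw [← hgrad]
    refine le_trans ?_ hc
    refine (lintegral_mono_set hDtsub).trans_eq (lintegral_congr fun x => ?_)
    rw [ENNReal.ofReal_mul (by positivity), ← ENNReal.ofReal_rpow_of_nonneg (abs_nonneg _) hp0.le,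
      Real.enorm_eq_ofReal_abs]
  calc _ ≤ 2 * (C * ∫⁻ x in Dt ε, ENNReal.ofReal (‖fderiv ℝ u x‖ ^ p * ω ε x)) ^ (1 / p) := by
        gcongr
    _ = 2 * C ^ (1 / p) *
        (∫⁻ x in Dt ε, ENNReal.ofReal (‖fderiv ℝ u x‖ ^ p * ω ε x)) ^ (1 / p) := by
        rw [ENNReal.mul_rpow_of_nonneg _ _ (by positivity), mul_assoc]
    _ ≤ _ := by
        gcongr
        rw [ENNReal.ofReal_add toReal_nonneg zero_le_one, ENNReal.ofReal_toReal hC']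
        exact le_self_add
end
end

section
/- Let 1 ≤ p < ∞ and assume D_ε is connected for each ε ∈ [0, ε₀]. Then there exists a constant C_P independent of ε such that for every ε ∈ (0, ε₀) and every v ∈ W^{1,p}(D_ε; ω^ε), the Poincaré–Friedrichs-type inequality ‖v‖_{L^p(D_ε;ω^ε)}^p ≤ C_P ( ‖∇v‖_{L^p(D_ε;ω^ε)}^p + ∫_{D_ε} |v|^p |∇ω^ε| dx ) holds. -/
open MeasureTheory ENNReal Set Filter Topology
open scoped RealInnerProductSpace

noncomputable section

/-- For `1 ≤ p` there is a differentiable function with absolute value `|x| ^ p`. -/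
lemma exists_hasDerivAt_abs_eq_rpow {p : ℝ} (hp : 1 ≤ p) :
    ∃ φ φ' : ℝ → ℝ, (∀ x, HasDerivAt φ (φ' x) x) ∧ (∀ x, |φ x| = |x| ^ p) ∧
      ∀ x, |φ' x| = p * |x| ^ (p - 1) := by
  rcases hp.eq_or_lt with rfl | hp
  · exact ⟨id, fun _ => 1, fun x => hasDerivAt_id x, by simp, by simp⟩
  · refine ⟨fun x => |x| ^ p, fun x => p * |x| ^ (p - 2) * x,
      fun x => hasDerivAt_abs_rpow x hp, fun x => abs_of_nonneg (by positivity), fun x => ?_⟩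
    rw [abs_mul, abs_of_nonneg (by positivity : 0 ≤ p * |x| ^ (p - 2)), mul_assoc]
    congr 1
    rcases eq_or_ne x 0 with rfl | hx
    · simp [Real.zero_rpow (by linarith : p - 1 ≠ 0)]
    · rw [← Real.rpow_add_one (abs_ne_zero.2 hx)]
      ring_nf

/-- A form of Young's inequality with a small factor in front of `a ^ p`. -/
lemma mul_rpow_sub_one_mul_le {p M a b : ℝ} (hp : 1 ≤ p) (hM : 0 < M) (ha : 0 ≤ a) (hb : 0 ≤ b) :
    M * (p * a ^ (p - 1) * b) ≤ a ^ p / 2 + M * p * (2 * M * p) ^ (p - 1) * b ^ p := by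
  have hp0 : 0 < p := by linarith
  have key : ∀ c : ℝ, 0 ≤ c → c ^ (p - 1) * c = c ^ p := fun c hc => by
    rcases hc.eq_or_lt with rfl | hc
    · simp [Real.zero_rpow hp0.ne']
    · rw [← Real.rpow_add_one hc.ne']; ring_nf
  have h1 : 0 ≤ a ^ (p - 1) := by positivity
  rcases le_total (2 * M * p * b) a with h | h
  · have h2 : 0 ≤ M * p * (2 * M * p) ^ (p - 1) * b ^ p := by positivity
    have h3 := mul_le_mul_of_nonneg_left h h1
    rw [key a ha] at h3
    linarith
  · have h2 : a ^ (p - 1) ≤ (2 * M * p) ^ (p - 1) * b ^ (p - 1) := by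
      rw [← Real.mul_rpow (by positivity) hb]
      exact Real.rpow_le_rpow ha h (by linarith)
    have h3 : 0 ≤ a ^ p := by positivity
    calc M * (p * a ^ (p - 1) * b)
        ≤ M * (p * ((2 * M * p) ^ (p - 1) * b ^ (p - 1)) * b) := by gcongr
      _ = M * p * (2 * M * p) ^ (p - 1) * (b ^ (p - 1) * b) := by ring
      _ ≤ _ := by rw [key b hb]; linarith

/-- If a continuous function rises from below a level `c` to above it, it stays above `c` after
a last crossing. -/
lemma exists_last_crossing {w : ℝ → ℝ} (hw : Continuous w) {a b c : ℝ} (hab : a ≤ b)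
    (ha : w a ≤ c) (hb : c < w b) :
    ∃ s ∈ Ico a b, w s = c ∧ ∀ t ∈ Icc s b, c ≤ w t := by
  set A : Set ℝ := Icc a b ∩ w ⁻¹' Iic c
  have hA : IsCompact A := isCompact_Icc.inter_right (isClosed_Iic.preimage hw)
  obtain ⟨s, hs⟩ := hA.exists_isGreatest ⟨a, ⟨le_rfl, hab⟩, ha⟩
  have hsb : s < b := lt_of_le_of_ne hs.1.1.2 fun h => by
    have : w s ≤ c := hs.1.2
    rw [h] at this
    exact hb.not_ge this
  have hgt : ∀ t ∈ Ioc s b, c < w t := fun t ht => by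
    by_contra! h
    exact ht.1.not_ge (hs.2 ⟨⟨hs.1.1.1.trans ht.1.le, ht.2⟩, h⟩)
  have hle : c ≤ w s := by
    refine ge_of_tendsto (hw.continuousWithinAt (s := Ioi s) (x := s)) ?_
    filter_upwards [Ioc_mem_nhdsGT hsb] with t ht using (hgt t ht).le
  have heq : w s = c := le_antisymm hs.1.2 hle
  refine ⟨s, ⟨hs.1.1.1, hsb⟩, heq, fun t ht => ?_⟩
  rcases ht.1.eq_or_lt with rfl | h
  · exact hle
  · exact (hgt t ⟨h, ht.2⟩).le

lemma AbsolutelyContinuousOnInterval.congr_of_eqOn {f g : ℝ → ℝ} {a b : ℝ}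
    (hf : AbsolutelyContinuousOnInterval f a b) (h : EqOn f g (uIcc a b)) :
    AbsolutelyContinuousOnInterval g a b := by
  rw [absolutelyContinuousOnInterval_iff] at hf ⊢
  intro ε hε
  obtain ⟨δ, hδ, H⟩ := hf ε hε
  refine ⟨δ, hδ, fun J hJ hlen => ?_⟩
  rw [Finset.sum_congr rfl fun i hi => by rw [← h (hJ.1 i hi).1, ← h (hJ.1 i hi).2]]
  exact H J hJ hlen

/-- Fundamental theorem of calculus estimate for the product of a differentiable function and a
truncated Lipschitz weight, above a level `c` of the weight. -/
lemma ofReal_abs_mul_le_lintegral_of_level {U U' w : ℝ → ℝ} {K : NNReal} {s b δ c : ℝ}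
    (hw : LipschitzWith K w) (hsb : s ≤ b) (hδ : δ < c) (hs : w s = c)
    (hc : ∀ t ∈ Icc s b, c ≤ w t) (hU : ∀ t ∈ Icc s b, HasDerivAt U (U' t) t) :
    ENNReal.ofReal (|U b| * (w b - c)) ≤
      ∫⁻ t in Ioc s b, ENNReal.ofReal (|U' t| * (w t - δ) + |U t| * |deriv w t|) := by
  set J : ℝ → ℝ := fun t => |U' t| * (w t - δ) + |U t| * |deriv w t|
  rcases eq_or_ne (∫⁻ t in Ioc s b, ENNReal.ofReal (J t)) ∞ with h | hfin
  · rw [h]; exact le_top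
  have hderiv : ∀ t ∈ Icc s b, deriv U t = U' t := fun t ht => (hU t ht).deriv
  have hUint : IntervalIntegrable (deriv U) volume s b := by
    rw [intervalIntegrable_iff_integrableOn_Ioc_of_le hsb]
    refine ⟨(measurable_deriv U).aestronglyMeasurable, ?_⟩
    have h1 : ∫⁻ t in Ioc s b, ‖deriv U t‖ₑ ≤
        ∫⁻ t in Ioc s b, ENNReal.ofReal (c - δ)⁻¹ * ENNReal.ofReal (J t) := by
      refine setLIntegral_mono' measurableSet_Ioc fun t ht => ?_
      have ht' : t ∈ Icc s b := ⟨ht.1.le, ht.2⟩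
      rw [hderiv t ht', Real.enorm_eq_ofReal_abs, ← ENNReal.ofReal_mul (by
        rw [inv_nonneg]; linarith)]
      refine ENNReal.ofReal_le_ofReal ?_
      rw [← div_eq_inv_mul, le_div_iff₀ (by linarith)]
      have h2 := hc t ht'
      have h3 : |U' t| * (c - δ) ≤ |U' t| * (w t - δ) := by gcongr
      have h4 : 0 ≤ |U t| * |deriv w t| := by positivity
      simp only [J]; linarith
    rw [lintegral_const_mul' _ _ ENNReal.ofReal_ne_top] at h1
    exact h1.trans_lt (ENNReal.mul_lt_top ENNReal.ofReal_lt_top hfin.lt_top)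
  have hUac : AbsolutelyContinuousOnInterval U s b := by
    have h1 := hUint.absolutelyContinuousOnInterval_intervalIntegral (c := s) left_mem_uIcc
    have h2 : AbsolutelyContinuousOnInterval (fun _ : ℝ => U s) s b :=
      ((LipschitzWith.const (U s)).lipschitzOnWith (s := uIcc s b)).absolutelyContinuousOnInterval
    refine (h2.fun_add h1).congr_of_eqOn fun t ht => ?_
    change U s + ∫ y in s..t, deriv U y = U t
    have hst : uIcc s t ⊆ Icc s b := (uIcc_of_le hsb) ▸ uIcc_subset_uIcc left_mem_uIcc ht
    rw [intervalIntegral.integral_eq_sub_of_hasDerivAt (f := U)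
      (fun x hx => hderiv x (hst hx) ▸ hU x (hst hx))
      (hUint.mono_set (uIcc_subset_uIcc left_mem_uIcc ht))]
    ring
  have hwac : AbsolutelyContinuousOnInterval (fun t => w t - c) s b := by
    have : LipschitzWith K (fun t => w t - c) := by
      simpa [LipschitzWith, edist_sub_right] using hw
    exact (this.lipschitzOnWith (s := uIcc s b)).absolutelyContinuousOnInterval
  have hFTC := hUac.integral_deriv_mul_eq_sub hwac
  simp only [hs, sub_self, mul_zero, sub_zero, deriv_sub_const_fun] at hFTC
  have hnn : |U b| * (w b - c) = |U b * (w b - c)| := by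
    rw [abs_mul, abs_of_nonneg (sub_nonneg.2 (hc b ⟨hsb, le_rfl⟩))]
  rw [hnn, ← hFTC, intervalIntegral.integral_of_le hsb, ← Real.enorm_eq_ofReal_abs]
  refine (enorm_integral_le_lintegral_enorm _).trans
    (setLIntegral_mono' measurableSet_Ioc fun t ht => ?_)
  have ht' : t ∈ Icc s b := ⟨ht.1.le, ht.2⟩
  rw [hderiv t ht', Real.enorm_eq_ofReal_abs]
  refine ENNReal.ofReal_le_ofReal ((abs_add_le _ _).trans ?_)
  rw [abs_mul, abs_mul, abs_of_nonneg (sub_nonneg.2 (hc t ht'))]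
  gcongr

lemma ofReal_abs_mul_le_lintegral {U U' w : ℝ → ℝ} {K : NNReal} {a b δ : ℝ}
    (hw : LipschitzWith K w) (hab : a ≤ b) (ha : w a ≤ δ)
    (hU : ∀ t ∈ Icc a b, δ < w t → HasDerivAt U (U' t) t) :
    ENNReal.ofReal (|U b| * (w b - δ)) ≤
      ∫⁻ t in Ioc a b ∩ {t | δ < w t},
        ENNReal.ofReal (|U' t| * (w t - δ) + |U t| * |deriv w t|) := by
  rcases le_or_gt (w b) δ with hb | hb
  · rw [ENNReal.ofReal_of_nonpos (mul_nonpos_of_nonneg_of_nonpos (abs_nonneg _) (by linarith))]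
    exact zero_le
  have hlim : Tendsto (fun c => ENNReal.ofReal (|U b| * (w b - c))) (𝓝[>] δ)
      (𝓝 (ENNReal.ofReal (|U b| * (w b - δ)))) := by
    have : Continuous fun c => ENNReal.ofReal (|U b| * (w b - c)) :=
      ENNReal.continuous_ofReal.comp (by fun_prop)
    exact (this.tendsto δ).mono_left nhdsWithin_le_nhds
  refine le_of_tendsto hlim ?_
  filter_upwards [Ioo_mem_nhdsGT hb] with c hc
  obtain ⟨s, hs, hsc, hge⟩ := exists_last_crossing hw.continuous hab (ha.trans hc.1.le) hc.2
  refine (ofReal_abs_mul_le_lintegral_of_level (U' := U') hw hs.2.le hc.1 hsc hge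
    fun t ht => hU t ⟨hs.1.trans ht.1, ht.2⟩ (hc.1.trans_le (hge t ht))).trans
    (lintegral_mono_set fun t ht => ⟨⟨hs.1.trans_lt ht.1, ht.2⟩, ?_⟩)
  exact hc.1.trans_le (hge t ⟨ht.1.le, ht.2⟩)

section FiniteDimensional

variable {E : Type*} [NormedAddCommGroup E] [NormedSpace ℝ E] [FiniteDimensional ℝ E]
  [MeasurableSpace E] [BorelSpace E]

/-- Averaging over translates along a segment of length `M`. -/
lemma lintegral_le_mul_lintegral_of_le_segment (μ : Measure E) [μ.IsAddHaarMeasure]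
    {F G : E → ℝ≥0∞} (hG : Measurable G) (e : E) {M : ℝ}
    (h : ∀ x, F x ≤ ∫⁻ t in Ioc (-M) (0 : ℝ), G (x + t • e)) :
    ∫⁻ x, F x ∂μ ≤ ENNReal.ofReal M * ∫⁻ x, G x ∂μ := by
  calc ∫⁻ x, F x ∂μ ≤ ∫⁻ x, (∫⁻ t in Ioc (-M) (0 : ℝ), G (x + t • e)) ∂μ := lintegral_mono h
    _ = ∫⁻ t in Ioc (-M) (0 : ℝ), ∫⁻ x, G (x + t • e) ∂μ := by
        refine lintegral_lintegral_swap (Measurable.aemeasurable ?_)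
        exact hG.comp (by fun_prop)
    _ = ∫⁻ t in Ioc (-M) (0 : ℝ), ∫⁻ x, G x ∂μ := by simp_rw [lintegral_add_right_eq_self]
    _ = ENNReal.ofReal M * ∫⁻ x, G x ∂μ := by simp [mul_comm]

/-- Friedrichs inequality for a truncated Lipschitz weight supported in a ball, before absorption
of the zeroth order term. -/
lemma lintegral_truncated_weight_le (μ : Measure E) [μ.IsAddHaarMeasure] {w v : E → ℝ}
    {K : NNReal} {R p δ : ℝ} {e : E} (he : ‖e‖ = 1) (hp : 1 ≤ p) (hδ : 0 ≤ δ)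
    (hw : LipschitzWith K w) (hwR : ∀ x, 0 < w x → ‖x‖ < R) (hvm : Measurable v)
    (hv : ∀ x, 0 < w x → DifferentiableAt ℝ v x) :
    ∫⁻ x, ENNReal.ofReal (|v x| ^ p * (w x - δ)) ∂μ ≤
      ENNReal.ofReal (2 * R) * ∫⁻ x in {x | δ < w x},
        ENNReal.ofReal (p * |v x| ^ (p - 1) * ‖fderiv ℝ v x‖ * (w x - δ) +
          |v x| ^ p * ‖fderiv ℝ w x‖) ∂μ := by
  classical
  obtain ⟨φ, φ', hφ, hφabs, hφ'abs⟩ := exists_hasDerivAt_abs_eq_rpow hp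
  have hA : MeasurableSet {x | δ < w x} :=
    measurableSet_lt measurable_const hw.continuous.measurable
  have hDm : MeasurableSet {x | DifferentiableAt ℝ w x} := measurableSet_of_differentiableAt ℝ w
  have hwm : Measurable w := hw.continuous.measurable
  have hdv : Measurable (fderiv ℝ v) := measurable_fderiv ℝ v
  have hdw : Measurable (fderiv ℝ w) := measurable_fderiv ℝ w
  set J : E → ℝ≥0∞ := fun x => ENNReal.ofReal
    (p * |v x| ^ (p - 1) * ‖fderiv ℝ v x‖ * (w x - δ) + |v x| ^ p * ‖fderiv ℝ w x‖)
  have hJ : Measurable J := by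
    refine ENNReal.measurable_ofReal.comp ?_
    fun_prop
  set G : E → ℝ≥0∞ := fun x =>
    if x ∈ {x | DifferentiableAt ℝ w x} then {x | δ < w x}.indicator J x else ∞
  have hG : Measurable G := Measurable.ite hDm (hJ.indicator hA) measurable_const
  have hGae : ∫⁻ x, G x ∂μ = ∫⁻ x in {x | δ < w x}, J x ∂μ := by
    rw [← lintegral_indicator hA]
    refine lintegral_congr_ae ?_
    filter_upwards [hw.ae_differentiableAt (μ := μ)] with x hx
    exact if_pos hx
  rw [← hGae]
  refine lintegral_le_mul_lintegral_of_le_segment μ hG e fun x => ?_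
  rcases le_or_gt (w x) δ with hx | hx
  · rw [ENNReal.ofReal_of_nonpos (mul_nonpos_of_nonneg_of_nonpos (by positivity) (by linarith))]
    exact zero_le
  have hxR : ‖x‖ < R := hwR x (hδ.trans_lt hx)
  have hR : 0 < R := (norm_nonneg x).trans_lt hxR
  have hline : ∀ t : ℝ, HasDerivAt (fun t : ℝ => x + t • e) e t := fun t => by
    simpa using ((hasDerivAt_id t).smul_const e).const_add x
  have hlip : LipschitzWith K (fun t : ℝ => w (x + t • e)) := by
    have : LipschitzWith 1 (fun t : ℝ => x + t • e) := LipschitzWith.of_dist_le_mul fun s t => by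
      simp [dist_eq_norm, ← sub_smul, norm_smul, he]
    simpa [Function.comp_def] using hw.comp this
  have hstart : w (x + (-(2 * R)) • e) ≤ δ := by
    refine le_trans ?_ hδ
    by_contra! h
    have h1 := hwR _ h
    have h2 : ‖(-(2 * R)) • e‖ ≤ ‖x + (-(2 * R)) • e‖ + ‖x‖ := by
      simpa using norm_sub_le (x + (-(2 * R)) • e) x
    rw [norm_smul, he, Real.norm_eq_abs, abs_neg, abs_of_pos (by linarith)] at h2
    linarith
  have hmain := ofReal_abs_mul_le_lintegral (U := fun t => φ (v (x + t • e)))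
    (U' := fun t => φ' (v (x + t • e)) * fderiv ℝ v (x + t • e) e) hlip
    (by linarith : -(2 * R) ≤ 0) hstart (fun t _ ht =>
      (hφ _).comp t ((hv _ (hδ.trans_lt ht)).hasFDerivAt.comp_hasDerivAt t (hline t)))
  simp only [zero_smul, add_zero, hφabs] at hmain
  refine hmain.trans ?_
  have hAt : MeasurableSet {t : ℝ | δ < w (x + t • e)} :=
    measurableSet_lt measurable_const hlip.continuous.measurable
  rw [inter_comm, ← Measure.restrict_restrict hAt, ← lintegral_indicator hAt]
  refine lintegral_mono fun t => ?_
  by_cases hd : DifferentiableAt ℝ w (x + t • e)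
  swap
  · simp [G, hd]
  by_cases ht : δ < w (x + t • e)
  swap
  · simp [ht]
  have hdt : deriv (fun t : ℝ => w (x + t • e)) t = fderiv ℝ w (x + t • e) e :=
    (hd.hasFDerivAt.comp_hasDerivAt t (hline t)).deriv
  have hop : ∀ L : E →L[ℝ] ℝ, |L e| ≤ ‖L‖ := fun L => by simpa [he] using L.le_opNorm e
  simp only [G, J, mem_ofPred_eq, hd, if_true, indicator, ht, hdt, abs_mul, hφ'abs]
  refine ENNReal.ofReal_le_ofReal ?_
  have h0 : 0 ≤ w (x + t • e) - δ := by linarith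
  gcongr
  · exact hop _
  · exact hop _

lemma lintegral_truncated_weight_lt_top (μ : Measure E) [μ.IsAddHaarMeasure] {w v : E → ℝ}
    {R p δ : ℝ} (hp : 0 ≤ p) (hδ : 0 < δ) (hw : Continuous w)
    (hwR : ∀ x, 0 < w x → ‖x‖ < R) (hv : ∀ x, 0 < w x → ContinuousAt v x) :
    ∫⁻ x, ENNReal.ofReal (|v x| ^ p * (w x - δ)) ∂μ < ∞ := by
  set A : Set E := {x | δ ≤ w x}
  have hAcl : IsClosed A := isClosed_le continuous_const hw
  have hA : IsCompact A := (isCompact_closedBall (0 : E) R).of_isClosed_subset hAcl fun x hx => by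
    simpa using (hwR x (hδ.trans_le hx)).le
  have hcont : ContinuousOn (fun x => |v x| ^ p * (w x - δ)) A := fun x hx =>
    (((hv x (hδ.trans_le hx)).abs.rpow_const (Or.inr hp)).mul
      (hw.continuousAt.sub continuousAt_const)).continuousWithinAt
  obtain ⟨B, hB⟩ := hA.exists_bound_of_continuousOn hcont
  calc ∫⁻ x, ENNReal.ofReal (|v x| ^ p * (w x - δ)) ∂μ
      ≤ ∫⁻ x, A.indicator (fun _ => ENNReal.ofReal B) x ∂μ := by
        refine lintegral_mono fun x => ?_
        by_cases hx : x ∈ A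
        · rw [indicator_of_mem hx]
          exact ENNReal.ofReal_le_ofReal ((le_abs_self _).trans (hB x hx))
        · rw [indicator_of_notMem hx, ENNReal.ofReal_of_nonpos]
          have : w x < δ := not_le.1 hx
          exact mul_nonpos_of_nonneg_of_nonpos (by positivity) (by linarith)
    _ = ENNReal.ofReal B * μ A := lintegral_indicator_const hAcl.measurableSet _
    _ < ∞ := ENNReal.mul_lt_top ENNReal.ofReal_lt_top hA.measure_lt_top

/-- Friedrichs inequality with respect to a Lipschitz weight supported in a ball of radius `R`,
with a constant depending only on `R` and `p`. -/
lemma friedrichs_lipschitz_weight (μ : Measure E) [μ.IsAddHaarMeasure] {w v : E → ℝ}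
    {K : NNReal} {R p : ℝ} {e : E} (he : ‖e‖ = 1) (hp : 1 ≤ p) (hR : 0 < R)
    (hw : LipschitzWith K w) (hwR : ∀ x, 0 < w x → ‖x‖ < R) (hvm : Measurable v)
    (hv : ∀ x, 0 < w x → DifferentiableAt ℝ v x) :
    ∫⁻ x, ENNReal.ofReal (|v x| ^ p * w x) ∂μ ≤
      ENNReal.ofReal (2 * (2 * R * p * (2 * (2 * R) * p) ^ (p - 1) + 2 * R)) *
        (∫⁻ x in {x | 0 < w x}, ENNReal.ofReal (‖fderiv ℝ v x‖ ^ p * w x) ∂μ +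
          ∫⁻ x in {x | 0 < w x},
            ENNReal.ofReal (|v x| ^ p) * ENNReal.ofReal ‖fderiv ℝ w x‖ ∂μ) := by
  set C : ℝ := 2 * R * p * (2 * (2 * R) * p) ^ (p - 1) + 2 * R with hC
  set I₁ := ∫⁻ x in {x | 0 < w x}, ENNReal.ofReal (‖fderiv ℝ v x‖ ^ p * w x) ∂μ
  set I₂ := ∫⁻ x in {x | 0 < w x}, ENNReal.ofReal (|v x| ^ p) * ENNReal.ofReal ‖fderiv ℝ w x‖ ∂μ
  have hp0 : 0 < p := by linarith
  have hC1 : 2 * R * p * (2 * (2 * R) * p) ^ (p - 1) ≤ C := by linarith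
  have hC2 : 2 * R ≤ C := by
    have : 0 ≤ 2 * R * p * (2 * (2 * R) * p) ^ (p - 1) := by positivity
    linarith
  have hC0 : 0 ≤ C := by linarith
  have hwm : Measurable w := hw.continuous.measurable
  have hdv : Measurable (fderiv ℝ v) := measurable_fderiv ℝ v
  have hdw : Measurable (fderiv ℝ w) := measurable_fderiv ℝ w
  have htrunc : ∀ δ : ℝ, 0 < δ →
      ∫⁻ x, ENNReal.ofReal (|v x| ^ p * (w x - δ)) ∂μ ≤ ENNReal.ofReal (2 * C) * (I₁ + I₂) := by
    intro δ hδ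
    set I := ∫⁻ x, ENNReal.ofReal (|v x| ^ p * (w x - δ)) ∂μ with hI
    have hfin : I ≠ ∞ := (lintegral_truncated_weight_lt_top μ hp0.le hδ hw.continuous hwR
      fun x hx => (hv x hx).continuousAt).ne
    have hA : MeasurableSet {x | δ < w x} := measurableSet_lt measurable_const hwm
    have hsub : {x | δ < w x} ⊆ {x | 0 < w x} := fun x hx => hδ.trans hx
    have h1 : I ≤ 2⁻¹ * I + ENNReal.ofReal C * (I₁ + I₂) := by
      calc I ≤ _ := lintegral_truncated_weight_le μ he hp hδ.le hw hwR hvm hv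
        _ ≤ ∫⁻ x in {x | δ < w x}, (2⁻¹ * ENNReal.ofReal (|v x| ^ p * (w x - δ)) +
              ENNReal.ofReal C * (ENNReal.ofReal (‖fderiv ℝ v x‖ ^ p * w x) +
                ENNReal.ofReal (|v x| ^ p) * ENNReal.ofReal ‖fderiv ℝ w x‖)) ∂μ := by
            rw [← lintegral_const_mul' _ _ ENNReal.ofReal_ne_top]
            refine setLIntegral_mono' hA fun x hx => ?_
            have hx : δ < w x := hx
            have hx0 : 0 ≤ w x - δ := by linarith
            have hw0 : 0 ≤ w x := by linarith
            have h2 : (2⁻¹ : ℝ≥0∞) = ENNReal.ofReal 2⁻¹ := by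
              rw [ENNReal.ofReal_inv_of_pos two_pos]; simp
            rw [h2, ← ENNReal.ofReal_mul (by positivity), ← ENNReal.ofReal_mul (by positivity),
              ← ENNReal.ofReal_mul (by positivity), ← ENNReal.ofReal_add (by positivity)
              (by positivity), ← ENNReal.ofReal_mul hC0, ← ENNReal.ofReal_add (by positivity)
              (by positivity)]
            refine ENNReal.ofReal_le_ofReal ?_
            have hy := mul_le_mul_of_nonneg_right (mul_rpow_sub_one_mul_le hp
              (by linarith : 0 < 2 * R) (abs_nonneg (v x)) (norm_nonneg (fderiv ℝ v x))) hx0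
            have h3 : 2 * R * p * (2 * (2 * R) * p) ^ (p - 1) * ‖fderiv ℝ v x‖ ^ p * (w x - δ) ≤
                C * ‖fderiv ℝ v x‖ ^ p * w x := by
              gcongr
              linarith
            have h4 : 2 * R * (|v x| ^ p * ‖fderiv ℝ w x‖) ≤ C * (|v x| ^ p * ‖fderiv ℝ w x‖) := by
              gcongr
            linarith
        _ = 2⁻¹ * (∫⁻ x in {x | δ < w x}, ENNReal.ofReal (|v x| ^ p * (w x - δ)) ∂μ) +
              ENNReal.ofReal C *
                (∫⁻ x in {x | δ < w x}, ENNReal.ofReal (‖fderiv ℝ v x‖ ^ p * w x) ∂μ +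
                 ∫⁻ x in {x | δ < w x},
                   ENNReal.ofReal (|v x| ^ p) * ENNReal.ofReal ‖fderiv ℝ w x‖ ∂μ) := by
            rw [lintegral_add_left (by fun_prop), lintegral_const_mul' _ _ (by simp),
              lintegral_const_mul' _ _ ENNReal.ofReal_ne_top, lintegral_add_left (by fun_prop)]
        _ ≤ _ := by
            gcongr
            · exact setLIntegral_le_lintegral _ _
            · exact lintegral_mono_set hsub
            · exact lintegral_mono_set hsub
    have h2 : 2⁻¹ * I + 2⁻¹ * I ≤ 2⁻¹ * I + ENNReal.ofReal C * (I₁ + I₂) := by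
      rwa [← add_mul, ENNReal.inv_two_add_inv_two, one_mul]
    have h3 : 2⁻¹ * I ≤ ENNReal.ofReal C * (I₁ + I₂) :=
      (ENNReal.add_le_add_iff_left (ENNReal.mul_ne_top (by simp) hfin)).1 h2
    calc I = 2 * (2⁻¹ * I) := by
          rw [← mul_assoc, ENNReal.mul_inv_cancel (by simp) (by simp), one_mul]
      _ ≤ 2 * (ENNReal.ofReal C * (I₁ + I₂)) := by gcongr
      _ = _ := by rw [ENNReal.ofReal_mul two_pos.le, mul_assoc]; simp
  have hlim : Tendsto (fun k : ℕ => ∫⁻ x, ENNReal.ofReal (|v x| ^ p * (w x - 1 / ((k : ℝ) + 1))) ∂μ)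
      atTop (𝓝 (∫⁻ x, ENNReal.ofReal (|v x| ^ p * w x) ∂μ)) := by
    refine lintegral_tendsto_of_tendsto_of_monotone (fun k => by fun_prop) (ae_of_all _ fun x => ?_)
      (ae_of_all _ fun x => ?_)
    · intro k l hkl
      refine ENNReal.ofReal_le_ofReal ?_
      gcongr
    · refine ENNReal.tendsto_ofReal (tendsto_const_nhds.mul ?_)
      simpa using tendsto_const_nhds.sub (tendsto_one_div_add_atTop_nhds_zero_nat (𝕜 := ℝ))
  exact le_of_tendsto' hlim fun k => htrunc _ (by positivity)

end FiniteDimensional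

/-- Poincaré–Friedrichs-type inequality for diffuse interfaces, with constant
independent of `ε`. -/
theorem poincare_friedrichs_diffuse
    (n : ℕ) (hn : 2 ≤ n)
    (D : Set (EuclideanSpace ℝ (Fin n)))
    (hD_open : IsOpen D) (hD_bdd : Bornology.IsBounded D) (hD_ne : D.Nonempty)
    (dD : EuclideanSpace ℝ (Fin n) → ℝ)
    (hdD : ∀ x, dD x = Metric.infDist x D - Metric.infDist x Dᶜ)
    (Dt : ℝ → Set (EuclideanSpace ℝ (Fin n)))
    (hDt : ∀ t, Dt t = {x | dD x < t})
    (Γ : ℝ → Set (EuclideanSpace ℝ (Fin n)))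
    (hΓ : ∀ ε : ℝ, Γ ε = Dt ε \ closure (Dt (-ε)))
    (ε₀ : ℝ) (hε₀ : 0 < ε₀)
    (hproj : ∀ z ∈ Γ (2 * ε₀), ∃! y, y ∈ frontier D ∧ dist z y = Metric.infDist z (frontier D))
    (hC11 : ∃ U : Set (EuclideanSpace ℝ (Fin n)), IsOpen U ∧ frontier D ⊆ U ∧
      ContDiffOn ℝ 1 dD U ∧ ∃ L : NNReal, LipschitzOnWith L (fun x => fderiv ℝ dD x) U)
    (S : ℝ → ℝ) (ζ₁ ζ₂ α : ℝ) (hζ₁ : 0 < ζ₁) (hζ₂ : 0 < ζ₂) (hα : 0 < α)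
    (hS_lip : ∃ L : NNReal, LipschitzWith L S)
    (hS_sign : ∀ t : ℝ, 1 ≤ |t| → S t = t / |t|)
    (hS_pos : ∀ t : ℝ, |t| < 1 → 0 < deriv S t)
    (hS_odd : ∀ t : ℝ, S (-t) = -S t)
    (hS2 : ∀ t ∈ Set.Ioo (0:ℝ) 2,
      ζ₁ * t ^ α ≤ (1 + S (t - 1)) / 2 ∧ (1 + S (t - 1)) / 2 ≤ ζ₂ * t ^ α)
    (ω : ℝ → EuclideanSpace ℝ (Fin n) → ℝ)
    (hω : ∀ ε : ℝ, 0 < ε → ∀ x, ω ε x = (1 + S (-(dD x) / ε)) / 2)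
    (hω0 : ∀ x, ω 0 x = D.indicator (fun _ => (1:ℝ)) x)
    (p : ℝ) (hp : 1 ≤ p)
    (hconn : ∀ ε ∈ Set.Icc (0:ℝ) ε₀, IsConnected (Dt ε)) :
    ∃ C : ℝ, 0 < C ∧ ∀ ε ∈ Set.Ioo (0:ℝ) ε₀,
      ∀ v : EuclideanSpace ℝ (Fin n) → ℝ, Measurable v →
        (∀ x ∈ Dt ε, DifferentiableAt ℝ v x) →
        (∫⁻ x in Dt ε, ENNReal.ofReal (|v x| ^ p * ω ε x)) ≤
          ENNReal.ofReal C *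
            ((∫⁻ x in Dt ε, ENNReal.ofReal (‖fderiv ℝ v x‖ ^ p * ω ε x)) +
              ∫⁻ x in Dt ε,
                ENNReal.ofReal (|v x| ^ p) * ENNReal.ofReal ‖fderiv ℝ (ω ε) x‖) := by
  obtain ⟨L, hL⟩ := hS_lip
  obtain ⟨r, hr⟩ := hD_bdd.subset_closedBall 0
  have hr0 : 0 ≤ r := by
    obtain ⟨y, hy⟩ := hD_ne
    exact (norm_nonneg y).trans (by simpa using hr hy)
  have hdlip : LipschitzWith (1 + 1) dD := by
    rw [funext hdD]
    exact (Metric.lipschitz_infDist_pt D).sub (Metric.lipschitz_infDist_pt Dᶜ)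
  have hdR : ∀ ε ∈ Ioo (0 : ℝ) ε₀, ∀ x, dD x < ε → ‖x‖ < r + ε₀ := by
    intro ε hε x hx
    by_cases hxD : x ∈ D
    · have : ‖x‖ ≤ r := by simpa using hr hxD
      linarith
    · rw [hdD, Metric.infDist_zero_of_mem (show x ∈ Dᶜ from hxD), sub_zero,
        Metric.infDist_lt_iff hD_ne] at hx
      obtain ⟨y, hy, hxy⟩ := hx
      have h1 : ‖y‖ ≤ r := by simpa using hr hy
      have h2 : ‖x‖ ≤ ‖x - y‖ + ‖y‖ := by simpa using norm_add_le (x - y) y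
      rw [dist_eq_norm] at hxy
      linarith [hε.2]
  have he : ‖(EuclideanSpace.single ⟨0, by omega⟩ 1 : EuclideanSpace ℝ (Fin n))‖ = 1 := by simp
  have hR : 0 < r + ε₀ := by linarith
  set R : ℝ := r + ε₀
  refine ⟨2 * (2 * R * p * (2 * (2 * R) * p) ^ (p - 1) + 2 * R), by positivity,
    fun ε hε v hvm hv => ?_⟩
  have hωlip : LipschitzWith (L * ((1 + 1) * ‖ε⁻¹‖₊) * ‖(2 : ℝ)⁻¹‖₊) (ω ε) := by
    refine LipschitzWith.of_dist_le_mul fun x y => ?_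
    have h1 := hL.dist_le_mul (-(dD x) / ε) (-(dD y) / ε)
    have h2 := hdlip.dist_le_mul x y
    have h3 : dist (-(dD x) / ε) (-(dD y) / ε) = ‖ε⁻¹‖ * dist (dD x) (dD y) := by
      rw [Real.dist_eq, Real.dist_eq, Real.norm_eq_abs, ← abs_mul, ← abs_neg]
      ring_nf
    have h4 : dist (ω ε x) (ω ε y) =
        ‖(2 : ℝ)⁻¹‖ * dist (S (-(dD x) / ε)) (S (-(dD y) / ε)) := by
      rw [hω ε hε.1, hω ε hε.1, Real.dist_eq, Real.dist_eq, Real.norm_eq_abs, ← abs_mul]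
      ring_nf
    rw [h4]
    push_cast at h1 h2 ⊢
    calc _ ≤ ‖(2 : ℝ)⁻¹‖ * (L * (‖ε⁻¹‖ * ((1 + 1) * dist x y))) := by
          gcongr
          refine h1.trans ?_
          rw [h3]
          gcongr
      _ = _ := by ring
  have hpos : ∀ x, 0 < ω ε x → x ∈ Dt ε := by
    intro x hx
    rw [hDt]
    change dD x < ε
    by_contra! h
    have h1 : -(dD x) / ε ≤ -1 := by
      rw [div_le_iff₀ hε.1]; linarith
    have h2 : S (-(dD x) / ε) = -1 := by
      rw [hS_sign _ (by rw [abs_of_nonpos (by linarith)]; linarith),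
        abs_of_nonpos (by linarith), div_neg, div_self (by linarith)]
    rw [hω ε hε.1, h2] at hx
    norm_num at hx
  have hposR : ∀ x, 0 < ω ε x → ‖x‖ < r + ε₀ := fun x hx => by
    have := hpos x hx
    rw [hDt] at this
    exact hdR ε hε x this
  refine (setLIntegral_le_lintegral _ _).trans ((friedrichs_lipschitz_weight volume he hp hR
    hωlip hposR hvm fun x hx => hv x (hpos x hx)).trans ?_)
  gcongr
  · exact hpos
  · exact hpos
end
end

section
/- Let 1 < p ≤ ∞ and h ∈ L^p(D_ε; ω^ε). Then there exists a constant C > 0 independent of ε ∈ (0, ε₀) such that the diffuse volume error satisfies |E_V(h)| = |∫_Ω h ω^ε dx − ∫_D h dx| ≤ C ε^{1−1/p} ‖h‖_{L^p(Γ_ε;ω^ε)}. Moreover, if p = 1 and h ∈ L^1(Ω), then E_V(h) → 0 as ε → 0⁺. -/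
open MeasureTheory ENNReal Set Filter Topology
open scoped RealInnerProductSpace

noncomputable section

/-- Near a point of nonvanishing strict derivative, the layer `{|f| ≤ ε}` has measure `O(ε)`. -/
theorem exists_isOpen_measure_layer_le {E : Type*} [NormedAddCommGroup E] [NormedSpace ℝ E]
    [FiniteDimensional ℝ E] [MeasurableSpace E] [BorelSpace E] (μ : Measure E)
    [μ.IsAddHaarMeasure] {f : E → ℝ} (hfm : Measurable f) {f' : E →L[ℝ] ℝ} {x₀ : E}
    (hf : HasStrictFDerivAt f f' x₀) (hf' : f' ≠ 0) :
    ∃ V : Set E, IsOpen V ∧ x₀ ∈ V ∧ ∃ C : ℝ, 0 ≤ C ∧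
      ∀ ε : ℝ, 0 < ε → ε ≤ 1 → μ (V ∩ {x | |f x| ≤ ε}) ≤ ENNReal.ofReal (C * ε) := by
  obtain ⟨v, hv⟩ : ∃ v, f' v = 1 := by
    obtain ⟨u, hu⟩ : ∃ u, f' u ≠ 0 := by
      by_contra! h
      exact hf' (ContinuousLinearMap.ext h)
    exact ⟨(f' u)⁻¹ • u, by simp [hu]⟩
  have hc : 0 < 1 / (2 * (‖v‖ + 1)) := by positivity
  have hev := hf.isLittleO.def hc
  obtain ⟨r, hr, hball⟩ := Metric.eventually_nhds_iff_ball.1 hev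
  have hgrow : ∀ x ∈ Metric.ball x₀ r, ∀ s : ℝ, 0 ≤ s → x + s • v ∈ Metric.ball x₀ r →
      s / 2 ≤ f (x + s • v) - f x := by
    intro x hx s hs hxs
    have h := hball (x + s • v, x) (by
      rw [Metric.mem_ball, Prod.dist_eq]
      exact max_lt hxs hx)
    simp only [add_sub_cancel_left, map_smul, hv, smul_eq_mul, mul_one, norm_smul,
      Real.norm_eq_abs, abs_of_nonneg hs] at h
    have h2 : 1 / (2 * (‖v‖ + 1)) * (s * ‖v‖) ≤ s / 2 := by
      rw [div_mul_eq_mul_div, div_le_iff₀ (by positivity)]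
      nlinarith [norm_nonneg v]
    have h3 := (abs_le.1 h).1
    linarith
  refine ⟨Metric.ball x₀ r, Metric.isOpen_ball, Metric.mem_ball_self hr,
    (μ (Metric.ball x₀ (r + 10 * ‖v‖))).toReal, ENNReal.toReal_nonneg, ?_⟩
  intro ε hε hε1
  set A := Metric.ball x₀ r ∩ {x | |f x| ≤ ε} with hA
  have hAm : MeasurableSet A :=
    Metric.isOpen_ball.measurableSet.inter (measurableSet_le hfm.abs measurable_const)
  have hsep : ∀ x s, 4 * ε < s → x ∈ A → x + s • v ∈ A → False := by
    intro x s hs hx hxs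
    have h1 := hgrow x hx.1 s (by linarith) hxs.1
    have h2 : |f x| ≤ ε := hx.2
    have h3 : |f (x + s • v)| ≤ ε := hxs.2
    linarith [(abs_le.1 h2).1, (abs_le.1 h3).2]
  set N := ⌈1 / ε⌉₊ with hN
  have hN1 : 1 / ε ≤ N := Nat.le_ceil _
  have hN2 : (N : ℝ) < 1 / ε + 1 := Nat.ceil_lt_add_one (by positivity)
  let T : ℕ → Set E := fun k => (fun x => x + (5 * ε * k) • v) ⁻¹' A
  have hTm : ∀ k, MeasurableSet (T k) := fun k => hAm.preimage (measurable_id.add_const _)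
  have hTlt : ∀ j k : ℕ, j < k → Disjoint (T j) (T k) := by
    intro j k hjk
    rw [Set.disjoint_left]
    intro x hj hk
    have hjk' : (j : ℝ) + 1 ≤ k := by exact_mod_cast hjk
    refine hsep (x + (5 * ε * j) • v) (5 * ε * (k - j)) (by nlinarith) hj ?_
    have : x + (5 * ε * j) • v + (5 * ε * (k - j)) • v = x + (5 * ε * k) • v := by
      rw [add_assoc, ← add_smul]; congr 2; ring
    rw [this]; exact hk
  have hTd : Pairwise (Function.onFun Disjoint T) := by
    intro j k hjk
    rcases lt_or_gt_of_ne hjk with h | h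
    · exact hTlt j k h
    · exact (hTlt k j h).symm
  have hTsub : ∀ k ∈ Finset.range N, T k ⊆ Metric.ball x₀ (r + 10 * ‖v‖) := by
    intro k hk x hx
    have hk' : (k : ℝ) ≤ N - 1 := by
      have : k + 1 ≤ N := Finset.mem_range.1 hk
      have : (k : ℝ) + 1 ≤ N := by exact_mod_cast this
      linarith
    have hk2 : 5 * ε * k ≤ 10 := by
      have : ε * k ≤ ε * (1 / ε) := by gcongr; linarith
      rw [mul_one_div_cancel hε.ne'] at this
      linarith
    have h1 : dist (x + (5 * ε * k) • v) x₀ < r := hx.1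
    have h2 : dist x (x + (5 * ε * k) • v) ≤ 10 * ‖v‖ := by
      rw [dist_self_add_right, norm_smul, Real.norm_eq_abs, abs_of_nonneg (by positivity)]
      gcongr
    rw [Metric.mem_ball]
    linarith [dist_triangle x (x + (5 * ε * k) • v) x₀]
  have hsum : (N : ℝ≥0∞) * μ A ≤ μ (Metric.ball x₀ (r + 10 * ‖v‖)) := by
    calc (N : ℝ≥0∞) * μ A = ∑ k ∈ Finset.range N, μ (T k) := by
          simp [T, measure_preimage_add_right]
      _ = μ (⋃ k ∈ Finset.range N, T k) :=
          (measure_biUnion_finset (hTd.set_pairwise _) fun k _ => hTm k).symm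
      _ ≤ _ := measure_mono (Set.iUnion₂_subset hTsub)
  have hM : μ (Metric.ball x₀ (r + 10 * ‖v‖)) ≠ ⊤ := measure_ball_lt_top.ne
  have hAfin : μ A ≠ ⊤ := ((measure_mono inter_subset_left).trans_lt measure_ball_lt_top).ne
  rw [← ENNReal.ofReal_toReal hAfin]
  apply ENNReal.ofReal_le_ofReal
  have h1 := ENNReal.toReal_mono hM hsum
  rw [ENNReal.toReal_mul, ENNReal.toReal_natCast] at h1
  have h2 : 1 / ε * (μ A).toReal ≤ (N : ℝ) * (μ A).toReal := by gcongr
  have h3 := h2.trans h1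
  rw [one_div_mul_eq_div, div_le_iff₀ hε] at h3
  exact h3

/-- A compact set of points with nonvanishing strict derivative has an open neighborhood in which
the layers `{|f| ≤ ε}` have measure `O(ε)`. -/
theorem IsCompact.exists_isOpen_measure_layer_le {E : Type*} [NormedAddCommGroup E]
    [NormedSpace ℝ E] [FiniteDimensional ℝ E] [MeasurableSpace E] [BorelSpace E] (μ : Measure E)
    [μ.IsAddHaarMeasure] {f : E → ℝ} (hfm : Measurable f) {K : Set E} (hK : IsCompact K)
    (hf : ∀ x ∈ K, ∃ f' : E →L[ℝ] ℝ, HasStrictFDerivAt f f' x ∧ f' ≠ 0) :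
    ∃ V : Set E, IsOpen V ∧ K ⊆ V ∧ ∃ C : ℝ, 0 ≤ C ∧
      ∀ ε : ℝ, 0 < ε → ε ≤ 1 → μ (V ∩ {x | |f x| ≤ ε}) ≤ ENNReal.ofReal (C * ε) := by
  refine hK.induction_on (p := fun s => ∃ V : Set E, IsOpen V ∧ s ⊆ V ∧ ∃ C : ℝ, 0 ≤ C ∧
      ∀ ε : ℝ, 0 < ε → ε ≤ 1 → μ (V ∩ {x | |f x| ≤ ε}) ≤ ENNReal.ofReal (C * ε)) ?_ ?_ ?_ ?_
  · exact ⟨∅, isOpen_empty, Subset.rfl, 0, le_rfl, by simp⟩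
  · rintro s t hst ⟨V, hV, htV, hC⟩
    exact ⟨V, hV, hst.trans htV, hC⟩
  · rintro s t ⟨V, hV, hsV, C, hC, hVC⟩ ⟨W, hW, htW, C', hC', hWC⟩
    refine ⟨V ∪ W, hV.union hW, union_subset_union hsV htW, C + C', by positivity, ?_⟩
    intro ε hε hε1
    rw [union_inter_distrib_right, add_mul, ENNReal.ofReal_add (by positivity) (by positivity)]
    exact (measure_union_le _ _).trans (add_le_add (hVC ε hε hε1) (hWC ε hε hε1))
  · intro x hx
    obtain ⟨f', hf', hne⟩ := hf x hx
    obtain ⟨V, hV, hxV, hC⟩ := _root_.exists_isOpen_measure_layer_le μ hfm hf' hne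
    exact ⟨V, mem_nhdsWithin_of_mem_nhds (hV.mem_nhds hxV), V, hV, Subset.rfl, hC⟩

/-- If the signed distance is `C¹` at a boundary point, its derivative does not vanish there. -/
theorem fderiv_signedDist_ne_zero {E : Type*} [NormedAddCommGroup E]
    [NormedSpace ℝ E] [FiniteDimensional ℝ E] {D : Set E} (hD : IsOpen D) {f : E → ℝ}
    (hf : ∀ x, f x = Metric.infDist x D - Metric.infDist x Dᶜ) {x₀ : E} (hx₀ : x₀ ∈ frontier D)
    {f' : E →L[ℝ] ℝ} (hf' : HasStrictFDerivAt f f' x₀) : f' ≠ 0 := by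
  rintro rfl
  have hev := hf'.isLittleO.def (show (0 : ℝ) < 1 / 2 by norm_num)
  obtain ⟨r, hr, hball⟩ := Metric.eventually_nhds_iff_ball.1 hev
  rw [hD.frontier_eq] at hx₀
  obtain ⟨x, hxD, hx⟩ := Metric.mem_closure_iff.1 hx₀.1 (r / 2) (by positivity)
  have hne : (Dᶜ).Nonempty := ⟨x₀, hx₀.2⟩
  obtain ⟨y, hy, hxy⟩ := hD.isClosed_compl.exists_infDist_eq_dist hne x
  have hyx₀ : dist x y ≤ dist x x₀ := hxy ▸ Metric.infDist_le_dist_of_mem hx₀.2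
  have hpos : 0 < dist x y := dist_pos.2 fun h => hy (h ▸ hxD)
  have h := hball (y, x) (by
    rw [Metric.mem_ball, Prod.dist_eq]
    refine max_lt ?_ ?_
    · linarith [dist_triangle y x x₀, dist_comm x y, dist_comm x x₀]
    · change dist x x₀ < r
      linarith [dist_comm x x₀])
  have hfx : f x = -dist x y := by rw [hf, Metric.infDist_zero_of_mem hxD, hxy]; ring
  have hfy : 0 ≤ f y := by
    rw [hf, Metric.infDist_zero_of_mem hy, sub_zero]; exact Metric.infDist_nonneg
  simp only [_root_.zero_apply, sub_zero, ← dist_eq_norm] at h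
  have := le_abs_self (f y - f x)
  rw [dist_comm y x, Real.dist_eq] at h
  linarith

/-- The layers `{|f| ≤ ε}` of the signed distance `f` of a bounded open set have measure `O(ε)`
if `f` is `C¹` near the boundary. -/
theorem exists_measure_signedDist_layer_le {E : Type*} [NormedAddCommGroup E]
    [NormedSpace ℝ E] [FiniteDimensional ℝ E] [MeasurableSpace E] [BorelSpace E] (μ : Measure E)
    [μ.IsAddHaarMeasure] {D : Set E} (hD : IsOpen D) (hDb : Bornology.IsBounded D)
    (hDne : D.Nonempty) (hDc : (Dᶜ).Nonempty) {f : E → ℝ}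
    (hf : ∀ x, f x = Metric.infDist x D - Metric.infDist x Dᶜ) (hfc : Continuous f)
    {U : Set E} (hU : IsOpen U) (hDU : frontier D ⊆ U) (hfU : ContDiffOn ℝ 1 f U)
    {ε₀ : ℝ} (hb : Bornology.IsBounded {x | f x < ε₀}) :
    ∃ C : ℝ, 0 < C ∧ ∀ ε ∈ Set.Ioo 0 ε₀, μ {x | |f x| ≤ ε} ≤ ENNReal.ofReal (C * ε) := by
  have hK : IsCompact (frontier D) :=
    hDb.isCompact_closure.of_isClosed_subset isClosed_frontier frontier_subset_closure
  obtain ⟨V, hV, hKV, C₁, hC₁, hVC⟩ := hK.exists_isOpen_measure_layer_le μ hfc.measurable (by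
    intro x hx
    have hs := (hfU.contDiffAt (hU.mem_nhds (hDU hx))).hasStrictFDerivAt one_ne_zero
    exact ⟨_, hs, fderiv_signedDist_ne_zero hD hf hx hs⟩)
  have hQ : IsCompact (closure {x | f x < ε₀} \ V) := hb.isCompact_closure.diff hV
  obtain ⟨δ, hδ, hδQ⟩ := hQ.exists_forall_le' (f := fun x => |f x|) (a := 0)
    hfc.abs.continuousOn (by
      intro x hx
      rw [abs_pos]
      intro h0
      refine hx.2 (hKV ?_)
      rw [hD.frontier_eq]
      rw [hf] at h0
      by_cases hxD : x ∈ D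
      · rw [Metric.infDist_zero_of_mem hxD] at h0
        exact absurd hxD ((hD.isClosed_compl.mem_iff_infDist_zero hDc).2 (by linarith))
      · rw [Metric.infDist_zero_of_mem (s := Dᶜ) hxD] at h0
        exact ⟨(Metric.mem_closure_iff_infDist_zero hDne).2 (by linarith), hxD⟩)
  have hM : μ {x | f x < ε₀} ≠ ⊤ := hb.measure_lt_top.ne
  set M := (μ {x | f x < ε₀}).toReal with hMdef
  have hM0 : 0 ≤ M := ENNReal.toReal_nonneg
  set ρ := min δ 1 with hρ
  have hρ0 : 0 < ρ := lt_min hδ one_pos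
  refine ⟨C₁ + M / ρ + 1, by positivity, ?_⟩
  rintro ε ⟨hε, hεε₀⟩
  have hsub : {x | |f x| ≤ ε} ⊆ {x | f x < ε₀} := fun x hx =>
    ((le_abs_self _).trans hx).trans_lt hεε₀
  rcases lt_or_ge ε ρ with h | h
  · have hlt : ε < δ := h.trans_le (min_le_left _ _)
    have hle : ε ≤ 1 := h.le.trans (min_le_right _ _)
    have hsubV : {x | |f x| ≤ ε} ⊆ V ∩ {x | |f x| ≤ ε} := by
      intro x hx
      refine ⟨?_, hx⟩
      by_contra hxV
      have h1 : |f x| ≤ ε := hx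
      exact absurd (hδQ x ⟨subset_closure (hsub hx), hxV⟩) (by simpa using h1.trans_lt hlt)
    refine ((measure_mono hsubV).trans (hVC ε hε hle)).trans (ENNReal.ofReal_le_ofReal ?_)
    gcongr
    have : 0 ≤ M / ρ := by positivity
    linarith
  · refine (measure_mono hsub).trans ?_
    rw [← ENNReal.ofReal_toReal hM]
    apply ENNReal.ofReal_le_ofReal
    have h1 : M ≤ M / ρ * ε := by
      rw [div_mul_eq_mul_div, le_div_iff₀ hρ0]
      gcongr
    calc M ≤ M / ρ * ε := h1
      _ ≤ (C₁ + M / ρ + 1) * ε := by gcongr; linarith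

theorem eLpNorm_one_wMeas {n : ℕ} (U : Set (EuclideanSpace ℝ (Fin n)))
    {w h : EuclideanSpace ℝ (Fin n) → ℝ} (hw : Measurable w) (hh : Measurable h) :
    eLpNorm h 1 (wMeas U w) = ∫⁻ x in U, ENNReal.ofReal (w x) * ‖h x‖ₑ := by
  rw [eLpNorm_one_eq_lintegral_enorm, wMeas,
    lintegral_withDensity_eq_lintegral_mul _ hw.ennreal_ofReal hh.enorm]
  rfl

theorem wMeas_univ_le {n : ℕ} (U : Set (EuclideanSpace ℝ (Fin n)))
    {w : EuclideanSpace ℝ (Fin n) → ℝ} (hw : ∀ x, w x ≤ 1) :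
    wMeas U w univ ≤ volume U := by
  rw [wMeas, withDensity_apply _ MeasurableSet.univ, Measure.restrict_univ]
  calc ∫⁻ x in U, ENNReal.ofReal (w x) ≤ ∫⁻ _ in U, 1 :=
        lintegral_mono fun x => by simpa using hw x
    _ = volume U := by simp

theorem one_sub_toReal_one_div_nonneg {p : ℝ≥0∞} (hp : 1 ≤ p) : 0 ≤ 1 - (1 / p).toReal := by
  rw [sub_nonneg]
  refine ENNReal.toReal_le_of_le_ofReal zero_le_one ?_
  simpa using hp

theorem eLpNorm_one_wMeas_le {n : ℕ} (U : Set (EuclideanSpace ℝ (Fin n)))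
    {w h : EuclideanSpace ℝ (Fin n) → ℝ} (hw : ∀ x, w x ≤ 1) (hh : Measurable h)
    {p : ℝ≥0∞} (hp : 1 ≤ p) :
    eLpNorm h 1 (wMeas U w) ≤
      eLpNorm h p (wMeas U w) * volume U ^ (1 - (1 / p).toReal) := by
  refine (eLpNorm_le_eLpNorm_mul_rpow_measure_univ hp hh.aestronglyMeasurable).trans ?_
  have he : 1 / (1 : ℝ≥0∞).toReal - 1 / p.toReal = 1 - (1 / p).toReal := by simp
  have h0 := one_sub_toReal_one_div_nonneg hp
  rw [he]
  exact mul_le_mul_right (ENNReal.rpow_le_rpow (wMeas_univ_le U hw) h0) _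

/-- Hölder estimate for the error made when replacing the indicator of `D` by a weight `w` that
agrees with it outside `G`. -/
theorem enorm_setIntegral_mul_sub_setIntegral_le {n : ℕ}
    {D U G Ω : Set (EuclideanSpace ℝ (Fin n))} {w h : EuclideanSpace ℝ (Fin n) → ℝ}
    (hD : MeasurableSet D) (hU : MeasurableSet U) (hG : MeasurableSet G)
    (hw : Measurable w) (hw0 : ∀ x, 0 ≤ w x) (hw1 : ∀ x, w x ≤ 1) (hwD : ∀ x ∈ D, 1 / 2 ≤ w x)
    (hwU : ∀ x ∉ U, w x = 0) (hUΩ : U ⊆ Ω) (hwG : ∀ x ∉ G, w x = D.indicator 1 x)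
    (hUfin : volume U ≠ ⊤) {p : ℝ≥0∞} (hp : 1 ≤ p) (hh : Measurable h)
    (hfin : eLpNorm h p (wMeas U w) < ⊤) :
    ‖(∫ x in Ω, h x * w x) - ∫ x in D, h x‖ₑ ≤
      eLpNorm h p (wMeas G w) * volume G ^ (1 - (1 / p).toReal) := by
  have h0 := one_sub_toReal_one_div_nonneg hp
  have hweight : ∀ x, ‖h x * w x‖ₑ = ENNReal.ofReal (w x) * ‖h x‖ₑ := by
    intro x
    rw [enorm_mul, Real.enorm_of_nonneg (hw0 x), mul_comm]
  have hint : Integrable fun x => h x * w x := by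
    refine ⟨(hh.mul hw).aestronglyMeasurable, ?_⟩
    have hind : ∀ x, ‖h x * w x‖ₑ = U.indicator (fun x => ENNReal.ofReal (w x) * ‖h x‖ₑ) x := by
      intro x
      by_cases hx : x ∈ U
      · rw [indicator_of_mem hx, hweight]
      · rw [indicator_of_notMem hx, hwU x hx]; simp
    rw [HasFiniteIntegral, lintegral_congr hind, lintegral_indicator hU,
      ← eLpNorm_one_wMeas U hw hh]
    refine (eLpNorm_one_wMeas_le U hw1 hh hp).trans_lt (ENNReal.mul_lt_top hfin ?_)
    exact ENNReal.rpow_lt_top_of_nonneg h0 hUfin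
  have hintD : Integrable (D.indicator h) := by
    refine (hint.norm.const_mul 2).mono' (hh.indicator hD).aestronglyMeasurable
      (ae_of_all _ fun x => ?_)
    by_cases hx : x ∈ D
    · rw [indicator_of_mem hx, norm_mul, Real.norm_of_nonneg (hw0 x)]
      nlinarith [hwD x hx, norm_nonneg (h x)]
    · rw [indicator_of_notMem hx, norm_zero]; positivity
  have hΩ : ∫ x in Ω, h x * w x = ∫ x, h x * w x :=
    setIntegral_eq_integral_of_forall_compl_eq_zero fun x hx => by
      rw [hwU x fun hxU => hx (hUΩ hxU), mul_zero]
  rw [hΩ, ← integral_indicator hD, ← integral_sub hint hintD]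
  calc ‖∫ x, (h x * w x - D.indicator h x)‖ₑ
      ≤ ∫⁻ x, ‖h x * w x - D.indicator h x‖ₑ := enorm_integral_le_lintegral_enorm _
    _ ≤ ∫⁻ x, G.indicator (fun x => ENNReal.ofReal (w x) * ‖h x‖ₑ) x := by
        refine lintegral_mono fun x => ?_
        by_cases hx : x ∈ G
        · rw [indicator_of_mem hx, ← hweight, enorm_le_iff_norm_le]
          by_cases hxD : x ∈ D
          · have : h x * w x - h x = h x * (w x - 1) := by ring
            rw [indicator_of_mem hxD, this, norm_mul, norm_mul, Real.norm_of_nonneg (hw0 x),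
              Real.norm_of_nonpos (sub_nonpos.2 (hw1 x))]
            refine mul_le_mul_of_nonneg_left ?_ (norm_nonneg _)
            linarith [hwD x hxD]
          · rw [indicator_of_notMem hxD, sub_zero]
        · rw [indicator_of_notMem hx, hwG x hx]
          by_cases hxD : x ∈ D <;> simp [hxD]
    _ = eLpNorm h 1 (wMeas G w) := by
        rw [lintegral_indicator hG, eLpNorm_one_wMeas G hw hh]
    _ ≤ _ := eLpNorm_one_wMeas_le G hw1 hh hp

/-- Convergence of diffuse volume integrals: rate `ε^{1-1/p}` for `L^p` integrands,
`1 < p ≤ ∞`, and plain convergence for `p = 1`. -/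
theorem diffuse_volume_integral_Lp
    (n : ℕ) (hn : 2 ≤ n)
    (D : Set (EuclideanSpace ℝ (Fin n)))
    (hD_open : IsOpen D) (hD_bdd : Bornology.IsBounded D) (hD_ne : D.Nonempty)
    (dD : EuclideanSpace ℝ (Fin n) → ℝ)
    (hdD : ∀ x, dD x = Metric.infDist x D - Metric.infDist x Dᶜ)
    (Dt : ℝ → Set (EuclideanSpace ℝ (Fin n)))
    (hDt : ∀ t, Dt t = {x | dD x < t})
    (Γ : ℝ → Set (EuclideanSpace ℝ (Fin n)))
    (hΓ : ∀ ε : ℝ, Γ ε = Dt ε \ closure (Dt (-ε)))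
    (ε₀ : ℝ) (hε₀ : 0 < ε₀)
    (hproj : ∀ z ∈ Γ (2 * ε₀), ∃! y, y ∈ frontier D ∧ dist z y = Metric.infDist z (frontier D))
    (hC11 : ∃ U : Set (EuclideanSpace ℝ (Fin n)), IsOpen U ∧ frontier D ⊆ U ∧
      ContDiffOn ℝ 1 dD U ∧ ∃ L : NNReal, LipschitzOnWith L (fun x => fderiv ℝ dD x) U)
    (S : ℝ → ℝ) (ζ₁ ζ₂ α : ℝ) (hζ₁ : 0 < ζ₁) (hζ₂ : 0 < ζ₂) (hα : 0 < α)
    (hS_lip : ∃ L : NNReal, LipschitzWith L S)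
    (hS_sign : ∀ t : ℝ, 1 ≤ |t| → S t = t / |t|)
    (hS_pos : ∀ t : ℝ, |t| < 1 → 0 < deriv S t)
    (hS_odd : ∀ t : ℝ, S (-t) = -S t)
    (hS2 : ∀ t ∈ Set.Ioo (0:ℝ) 2,
      ζ₁ * t ^ α ≤ (1 + S (t - 1)) / 2 ∧ (1 + S (t - 1)) / 2 ≤ ζ₂ * t ^ α)
    (ω : ℝ → EuclideanSpace ℝ (Fin n) → ℝ)
    (hω : ∀ ε : ℝ, 0 < ε → ∀ x, ω ε x = (1 + S (-(dD x) / ε)) / 2)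
    (Ω : Set (EuclideanSpace ℝ (Fin n))) (hΩ_open : IsOpen Ω) (hΩ_bdd : Bornology.IsBounded Ω)
    (hΩD : closure (Dt ε₀) ⊆ Ω)
 :
    (∀ p : ℝ≥0∞, 1 < p →
      ∃ C : ℝ, 0 < C ∧ ∀ ε ∈ Set.Ioo (0:ℝ) ε₀,
        ∀ h : EuclideanSpace ℝ (Fin n) → ℝ, Measurable h →
          eLpNorm h p (wMeas (Dt ε) (ω ε)) < ⊤ →
          ENNReal.ofReal |(∫ x in Ω, h x * ω ε x) - ∫ x in D, h x| ≤
            ENNReal.ofReal (C * ε ^ (1 - (1 / p).toReal)) *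
              eLpNorm h p (wMeas (Γ ε) (ω ε))) ∧
    (∀ h : EuclideanSpace ℝ (Fin n) → ℝ, IntegrableOn h Ω volume →
      Tendsto (fun ε : ℝ => (∫ x in Ω, h x * ω ε x) - ∫ x in D, h x)
        (𝓝[>] (0:ℝ)) (𝓝 0)) := by
  obtain ⟨LS, hLS⟩ := hS_lip
  have hS0 : S 0 = 0 := by
    have := hS_odd 0
    rw [neg_zero] at this
    linarith
  have hS_one : ∀ t, 1 ≤ t → S t = 1 := fun t ht => by
    have h0 : 0 < t := by linarith
    rw [hS_sign t (by rwa [abs_of_pos h0]), abs_of_pos h0, div_self h0.ne']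
  have hS_mono : StrictMonoOn S (Icc (-1) 1) :=
    strictMonoOn_of_deriv_pos (convex_Icc _ _) hLS.continuous.continuousOn fun t ht => by
      rw [interior_Icc] at ht
      exact hS_pos t (abs_lt.2 ht)
  have hS_nonneg : ∀ t, 0 ≤ t → 0 ≤ S t ∧ S t ≤ 1 := by
    intro t ht
    rcases le_total 1 t with h | h
    · rw [hS_one t h]; norm_num
    · constructor
      · rw [← hS0]
        exact hS_mono.monotoneOn (by norm_num) ⟨by linarith, h⟩ ht
      · rw [← hS_one 1 le_rfl]
        exact hS_mono.monotoneOn ⟨by linarith, h⟩ (by norm_num) h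
  have hS_nonpos : ∀ t, t ≤ 0 → -1 ≤ S t ∧ S t ≤ 0 := by
    intro t ht
    have h := hS_nonneg (-t) (by linarith)
    rw [hS_odd] at h
    constructor <;> linarith [h.1, h.2]
  have hdc : Continuous dD := by
    rw [show dD = fun x => Metric.infDist x D - Metric.infDist x Dᶜ from funext hdD]
    exact (Metric.continuous_infDist_pt _).sub (Metric.continuous_infDist_pt _)
  have hωc : ∀ ε, 0 < ε → Continuous (ω ε) := by
    intro ε hε
    rw [show ω ε = fun x => (1 + S (-(dD x) / ε)) / 2 from funext (hω ε hε)]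
    exact (continuous_const.add (hLS.continuous.comp (hdc.neg.div_const ε))).div_const 2
  have hω0 : ∀ ε, 0 < ε → ∀ x, 0 ≤ ω ε x ∧ ω ε x ≤ 1 := by
    intro ε hε x
    rw [hω ε hε]
    rcases le_total 0 (-(dD x) / ε) with h | h
    · constructor <;> linarith [(hS_nonneg _ h).1, (hS_nonneg _ h).2]
    · constructor <;> linarith [(hS_nonpos _ h).1, (hS_nonpos _ h).2]
  have hω_half : ∀ ε, 0 < ε → ∀ x, dD x ≤ 0 → 1 / 2 ≤ ω ε x := by
    intro ε hε x hx
    rw [hω ε hε]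
    linarith [(hS_nonneg (-(dD x) / ε) (div_nonneg (by linarith) hε.le)).1]
  have hω_one : ∀ ε, 0 < ε → ∀ x, dD x ≤ -ε → ω ε x = 1 := by
    intro ε hε x hx
    rw [hω ε hε, hS_one _ (by rw [le_div_iff₀ hε]; linarith)]
    norm_num
  have hω_zero : ∀ ε, 0 < ε → ∀ x, ε ≤ dD x → ω ε x = 0 := by
    intro ε hε x hx
    have h := hS_odd (dD x / ε)
    rw [hS_one (dD x / ε) (by rwa [le_div_iff₀ hε, one_mul]), ← neg_div] at h
    rw [hω ε hε, h]
    norm_num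
  have hDc : (Dᶜ).Nonempty := by
    rw [nonempty_compl]
    rintro rfl
    have : Nonempty (Fin n) := ⟨⟨0, by omega⟩⟩
    exact NormedSpace.unbounded_univ ℝ (EuclideanSpace ℝ (Fin n)) hD_bdd
  have hdD_neg : ∀ x ∈ D, dD x < 0 := by
    intro x hx
    rw [hdD, Metric.infDist_zero_of_mem hx, zero_sub, neg_lt_zero]
    exact (hD_open.isClosed_compl.notMem_iff_infDist_pos hDc).1 (not_not.2 hx)
  have hdD_nonneg : ∀ x ∉ D, 0 ≤ dD x := by
    intro x hx
    rw [hdD, Metric.infDist_zero_of_mem (s := Dᶜ) hx, sub_zero]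
    exact Metric.infDist_nonneg
  have hDtsub : ∀ ε, ε ≤ ε₀ → Dt ε ⊆ Ω := by
    intro ε hε x hx
    refine hΩD (subset_closure ?_)
    rw [hDt] at hx ⊢
    exact lt_of_lt_of_le hx hε
  have hb : Bornology.IsBounded {x | dD x < ε₀} := by
    rw [← hDt]
    exact hΩ_bdd.subset (hDtsub ε₀ le_rfl)
  have hDt_meas : ∀ ε, MeasurableSet (Dt ε) := by
    intro ε
    rw [hDt]
    exact measurableSet_lt hdc.measurable measurable_const
  obtain ⟨U, hU, hDU, hdU, -⟩ := hC11
  obtain ⟨C, hC, hvol⟩ := exists_measure_signedDist_layer_le volume hD_open hD_bdd hD_ne hDc hdD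
    hdc hU hDU hdU hb
  have hDΩ : D ⊆ Ω := fun x hx => hDtsub ε₀ le_rfl (by
    rw [hDt]
    exact (hdD_neg x hx).trans hε₀)
  refine ⟨?_, ?_⟩
  · intro p hp
    have h0 := one_sub_toReal_one_div_nonneg hp.le
    refine ⟨C ^ (1 - (1 / p).toReal), by positivity, ?_⟩
    rintro ε ⟨hε, hεε₀⟩ h hh hfin
    have hΓsub : Γ ε ⊆ {x | |dD x| ≤ ε} := by
      intro x hx
      rw [hΓ, hDt, hDt] at hx
      have h1 : dD x < ε := hx.1
      have h2 : ¬dD x < -ε := fun h => hx.2 (subset_closure h)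
      exact abs_le.2 ⟨not_lt.1 h2, h1.le⟩
    have hnotΓ : ∀ x ∉ Γ ε, ω ε x = D.indicator 1 x := by
      intro x hx
      rw [hΓ, hDt, hDt, Set.mem_sdiff, not_and_or, not_not] at hx
      rcases hx with hx | hx
      · have h1 : ε ≤ dD x := not_lt.1 hx
        have hxD : x ∉ D := fun hxD => by linarith [hdD_neg x hxD]
        rw [indicator_of_notMem hxD, hω_zero ε hε x h1]
      · have h1 : dD x ≤ -ε :=
          closure_minimal (fun y (hy : dD y < -ε) => hy.le)
            (isClosed_le hdc continuous_const) hx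
        have hxD : x ∈ D := by
          by_contra hxD
          linarith [hdD_nonneg x hxD]
        rw [indicator_of_mem hxD, hω_one ε hε x h1, Pi.one_apply]
    have hvolDt : volume (Dt ε) ≠ ⊤ := (hΩ_bdd.subset (hDtsub ε hεε₀.le)).measure_lt_top.ne
    have hmain := enorm_setIntegral_mul_sub_setIntegral_le hD_open.measurableSet (hDt_meas ε)
      (G := Γ ε) (by rw [hΓ]; exact (hDt_meas ε).diff isClosed_closure.measurableSet)
      (hωc ε hε).measurable (fun x => (hω0 ε hε x).1) (fun x => (hω0 ε hε x).2)
      (fun x hx => hω_half ε hε x (hdD_neg x hx).le)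
      (fun x hx => hω_zero ε hε x (by rw [hDt] at hx; exact not_lt.1 hx))
      (hDtsub ε hεε₀.le) hnotΓ hvolDt hp.le hh hfin
    rw [← Real.enorm_eq_ofReal_abs]
    refine hmain.trans ?_
    rw [mul_comm, ← Real.mul_rpow hC.le hε.le, ← ENNReal.ofReal_rpow_of_nonneg (by positivity) h0]
    gcongr
    exact (measure_mono hΓsub).trans (hvol ε ⟨hε, hεε₀⟩)
  · intro h hh
    have hfr : volume {x | dD x = 0} = 0 := by
      have hlim : Tendsto (fun ε : ℝ => ENNReal.ofReal (C * ε)) (𝓝[>] 0) (𝓝 0) := by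
        have hcont : Continuous fun ε : ℝ => ENNReal.ofReal (C * ε) :=
          ENNReal.continuous_ofReal.comp (continuous_const_mul C)
        simpa using (hcont.tendsto 0).mono_left nhdsWithin_le_nhds
      refine le_antisymm (ge_of_tendsto hlim ?_) zero_le
      filter_upwards [Ioo_mem_nhdsGT hε₀] with ε hε
      refine (measure_mono fun x (hx : dD x = 0) => ?_).trans (hvol ε hε)
      simpa [hx] using hε.1.le
    have hind : ∫ x in D, h x = ∫ x in Ω, h x * D.indicator 1 x := by
      rw [← inter_eq_self_of_subset_right hDΩ, ← setIntegral_indicator hD_open.measurableSet,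
        inter_eq_self_of_subset_right hDΩ]
      refine integral_congr_ae (ae_of_all _ fun x => ?_)
      by_cases hx : x ∈ D <;> simp [hx]
    rw [hind]
    refine tendsto_sub_nhds_zero_iff.2 ?_
    refine tendsto_integral_filter_of_dominated_convergence (fun x => ‖h x‖) ?_ ?_ hh.norm ?_
    · filter_upwards [self_mem_nhdsWithin] with ε hε
      exact hh.aestronglyMeasurable.mul (hωc ε hε).aestronglyMeasurable
    · filter_upwards [self_mem_nhdsWithin] with ε hε
      refine ae_of_all _ fun x => ?_
      rw [norm_mul, Real.norm_of_nonneg (hω0 ε hε x).1]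
      exact mul_le_of_le_one_right (norm_nonneg _) (hω0 ε hε x).2
    · refine ae_restrict_of_ae ?_
      have hne : ∀ᵐ x, dD x ≠ 0 := measure_eq_zero_iff_ae_notMem.1 hfr
      filter_upwards [hne] with x hx
      refine Tendsto.const_mul _ (tendsto_const_nhds.congr' ?_)
      filter_upwards [Ioo_mem_nhdsGT (abs_pos.2 hx)] with ε hε
      by_cases hxD : x ∈ D
      · have := hε.2
        rw [abs_of_neg (hdD_neg x hxD)] at this
        rw [indicator_of_mem hxD, hω_one ε hε.1 x (by linarith), Pi.one_apply]
      · have := hε.2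
        rw [abs_of_nonneg (hdD_nonneg x hxD)] at this
        rw [indicator_of_notMem hxD, hω_zero ε hε.1 x this.le]
end
end
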